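/- arXiv:2111.10082 — 2 statements merged into one kernel-verified Lean document; each statement's English description precedes it below -/
import Mathlib

section
/- Let β > 1 and let ((Φ^{(i)})_{i∈I}, (p_i)_{i∈I}, ℙ) be a non-trivial Bernoulli model satisfying the strong separation condition such that log|r_i| / log β is irrational for some i ∈ I with ℙ([i]) > 0. Then there exists a non-trivial S-invariant, S-ergodic Borel probability measure Q on 𝒫([-1,1]) such that ℙ-almost every η^{(ω)} generates Q, and the pure point spectrum of the flow (𝒫([-1,1]), Q, (S_t)_{t≥0}) contains no nonzero integer multiple of 1/log β: there is no α = k/log β with k ∈ ℤ\{0} for which there exists a measurable φ : 𝒫([-1,1]) → ℂ, not Q-a.e. zero, satisfying φ(S_t ν) = e^{2πiαt}·φ(ν) for all t ≥ 0 on a set of full Q-measure. -/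
open MeasureTheory Filter Topology

noncomputable section

/-- The left shift on sequences. -/
def shiftSeq {I : Type*} (ω : ℕ → I) : ℕ → I := fun n => ω (n + 1)

/-- The coding map `Π_ω(u) = Σ_{n} (Π_{j<n} r_{ω_j}) · t^{(ω_n)}_{u_n}` of a model. -/
def coding {I : Type*} (k : I → ℕ) (r : I → ℝ) (t : (i : I) → Fin (k i) → ℝ)
    (ω : ℕ → I) (u : (n : ℕ) → Fin (k (ω n))) : ℝ :=
  ∑' n : ℕ, (∏ j ∈ Finset.range n, r (ω j)) * t (ω n) (u n)

/-- The set `Y^{(ω)}`, the image of the coding map. -/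
def Yset {I : Type*} (k : I → ℕ) (r : I → ℝ) (t : (i : I) → Fin (k i) → ℝ)
    (ω : ℕ → I) : Set ℝ :=
  Set.range (coding k r t ω)

/-- The measure `η^{(ω)} = (Π_ω)₌ η̄^{(ω)}`. -/
def etaMeas {I : Type*} (k : I → ℕ) (r : I → ℝ) (t : (i : I) → Fin (k i) → ℝ)
    (η' : (ω : ℕ → I) → Measure ((n : ℕ) → Fin (k (ω n)))) (ω : ℕ → I) : Measure ℝ :=
  Measure.map (coding k r t ω) (η' ω)

/-- The recentering of a measure `η` at `x`: `η_x(E) = η(E + x) / η([x-1,x+1])` for Borel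
`E ⊆ [-1,1]` (realized as a measure on `ℝ` supported on `[-1,1]`). -/
def recenter (η : Measure ℝ) (x : ℝ) : Measure ℝ :=
  (η (Set.Icc (x - 1) (x + 1)))⁻¹ •
    (Measure.map (fun y => y - x) η).restrict (Set.Icc (-1 : ℝ) 1)

/-- The scaling flow: `S_τ ν (E) = ν(e^{-τ}·E) / ν([-e^{-τ}, e^{-τ}])` for Borel
`E ⊆ [-1,1]` (realized as a measure on `ℝ` supported on `[-1,1]`). -/
def scaleM (τ : ℝ) (ν : Measure ℝ) : Measure ℝ :=
  (ν (Set.Icc (-(Real.exp (-τ))) (Real.exp (-τ))))⁻¹ •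
    (Measure.map (fun y => Real.exp τ * y) ν).restrict (Set.Icc (-1 : ℝ) 1)

open Classical in
/-- Package a measure on `ℝ` as a probability measure (with an irrelevant junk value when
it is not a probability measure). -/
def toProb (ν : Measure ℝ) : ProbabilityMeasure ℝ :=
  if h : IsProbabilityMeasure ν then ⟨ν, h⟩ else ⟨Measure.dirac 0, by infer_instance⟩

/-- Borel structure on the space of probability measures with its weak topology. -/
instance : MeasurableSpace (ProbabilityMeasure ℝ) := borel (ProbabilityMeasure ℝ)

instance : BorelSpace (ProbabilityMeasure ℝ) := ⟨rfl⟩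

/-- The scaling flow on probability measures. -/
def scaleFlow (τ : ℝ) (ν : ProbabilityMeasure ℝ) : ProbabilityMeasure ℝ :=
  toProb (scaleM τ (ν : Measure ℝ))

section Birkhoff
variable {X : Type*} [MeasurableSpace X] {m : Measure X} [IsProbabilityMeasure m] {T : X → X}

/-- Running maxima of the Birkhoff sums of `f`, defined recursively. -/
def maxBirkhoff (T : X → X) (f : X → ℝ) : ℕ → X → ℝ
  | 0, _ => 0
  | n + 1, x => max 0 (f x + maxBirkhoff T f n (T x))

omit [MeasurableSpace X] in
theorem maxBirkhoff_nonneg (f : X → ℝ) (n : ℕ) (x : X) : 0 ≤ maxBirkhoff T f n x := by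
  cases n <;> simp [maxBirkhoff]

omit [MeasurableSpace X] in
theorem maxBirkhoff_le_succ (f : X → ℝ) (n : ℕ) (x : X) :
    maxBirkhoff T f n x ≤ maxBirkhoff T f (n + 1) x := by
  induction n generalizing x with
  | zero => exact maxBirkhoff_nonneg f 1 x
  | succ n ih => exact max_le_max le_rfl (by gcongr; exact ih _)

omit [MeasurableSpace X] in
theorem birkhoffSum_le_maxBirkhoff (f : X → ℝ) (n : ℕ) (x : X) :
    birkhoffSum T f n x ≤ maxBirkhoff T f n x := by
  induction n generalizing x with
  | zero => simp [maxBirkhoff]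
  | succ n ih =>
    rw [birkhoffSum_succ']
    exact (add_le_add_right (ih _) _).trans (le_max_right _ _)

theorem measurable_maxBirkhoff (hT : Measurable T) {f : X → ℝ} (hf : Measurable f) (n : ℕ) :
    Measurable (maxBirkhoff T f n) := by
  induction n with
  | zero => exact measurable_const
  | succ n ih => exact measurable_const.max (hf.add (ih.comp hT))

omit [MeasurableSpace X] in
theorem maxBirkhoff_le {f : X → ℝ} {M : ℝ} (hM : 0 ≤ M) (hb : ∀ x, |f x| ≤ M) (n : ℕ) (x : X) :
    maxBirkhoff T f n x ≤ n * M := by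
  induction n generalizing x with
  | zero => simp [maxBirkhoff]
  | succ n ih =>
    refine max_le (by positivity) ?_
    have := (abs_le.1 (hb x)).2
    have := ih (T x)
    push_cast
    linarith

/-- The maximal ergodic theorem. -/
theorem integral_nonneg_of_exists_birkhoffSum_pos (hT : MeasurePreserving T m m) {f : X → ℝ}
    (hf : Measurable f) {M : ℝ} (hb : ∀ x, |f x| ≤ M)
    (hpos : ∀ᵐ x ∂m, ∃ n, 0 < birkhoffSum T f n x) : 0 ≤ ∫ x, f x ∂m := by
  obtain ⟨x₀⟩ : Nonempty X := m.nonempty_of_neZero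
  have hM : 0 ≤ M := (abs_nonneg _).trans (hb x₀)
  have hmeas := measurable_maxBirkhoff hT.measurable hf
  have h_integrable : ∀ n, Integrable (maxBirkhoff T f n) m := fun n =>
    Integrable.of_bound (hmeas n).aestronglyMeasurable (n * M) (ae_of_all _ fun x => by
      rw [Real.norm_eq_abs, abs_of_nonneg (maxBirkhoff_nonneg f n x)]
      exact maxBirkhoff_le hM hb n x)
  have hfint : Integrable f m :=
    Integrable.of_bound hf.aestronglyMeasurable M (ae_of_all _ hb)
  let E : ℕ → Set X := fun n => {x | 0 < maxBirkhoff T f n x}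
  have hE : ∀ n, MeasurableSet (E n) := fun n => measurableSet_lt measurable_const (hmeas n)
  have hEmono : ∀ x, Monotone fun n => maxBirkhoff T f n x := fun x =>
    monotone_nat_of_le_succ fun n => maxBirkhoff_le_succ f n x
  have key : ∀ n, 0 ≤ ∫ x, (E (n + 1)).indicator f x ∂m := by
    intro n
    have h1 : ∫ x, maxBirkhoff T f n x ∂m ≤
        ∫ x, ((E (n + 1)).indicator f x + maxBirkhoff T f n (T x)) ∂m := by
      refine integral_mono (h_integrable n) ((hfint.indicator (hE (n + 1))).add
        (hT.integrable_comp_of_integrable (h_integrable n))) fun x => ?_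
      refine (maxBirkhoff_le_succ f n x).trans ?_
      by_cases hx : x ∈ E (n + 1)
      · rw [Set.indicator_of_mem hx]
        have hx' : 0 < max 0 (f x + maxBirkhoff T f n (T x)) := hx
        have : max 0 (f x + maxBirkhoff T f n (T x)) = f x + maxBirkhoff T f n (T x) := by
          rcases lt_max_iff.1 hx' with h | h
          · exact absurd h (lt_irrefl _)
          · exact max_eq_right h.le
        exact this.le
      · rw [Set.indicator_of_notMem hx, zero_add]
        exact (not_lt.1 hx).trans (maxBirkhoff_nonneg f n _)
    have hcomp : Integrable (fun x => maxBirkhoff T f n (T x)) m :=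
      hT.integrable_comp_of_integrable (h_integrable n)
    rw [integral_add (hfint.indicator (hE _)) hcomp] at h1
    have h2 : ∫ x, maxBirkhoff T f n (T x) ∂m = ∫ x, maxBirkhoff T f n x ∂m := by
      rw [← integral_map (φ := T) hT.measurable.aemeasurable
        (by rw [hT.map_eq]; exact (hmeas n).aestronglyMeasurable), hT.map_eq]
    linarith
  have hlim : Tendsto (fun n => ∫ x, (E (n + 1)).indicator f x ∂m) atTop (𝓝 (∫ x, f x ∂m)) := by
    refine tendsto_integral_of_dominated_convergence (fun _ => M)
      (fun n => (hf.indicator (hE _)).aestronglyMeasurable) (integrable_const _)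
      (fun n => ae_of_all _ fun x => ?_) ?_
    · exact (norm_indicator_le_norm_self f x).trans (hb x)
    · filter_upwards [hpos] with x ⟨n, hn⟩
      refine tendsto_const_nhds.congr' ?_
      filter_upwards [eventually_ge_atTop n] with k hk
      rw [Set.indicator_of_mem]
      exact (hn.trans_le (birkhoffSum_le_maxBirkhoff f n x)).trans_le
        (hEmono x (hk.trans (Nat.le_succ k)))
  exact ge_of_tendsto' hlim key

omit [MeasurableSpace X] in
theorem abs_birkhoffAverage_le {f : X → ℝ} {M : ℝ} (hM : 0 ≤ M) (hb : ∀ x, |f x| ≤ M) (n : ℕ)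
    (x : X) : |birkhoffAverage ℝ T f n x| ≤ M := by
  rcases Nat.eq_zero_or_pos n with rfl | hn
  · simpa using hM
  have hn' : (0 : ℝ) < n := by exact_mod_cast hn
  rw [birkhoffAverage, smul_eq_mul, abs_mul, abs_inv, abs_of_pos hn', inv_mul_le_iff₀ hn']
  refine (Finset.abs_sum_le_sum_abs _ _).trans ((Finset.sum_le_sum fun k _ => hb _).trans ?_)
  simp

theorem ae_eventually_birkhoffAverage_lt (hT : Ergodic T m) {f : X → ℝ} (hf : Measurable f) {M : ℝ}
    (hb : ∀ x, |f x| ≤ M) {c : ℝ} (hc : ∫ x, f x ∂m < c) :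
    ∀ᵐ x ∂m, ∀ᶠ n in atTop, birkhoffAverage ℝ T f n x < c := by
  obtain ⟨x₀⟩ : Nonempty X := m.nonempty_of_neZero
  have hM : 0 ≤ M := (abs_nonneg _).trans (hb x₀)
  obtain ⟨d, hd, hdc⟩ := exists_between hc
  let A : ℕ → X → ℝ := fun n x => birkhoffAverage ℝ T f n x
  have hA : ∀ n x, |A n x| ≤ M := abs_birkhoffAverage_le hM hb
  have hAm : ∀ n, Measurable (A n) := fun n => by
    refine Measurable.const_smul (c := (n : ℝ)⁻¹) ?_
    exact Finset.measurable_sum _ fun k _ => hf.comp (hT.measurable.iterate k)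
  have hbdd : ∀ x, IsBoundedUnder (· ≤ ·) atTop fun n => A n x := fun x =>
    isBoundedUnder_of ⟨M, fun n => (abs_le.1 (hA n x)).2⟩
  have hbdd' : ∀ x, IsBoundedUnder (· ≥ ·) atTop fun n => A n x := fun x =>
    isBoundedUnder_of ⟨-M, fun n => (abs_le.1 (hA n x)).1⟩
  let l : X → ℝ := fun x => limsup (fun n => A n x) atTop
  have hl : Measurable l := Measurable.limsup hAm
  have hlT : l ∘ T = l := by
    funext x
    have h0 : Tendsto (fun n => A n (T x) - A n x) atTop (𝓝 0) :=
      tendsto_birkhoffAverage_apply_sub_birkhoffAverage' ℝ (g := f)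
        ((isBounded_iff_forall_norm_le).2 ⟨M, by rintro _ ⟨y, rfl⟩; exact hb y⟩) T x
    have h1 : ∀ u v : X, Tendsto (fun n => A n u - A n v) atTop (𝓝 0) → l u ≤ l v := by
      intro u v h
      refine le_of_forall_pos_le_add fun ε hε => ?_
      have e1 : ∀ᶠ n in atTop, A n v < l v + ε / 2 :=
        eventually_lt_of_limsup_lt (by linarith : limsup (fun n => A n v) atTop < l v + ε / 2)
          (hbdd v)
      refine limsup_le_of_le (hbdd' u).isCoboundedUnder_flip ?_
      filter_upwards [e1, h.eventually (gt_mem_nhds (half_pos hε))] with n h1 h2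
      linarith
    refine le_antisymm (h1 _ _ h0) (h1 _ _ ?_)
    simpa using h0.neg
  obtain ⟨ℓ, hℓ⟩ := hT.toPreErgodic.ae_eq_const_of_ae_eq_comp hl hlT
  have hℓd : ℓ ≤ d := by
    by_contra! hlt
    have : 0 ≤ ∫ x, (f x - d) ∂m := by
      refine integral_nonneg_of_exists_birkhoffSum_pos hT.toMeasurePreserving
        (f := fun x => f x - d) (M := M + |d|) (hf.sub_const d)
        (fun x => (abs_sub _ _).trans (by gcongr; exact hb x)) ?_
      filter_upwards [hℓ] with x hx
      have hx' : d < limsup (fun n => A n x) atTop := by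
        change l x = ℓ at hx; change d < l x; rw [hx]; exact hlt
      have hfr := frequently_lt_of_lt_limsup (hbdd' x).isCoboundedUnder_flip hx'
      obtain ⟨n, hn1, hn2⟩ := (hfr.and_eventually (eventually_gt_atTop 0)).exists
      refine ⟨n, ?_⟩
      have hn' : (0 : ℝ) < n := by exact_mod_cast hn2
      have hsum : birkhoffSum T (fun x => f x - d) n x = birkhoffSum T f n x - n * d := by
        simp [birkhoffSum]
      have : (n : ℝ) * d < birkhoffSum T f n x := by
        have h3 : d < (n : ℝ)⁻¹ * birkhoffSum T f n x := hn1
        rwa [lt_inv_mul_iff₀ hn'] at h3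
      rw [hsum]; linarith
    rw [integral_sub (Integrable.of_bound hf.aestronglyMeasurable M (ae_of_all _ hb))
      (integrable_const _)] at this
    simp at this
    linarith
  filter_upwards [hℓ] with x hx
  refine eventually_lt_of_limsup_lt (?_ : limsup (fun n => A n x) atTop < c) (hbdd x)
  change l x = ℓ at hx; change l x < c; rw [hx]; linarith

/-- Birkhoff's pointwise ergodic theorem for a bounded function and an ergodic map. -/
theorem ae_tendsto_birkhoffAverage (hT : Ergodic T m) {f : X → ℝ} (hf : Measurable f) {M : ℝ}
    (hb : ∀ x, |f x| ≤ M) :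
    ∀ᵐ x ∂m, Tendsto (fun n => birkhoffAverage ℝ T f n x) atTop (𝓝 (∫ x, f x ∂m)) := by
  have h1 : ∀ᵐ x ∂m, ∀ j : ℕ, ∀ᶠ n in atTop,
      birkhoffAverage ℝ T f n x < ∫ x, f x ∂m + 1 / ((j : ℝ) + 1) :=
    ae_all_iff.2 fun j => ae_eventually_birkhoffAverage_lt hT hf hb
      (lt_add_of_pos_right _ Nat.one_div_pos_of_nat)
  have h2 : ∀ᵐ x ∂m, ∀ j : ℕ, ∀ᶠ n in atTop,
      birkhoffAverage ℝ T (-f) n x < ∫ x, (-f) x ∂m + 1 / ((j : ℝ) + 1) :=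
    ae_all_iff.2 fun j => ae_eventually_birkhoffAverage_lt hT hf.neg
      (M := M) (fun x => by simpa using hb x) (lt_add_of_pos_right _ Nat.one_div_pos_of_nat)
  filter_upwards [h1, h2] with x h1 h2
  rw [Metric.tendsto_atTop]
  intro ε hε
  obtain ⟨j, hj⟩ := exists_nat_one_div_lt hε
  obtain ⟨N, hN⟩ := eventually_atTop.1 ((h1 j).and (h2 j))
  refine ⟨N, fun n hn => ?_⟩
  obtain ⟨ha, hb'⟩ := hN n hn
  rw [birkhoffAverage_neg] at hb'
  simp only [Pi.neg_apply, integral_neg] at hb'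
  rw [Real.dist_eq, abs_lt]
  constructor <;> linarith

end Birkhoff

section ProbabilityMeasureSpace

open scoped BoundedContinuousFunction NNReal ENNReal

/-- The probability measures on `ℝ` that are carried by `[-1,1]`. -/
def unitBallMeasures : Set (ProbabilityMeasure ℝ) :=
  {ν | (ν : Measure ℝ) (Set.Icc (-1 : ℝ) 1)ᶜ = 0}

theorem isCompact_unitBallMeasures : IsCompact unitBallMeasures := by
  have h := isCompact_setOfPred_probabilityMeasure_mass_eq_compl_isCompact_le
    (E := ℝ) (u := fun _ => 0) (K := fun _ => Set.Icc (-1 : ℝ) 1) tendsto_const_nhds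
    (fun _ => isCompact_Icc)
  have hset : unitBallMeasures =
      {μ : ProbabilityMeasure ℝ | ∀ _ : ℕ, μ (Set.Icc (-1 : ℝ) 1)ᶜ ≤ 0} := by
    ext ν
    simp [unitBallMeasures, ProbabilityMeasure.null_iff_toMeasure_null]
  rw [hset]
  exact h (Or.inl inferInstance)

theorem isInducing_lintegral :
    IsInducing fun (ν : ProbabilityMeasure ℝ) (f : ℝ →ᵇ ℝ≥0) => ∫⁻ x, f x ∂(ν : Measure ℝ) := by
  set Φ : ProbabilityMeasure ℝ → (ℝ →ᵇ ℝ≥0) → ℝ≥0∞ :=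
    fun ν f => ∫⁻ x, f x ∂(ν : Measure ℝ) with hΦ
  refine isInducing_iff_nhds.2 fun ν => le_antisymm ?_ ?_
  · rw [← tendsto_iff_comap]
    exact (continuous_pi fun f =>
      ProbabilityMeasure.continuous_lintegral_boundedContinuousFunction f).tendsto ν
  · refine (ProbabilityMeasure.tendsto_iff_forall_lintegral_tendsto
      (F := comap Φ (𝓝 (Φ ν))) (μs := id)).2 fun f => ?_
    have h : Tendsto Φ (comap Φ (𝓝 (Φ ν))) (𝓝 (Φ ν)) := tendsto_comap
    exact tendsto_pi_nhds.1 h f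

theorem measurable_toMeasure :
    Measurable fun ν : ProbabilityMeasure ℝ => (ν : Measure ℝ) := by
  refine Measurable.measure_of_isPiSystem_of_isProbabilityMeasure
    (S := {s : Set ℝ | IsClosed s}) ?_ isPiSystem_isClosed fun s hs => ?_
  · rw [← borel_eq_generateFrom_isClosed]; exact BorelSpace.measurable_eq
  · refine measurable_of_tendsto_metrizable (f := fun (n : ℕ) (ν : ProbabilityMeasure ℝ) =>
      ∫⁻ x, thickenedIndicator (δ := 1 / ((n : ℝ) + 1)) Nat.one_div_pos_of_nat s x ∂(ν : Measure ℝ))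
      (fun n => (ProbabilityMeasure.continuous_lintegral_boundedContinuousFunction _).measurable) ?_
    refine tendsto_pi_nhds.2 fun ν => ?_
    exact tendsto_lintegral_thickenedIndicator_of_isClosed (ν : Measure ℝ) hs _
      tendsto_one_div_add_atTop_nhds_zero_nat

theorem measurable_probabilityMeasure_of_mem {X : Type*} [MeasurableSpace X]
    {g : X → ProbabilityMeasure ℝ} (hK : ∀ x, g x ∈ unitBallMeasures)
    (hg : Measurable fun x => (g x : Measure ℝ)) : Measurable g := by
  let K := unitBallMeasures
  have : CompactSpace K := isCompact_iff_compactSpace.1 isCompact_unitBallMeasures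
  let : MetricSpace K := TopologicalSpace.metrizableSpaceMetric K
  have : SecondCountableTopology K := inferInstance
  let Φ : K → (ℝ →ᵇ ℝ≥0) → ℝ≥0∞ := fun ν f => ∫⁻ x, f x ∂((ν : ProbabilityMeasure ℝ) : Measure ℝ)
  have hΦ : IsInducing Φ := isInducing_lintegral.comp IsInducing.subtypeVal
  let S : Set (Set K) := {A | ∃ (f : ℝ →ᵇ ℝ≥0) (O : Set ℝ≥0∞), IsOpen O ∧
    A = (fun ν => Φ ν f) ⁻¹' O}
  have hS : (instTopologicalSpaceSubtype : TopologicalSpace K) =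
      TopologicalSpace.generateFrom S := by
    refine le_antisymm (le_generateFrom ?_) ?_
    · rintro _ ⟨f, O, hO, rfl⟩
      exact hO.preimage ((continuous_apply f).comp hΦ.continuous)
    · rw [hΦ.eq_induced]
      refine continuous_iff_le_induced.1 ?_
      refine @continuous_pi K (ℝ →ᵇ ℝ≥0) (fun _ => ℝ≥0∞) (TopologicalSpace.generateFrom S) _ Φ
        fun f => (@continuous_def _ _ (TopologicalSpace.generateFrom S) _ _).2 fun O hO => ?_
      exact TopologicalSpace.isOpen_generateFrom_of_mem ⟨f, O, hO, rfl⟩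
  have hb : (Subtype.instMeasurableSpace : MeasurableSpace K) =
      MeasurableSpace.generateFrom S := by
    rw [← borel_eq_generateFrom_of_subbasis hS]
    exact BorelSpace.measurable_eq
  have hg' : Measurable fun x => (⟨g x, hK x⟩ : K) := by
    rw [hb]
    refine measurable_generateFrom ?_
    rintro _ ⟨f, O, hO, rfl⟩
    exact ((Measure.measurable_lintegral
      (f.continuous.measurable.coe_nnreal_ennreal)).comp hg) hO.measurableSet
  exact measurable_subtype_coe.comp hg'

theorem coe_toProb {ν : Measure ℝ} (h : IsProbabilityMeasure ν) : (toProb ν : Measure ℝ) = ν := by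
  exact congrArg (fun μ : ProbabilityMeasure ℝ => (μ : Measure ℝ)) (dif_pos h)

theorem coe_toProb_of_not {ν : Measure ℝ} (h : ¬ IsProbabilityMeasure ν) :
    (toProb ν : Measure ℝ) = Measure.dirac 0 := by
  exact congrArg (fun μ : ProbabilityMeasure ℝ => (μ : Measure ℝ)) (dif_neg h)

theorem toProb_mem {ν : Measure ℝ} (h : ν (Set.Icc (-1 : ℝ) 1)ᶜ = 0) :
    toProb ν ∈ unitBallMeasures := by
  change (toProb ν : Measure ℝ) _ = 0
  by_cases hν : IsProbabilityMeasure ν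
  · rwa [coe_toProb hν]
  · rw [coe_toProb_of_not hν, Measure.dirac_apply' _ measurableSet_Icc.compl]
    simp

theorem measurable_toProb {X : Type*} [MeasurableSpace X] {F : X → Measure ℝ} (hF : Measurable F)
    (h : ∀ x, F x (Set.Icc (-1 : ℝ) 1)ᶜ = 0) : Measurable fun x => toProb (F x) := by
  classical
  refine measurable_probabilityMeasure_of_mem (fun x => toProb_mem (h x)) ?_
  have : (fun x => (toProb (F x) : Measure ℝ)) =
      fun x => if IsProbabilityMeasure (F x) then F x else Measure.dirac 0 := by
    funext x
    split_ifs with hx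
    · exact coe_toProb hx
    · exact coe_toProb_of_not hx
  rw [this]
  exact Measurable.ite (hF ProbabilityMeasure.measurableSet_isProbabilityMeasure) hF
    measurable_const

/-- The normalized restriction to `[-1,1]` of the image of `η` under `y ↦ c * (y - x)`. -/
def scenery (c x : ℝ) (η : Measure ℝ) : Measure ℝ :=
  (η ((fun y => c * (y - x)) ⁻¹' Set.Icc (-1 : ℝ) 1))⁻¹ •
    (Measure.map (fun y => c * (y - x)) η).restrict (Set.Icc (-1 : ℝ) 1)

theorem measurable_zoom (c x : ℝ) : Measurable fun y : ℝ => c * (y - x) := by fun_prop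

theorem scenery_apply (c x : ℝ) (η : Measure ℝ) {s : Set ℝ} (hs : MeasurableSet s) :
    scenery c x η s = (η ((fun y => c * (y - x)) ⁻¹' Set.Icc (-1 : ℝ) 1))⁻¹ *
      η ((fun y => c * (y - x)) ⁻¹' (s ∩ Set.Icc (-1 : ℝ) 1)) := by
  rw [scenery, Measure.smul_apply, smul_eq_mul, Measure.restrict_apply hs,
    Measure.map_apply (measurable_zoom c x) (hs.inter measurableSet_Icc)]

theorem scenery_compl (c x : ℝ) (η : Measure ℝ) : scenery c x η (Set.Icc (-1 : ℝ) 1)ᶜ = 0 := by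
  rw [scenery_apply _ _ _ measurableSet_Icc.compl]
  simp

theorem isProbabilityMeasure_scenery {c x : ℝ} {η : Measure ℝ} [IsFiniteMeasure η]
    (h : η ((fun y => c * (y - x)) ⁻¹' Set.Icc (-1 : ℝ) 1) ≠ 0) :
    IsProbabilityMeasure (scenery c x η) := by
  refine ⟨?_⟩
  rw [scenery_apply _ _ _ MeasurableSet.univ, Set.univ_inter]
  exact ENNReal.inv_mul_cancel h (measure_ne_top _ _)

theorem scaleM_eq_scenery (τ : ℝ) (ν : Measure ℝ) : scaleM τ ν = scenery (Real.exp τ) 0 ν := by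
  have : (fun y : ℝ => Real.exp τ * (y - 0)) ⁻¹' Set.Icc (-1 : ℝ) 1 =
      Set.Icc (-(Real.exp (-τ))) (Real.exp (-τ)) := by
    ext y
    have h := Real.exp_pos τ
    simp only [sub_zero, Set.mem_preimage, Set.mem_Icc, Real.exp_neg]
    rw [← abs_le, ← abs_le, abs_mul, abs_of_pos h, ← one_div, le_div_iff₀' h]
  rw [scaleM, scenery, this]
  simp

theorem recenter_eq_scenery (η : Measure ℝ) (x : ℝ) : recenter η x = scenery 1 x η := by
  have : (fun y : ℝ => 1 * (y - x)) ⁻¹' Set.Icc (-1 : ℝ) 1 = Set.Icc (x - 1) (x + 1) := by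
    ext y
    simp only [one_mul, Set.mem_preimage, Set.mem_Icc]
    constructor <;> rintro ⟨h1, h2⟩ <;> constructor <;> linarith
  rw [recenter, scenery, this]
  simp

theorem scenery_scenery {c c' x : ℝ} {η : Measure ℝ} [IsFiniteMeasure η] (hc' : 1 ≤ c')
    (h : η ((fun y => c' * c * (y - x)) ⁻¹' Set.Icc (-1 : ℝ) 1) ≠ 0) :
    scenery c' 0 (scenery c x η) = scenery (c' * c) x η := by
  have hpre : ∀ s : Set ℝ, (fun y => c * (y - x)) ⁻¹'
      ((fun y => c' * (y - 0)) ⁻¹' (s ∩ Set.Icc (-1 : ℝ) 1) ∩ Set.Icc (-1 : ℝ) 1) =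
      (fun y => c' * c * (y - x)) ⁻¹' (s ∩ Set.Icc (-1 : ℝ) 1) := by
    intro s
    ext y
    simp only [Set.mem_preimage, Set.mem_inter_iff, sub_zero, ← mul_assoc, and_iff_left_iff_imp]
    rintro ⟨-, hy⟩
    simp only [Set.mem_Icc, ← abs_le] at hy ⊢
    refine le_trans ?_ hy
    rw [mul_assoc, abs_mul c', abs_of_pos (by linarith : 0 < c')]
    exact le_mul_of_one_le_left (abs_nonneg _) hc'
  have hb := measure_ne_top η ((fun y => c' * c * (y - x)) ⁻¹' Set.Icc (-1 : ℝ) 1)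
  have ha := measure_ne_top η ((fun y => c * (y - x)) ⁻¹' Set.Icc (-1 : ℝ) 1)
  have h1 := hpre Set.univ
  rw [Set.univ_inter] at h1
  have hle : η ((fun y => c' * c * (y - x)) ⁻¹' Set.Icc (-1 : ℝ) 1) ≤
      η ((fun y => c * (y - x)) ⁻¹' Set.Icc (-1 : ℝ) 1) := by
    rw [← h1]; exact measure_mono (Set.preimage_mono Set.inter_subset_right)
  have ha0 : η ((fun y => c * (y - x)) ⁻¹' Set.Icc (-1 : ℝ) 1) ≠ 0 := fun h0 =>
    h (le_antisymm (h0 ▸ hle) (zero_le))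
  ext s hs
  rw [scenery_apply _ _ _ hs, scenery_apply _ _ _ hs,
    scenery_apply _ _ _ ((measurable_zoom c' 0) measurableSet_Icc),
    scenery_apply _ _ _ ((measurable_zoom c' 0) (hs.inter measurableSet_Icc)), hpre, h1,
    ENNReal.mul_inv (Or.inr hb) (Or.inr h), inv_inv]
  rw [mul_mul_mul_comm, ENNReal.mul_inv_cancel ha0 ha, one_mul]

theorem scenery_eq_of_local {c x x' r t : ℝ} {p : ℝ≥0∞} (hp0 : p ≠ 0) (hp : p ≠ ⊤)
    {η η' : Measure ℝ} (hx : x = r * x' + t)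
    (h : ∀ s ⊆ (fun y => c * (y - x)) ⁻¹' Set.Icc (-1 : ℝ) 1, MeasurableSet s →
      η s = p * η' ((fun y => r * y + t) ⁻¹' s)) :
    scenery c x η = scenery (c * r) x' η' := by
  have hpre : ∀ s : Set ℝ, (fun y => r * y + t) ⁻¹' ((fun y => c * (y - x)) ⁻¹' s) =
      (fun y => c * r * (y - x')) ⁻¹' s := by
    intro s
    rw [← Set.preimage_comp]
    congr 1
    funext y
    simp only [Function.comp, hx]
    ring
  ext s hs
  rw [scenery_apply _ _ _ hs, scenery_apply _ _ _ hs,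
    h _ subset_rfl ((measurable_zoom c x) measurableSet_Icc),
    h _ (Set.preimage_mono Set.inter_subset_right)
      ((measurable_zoom c x) (hs.inter measurableSet_Icc)), hpre, hpre,
    ENNReal.mul_inv (Or.inl hp0) (Or.inl hp), mul_mul_mul_comm, ENNReal.inv_mul_cancel hp0 hp,
    one_mul]

theorem measurable_scenery {X : Type*} [MeasurableSpace X] {c x : X → ℝ} {η : X → Measure ℝ}
    [∀ a, IsProbabilityMeasure (η a)]
    (hc : Measurable c) (hx : Measurable x) (hη : Measurable η) :
    Measurable fun a => scenery (c a) (x a) (η a) := by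
  let κ : ProbabilityTheory.Kernel X ℝ := ⟨η, hη⟩
  have : ProbabilityTheory.IsMarkovKernel κ :=
    ⟨fun a => by change IsProbabilityMeasure (η a); infer_instance⟩
  have key : ∀ s : Set ℝ, MeasurableSet s →
      Measurable fun a => η a ((fun y => c a * (y - x a)) ⁻¹' s) := by
    intro s hs
    have hm : MeasurableSet ((fun q : X × ℝ => c q.1 * (q.2 - x q.1)) ⁻¹' s) := by
      have hf : Measurable fun q : X × ℝ => c q.1 * (q.2 - x q.1) := by fun_prop
      exact hf hs
    exact ProbabilityTheory.Kernel.measurable_kernel_prodMk_left (κ := κ) hm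
  refine Measure.measurable_of_measurable_coe _ fun s hs => ?_
  simp only [scenery_apply _ _ _ hs]
  exact (key _ measurableSet_Icc).inv.mul (key _ (hs.inter measurableSet_Icc))

theorem measurable_scaleFlow (τ : ℝ) : Measurable (scaleFlow τ) := by
  refine measurable_toProb ?_ fun ν => ?_
  · simp only [scaleM_eq_scenery]
    exact measurable_scenery measurable_const measurable_const measurable_toMeasure
  · rw [scaleM_eq_scenery]; exact scenery_compl _ _ _

end ProbabilityMeasureSpace

section Sequences

open scoped ENNReal

variable {A : Type*}

/-- Prepend a letter to a sequence. -/
def consSeq (a : A) (z : ℕ → A) : ℕ → A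
  | 0 => a
  | n + 1 => z n

@[simp] theorem consSeq_zero (a : A) (z : ℕ → A) : consSeq a z 0 = a := rfl

@[simp] theorem consSeq_succ (a : A) (z : ℕ → A) (n : ℕ) : consSeq a z (n + 1) = z n := rfl

@[simp] theorem shiftSeq_consSeq (a : A) (z : ℕ → A) : shiftSeq (consSeq a z) = z := rfl

@[simp] theorem consSeq_shiftSeq (z : ℕ → A) : consSeq (z 0) (shiftSeq z) = z := by
  funext n; cases n <;> rfl

/-- The sequences that agree with `c` in the first `n` places. -/
def cyl (n : ℕ) (c : ℕ → A) : Set (ℕ → A) := {z | ∀ j < n, z j = c j}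

theorem consSeq_mem_cyl_succ {n : ℕ} {a : A} {c z : ℕ → A} :
    consSeq a z ∈ cyl (n + 1) c ↔ a = c 0 ∧ z ∈ cyl n (shiftSeq c) := by
  refine ⟨fun h => ⟨h 0 (Nat.succ_pos n), fun j hj => h (j + 1) (Nat.succ_lt_succ hj)⟩, ?_⟩
  rintro ⟨h0, h⟩ j hj
  cases j with
  | zero => exact h0
  | succ j => exact h j (Nat.lt_of_succ_lt_succ hj)

theorem isPiSystem_cyl : IsPiSystem {s : Set (ℕ → A) | ∃ n c, s = cyl n c} := by
  rintro _ ⟨n, c, rfl⟩ _ ⟨k, d, rfl⟩ ⟨z, hz1, hz2⟩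
  refine ⟨max n k, z, ?_⟩
  ext y
  constructor
  · rintro ⟨h1, h2⟩ j hj
    rcases lt_max_iff.1 hj with h | h
    · rw [h1 j h, hz1 j h]
    · rw [h2 j h, hz2 j h]
  · intro h
    exact ⟨fun j hj => (h j (lt_max_of_lt_left hj)).trans (hz1 j hj),
      fun j hj => (h j (lt_max_of_lt_right hj)).trans (hz2 j hj)⟩

variable [MeasurableSpace A]

theorem measurable_shiftSeq : Measurable (shiftSeq : (ℕ → A) → ℕ → A) :=
  measurable_pi_lambda _ fun n => measurable_pi_apply (n + 1)

theorem measurable_consSeq (a : A) : Measurable (consSeq a) :=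
  measurable_pi_lambda _ fun n => by
    cases n with
    | zero => exact measurable_const
    | succ n => exact measurable_pi_apply n

theorem measurableSet_cyl [MeasurableSingletonClass A] (n : ℕ) (c : ℕ → A) :
    MeasurableSet (cyl n c) := by
  have : cyl n c = ⋂ j, ⋂ (_ : j < n), (fun z : ℕ → A => z j) ⁻¹' {c j} := by
    ext z; simp [cyl]
  rw [this]
  exact MeasurableSet.iInter fun j => MeasurableSet.iInter fun _ =>
    measurable_pi_apply j (measurableSet_singleton _)

variable [Fintype A] [MeasurableSingletonClass A]

theorem generateFrom_cyl : (MeasurableSpace.pi : MeasurableSpace (ℕ → A)) =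
    MeasurableSpace.generateFrom {s : Set (ℕ → A) | ∃ n c, s = cyl n c} := by
  refine le_antisymm ?_ (MeasurableSpace.generateFrom_le ?_)
  · refine iSup_le fun n => ?_
    rw [← measurable_iff_comap_le]
    refine @measurable_to_countable' A (ℕ → A) _ _
      (MeasurableSpace.generateFrom {s : Set (ℕ → A) | ∃ n c, s = cyl n c}) _ fun a => ?_
    have : (fun z : ℕ → A => z n) ⁻¹' {a} = ⋃ w : Fin n → A,
        cyl (n + 1) (fun j => if h : j < n then w ⟨j, h⟩ else a) := by
      ext z
      simp only [Set.mem_preimage, Set.mem_singleton_iff, Set.mem_iUnion]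
      constructor
      · intro hz
        refine ⟨fun j => z j, fun j hj => ?_⟩
        by_cases h : j < n
        · simp [h]
        · have : j = n := by omega
          simp [this, hz]
      · rintro ⟨w, hw⟩
        simpa using hw n (Nat.lt_succ_self n)
    rw [this]
    exact MeasurableSet.iUnion fun w => MeasurableSpace.measurableSet_generateFrom ⟨_, _, rfl⟩
  · rintro _ ⟨n, c, rfl⟩
    exact measurableSet_cyl n c

theorem measure_ext_cyl {μ ν : Measure (ℕ → A)} [IsProbabilityMeasure μ] [IsProbabilityMeasure ν]
    (h : ∀ n c, μ (cyl n c) = ν (cyl n c)) : μ = ν := by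
  refine ext_of_generate_finite _ generateFrom_cyl isPiSystem_cyl ?_ (by simp)
  rintro _ ⟨n, c, rfl⟩
  exact h n c

theorem isProbabilityMeasure_sum_consSeq {w : A → ℝ≥0∞} (hw : ∑ a, w a = 1) (μ : Measure (ℕ → A))
    [IsProbabilityMeasure μ] : IsProbabilityMeasure (∑ a, w a • μ.map (consSeq a)) := by
  refine ⟨?_⟩
  rw [Measure.finsetSum_apply]
  simp only [Measure.smul_apply, smul_eq_mul]
  rw [← hw]
  refine Finset.sum_congr rfl fun a _ => ?_
  rw [Measure.map_apply (measurable_consSeq a) MeasurableSet.univ]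
  simp

theorem eq_sum_consSeq {w : A → ℝ≥0∞} (hw : ∑ a, w a = 1) {μ μ' : Measure (ℕ → A)}
    [IsProbabilityMeasure μ] [IsProbabilityMeasure μ']
    (h : ∀ n c, μ (cyl (n + 1) c) = w (c 0) * μ' (cyl n (shiftSeq c))) :
    μ = ∑ a, w a • μ'.map (consSeq a) := by
  classical
  have := isProbabilityMeasure_sum_consSeq hw μ'
  refine measure_ext_cyl fun n c => ?_
  cases n with
  | zero =>
    have : cyl 0 c = Set.univ := by ext; simp [cyl]
    rw [this, measure_univ, measure_univ]
  | succ n =>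
    rw [h, Measure.finsetSum_apply, Finset.sum_eq_single (c 0)]
    · rw [Measure.smul_apply, Measure.map_apply (measurable_consSeq _) (measurableSet_cyl _ _)]
      congr 2
      ext z
      simp [consSeq_mem_cyl_succ]
    · intro a _ ha
      rw [Measure.smul_apply, Measure.map_apply (measurable_consSeq _) (measurableSet_cyl _ _)]
      have : consSeq a ⁻¹' cyl (n + 1) c = ∅ := by
        ext z
        simp [consSeq_mem_cyl_succ, ha]
      simp [this]
    · simp

end Sequences

section Bernoulli

open scoped ENNReal

variable {A : Type*} [Fintype A] [MeasurableSpace A] [MeasurableSingletonClass A]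
  {w : A → ℝ≥0∞} {μ : Measure (ℕ → A)} [IsProbabilityMeasure μ]

theorem lintegral_bernoulli (hμ : μ = ∑ a, w a • μ.map (consSeq a)) {f : (ℕ → A) → ℝ≥0∞}
    (hf : Measurable f) : ∫⁻ z, f z ∂μ = ∑ a, w a * ∫⁻ z, f (consSeq a z) ∂μ := by
  conv_lhs => rw [hμ]
  rw [lintegral_finsetSum_measure]
  refine Finset.sum_congr rfl fun a _ => ?_
  rw [lintegral_smul_measure, lintegral_map hf (measurable_consSeq a), smul_eq_mul]

theorem ae_consSeq (hμ : μ = ∑ a, w a • μ.map (consSeq a)) {p : (ℕ → A) → Prop}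
    (h : ∀ᵐ z ∂μ, p z) {a : A} (ha : w a ≠ 0) : ∀ᵐ z ∂μ, p (consSeq a z) := by
  have h1 : w a • μ.map (consSeq a) ≤ μ := by
    conv_rhs => rw [hμ]
    exact Finset.single_le_sum (f := fun a => w a • μ.map (consSeq a))
      (fun _ _ => Measure.zero_le _) (Finset.mem_univ a)
  have h2 : ∀ᵐ z ∂(w a • μ.map (consSeq a)), p z := ae_mono h1 h
  rw [Measure.ae_ennreal_smul_measure_iff ha] at h2
  exact ae_of_ae_map (measurable_consSeq a).aemeasurable h2

theorem ae_of_consSeq (hμ : μ = ∑ a, w a • μ.map (consSeq a)) {p : (ℕ → A) → Prop}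
    (hp : MeasurableSet {z | p z}) (h : ∀ a, w a ≠ 0 → ∀ᵐ z ∂μ, p (consSeq a z)) :
    ∀ᵐ z ∂μ, p z := by
  rw [hμ, ← Measure.sum_fintype, Measure.ae_sum_iff]
  intro a
  by_cases ha : w a = 0
  · simp [ha]
  · rw [Measure.ae_ennreal_smul_measure_iff ha, ae_map_iff (measurable_consSeq a).aemeasurable hp]
    exact h a ha

theorem integral_bernoulli (hw : ∑ a, w a = 1) (hμ : μ = ∑ a, w a • μ.map (consSeq a))
    {f : (ℕ → A) → ℂ} (hf : Measurable f) {M : ℝ} (hb : ∀ z, ‖f z‖ ≤ M) :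
    ∫ z, f z ∂μ = ∑ a, (w a).toReal • ∫ z, f (consSeq a z) ∂μ := by
  have hwt : ∀ a, w a ≠ ⊤ := fun a => ne_top_of_le_ne_top ENNReal.one_ne_top
    (hw ▸ Finset.single_le_sum (fun _ _ => zero_le) (Finset.mem_univ a))
  conv_lhs => rw [hμ]
  rw [integral_finsetSum_measure]
  · refine Finset.sum_congr rfl fun a _ => ?_
    rw [integral_smul_measure, integral_map (measurable_consSeq a).aemeasurable
      hf.aestronglyMeasurable]
  · intro a _
    have : IsProbabilityMeasure (μ.map (consSeq a)) :=
      Measure.isProbabilityMeasure_map (measurable_consSeq a).aemeasurable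
    exact (Integrable.of_bound hf.aestronglyMeasurable M (ae_of_all _ hb)).smul_measure (hwt a)

theorem setIntegral_cyl_eq_zero (hw : ∑ a, w a = 1) (hμ : μ = ∑ a, w a • μ.map (consSeq a))
    {V : (ℕ → A) → ℂ} (hV : Measurable V) {M : ℝ} (hb : ∀ z, ‖V z‖ ≤ M) {χ : A → ℂ}
    (hχ : ∀ᵐ z ∂μ, V z = χ (z 0) * V (shiftSeq z)) (h0 : ∫ z, V z ∂μ = 0) (n : ℕ) (c : ℕ → A) :
    ∫ z in cyl n c, V z ∂μ = 0 := by
  induction n generalizing c with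
  | zero =>
    have : cyl 0 c = Set.univ := by ext; simp [cyl]
    simpa [this] using h0
  | succ n ih =>
    rw [← integral_indicator (measurableSet_cyl _ _),
      integral_bernoulli hw hμ (hV.indicator (measurableSet_cyl _ _)) (M := M)
        (fun z => (norm_indicator_le_norm_self _ _).trans (hb z))]
    refine Finset.sum_eq_zero fun a _ => ?_
    by_cases ha : w a = 0
    · simp [ha]
    by_cases hac : a = c 0
    · have h1 : ∀ᵐ z ∂μ, (cyl (n + 1) c).indicator V (consSeq a z) =
          χ a * (cyl n (shiftSeq c)).indicator V z := by
        filter_upwards [ae_consSeq hμ hχ ha] with z hz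
        by_cases hzc : z ∈ cyl n (shiftSeq c)
        · rw [Set.indicator_of_mem (consSeq_mem_cyl_succ.2 ⟨hac, hzc⟩),
            Set.indicator_of_mem hzc, hz]
          simp
        · rw [Set.indicator_of_notMem (fun h => hzc (consSeq_mem_cyl_succ.1 h).2),
            Set.indicator_of_notMem hzc, mul_zero]
      rw [integral_congr_ae h1, integral_const_mul, integral_indicator (measurableSet_cyl _ _), ih]
      simp
    · have h1 : ∀ z, (cyl (n + 1) c).indicator V (consSeq a z) = 0 := fun z =>
        Set.indicator_of_notMem (fun h => hac (consSeq_mem_cyl_succ.1 h).1) _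
      simp [h1]

/-- A mean-zero bounded eigenfunction of a one-sided Bernoulli shift, with a multiplier that depends
on the first letter only, vanishes. -/
theorem ae_eq_zero_of_integral_eq_zero (hw : ∑ a, w a = 1)
    (hμ : μ = ∑ a, w a • μ.map (consSeq a))
    {V : (ℕ → A) → ℂ} (hV : Measurable V) {M : ℝ} (hb : ∀ z, ‖V z‖ ≤ M) {χ : A → ℂ}
    (hχ : ∀ᵐ z ∂μ, V z = χ (z 0) * V (shiftSeq z)) (h0 : ∫ z, V z ∂μ = 0) :
    ∀ᵐ z ∂μ, V z = 0 := by
  have h_integrable : Integrable V μ :=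
    Integrable.of_bound hV.aestronglyMeasurable M (ae_of_all _ hb)
  refine h_integrable.ae_eq_zero_of_forall_setIntegral_eq_zero fun s hs _ => ?_
  refine MeasurableSpace.induction_on_inter (C := fun s _ => ∫ z in s, V z ∂μ = 0)
    generateFrom_cyl isPiSystem_cyl (by simp) ?_ (fun s hs ih => ?_)
    (fun f hd hf ih => ?_) s hs
  · rintro s ⟨n, c, rfl⟩
    exact setIntegral_cyl_eq_zero hw hμ hV hb hχ h0 n c
  · have := integral_add_compl hs h_integrable
    rw [h0, ih, zero_add] at this
    exact this
  · rw [integral_iUnion hf hd h_integrable.integrableOn]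
    simp [ih]

theorem eq_one_of_integral_ne_zero (hw : ∑ a, w a = 1) (hμ : μ = ∑ a, w a • μ.map (consSeq a))
    {V : (ℕ → A) → ℂ} (hV : Measurable V) {M : ℝ} (hb : ∀ z, ‖V z‖ ≤ M) {χ : A → ℂ}
    (hχ1 : ∀ a, ‖χ a‖ = 1) (hχ : ∀ᵐ z ∂μ, V z = χ (z 0) * V (shiftSeq z))
    (h0 : ∫ z, V z ∂μ ≠ 0) {a : A} (ha : w a ≠ 0) : χ a = 1 := by
  have hwt : ∀ a, w a ≠ ⊤ := fun a => ne_top_of_le_ne_top ENNReal.one_ne_top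
    (hw ▸ Finset.single_le_sum (fun _ _ => zero_le) (Finset.mem_univ a))
  have hwr : ∑ a, (w a).toReal = 1 := by
    rw [← ENNReal.toReal_sum fun a _ => hwt a, hw, ENNReal.toReal_one]
  have h1 : ∫ z, V z ∂μ = (∑ a, (w a).toReal • χ a) * ∫ z, V z ∂μ := by
    conv_lhs => rw [integral_bernoulli hw hμ hV hb]
    rw [Finset.sum_mul]
    refine Finset.sum_congr rfl fun a _ => ?_
    by_cases ha : w a = 0
    · simp [ha]
    have h2 : ∀ᵐ z ∂μ, V (consSeq a z) = χ a * V z := by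
      filter_upwards [ae_consSeq hμ hχ ha] with z hz
      simpa using hz
    rw [integral_congr_ae h2, integral_const_mul, smul_mul_assoc]
  have h2 : ∑ a, (w a).toReal • χ a = 1 := by
    have := mul_right_cancel₀ h0 ((one_mul _).trans h1)
    exact this.symm
  have h3 : ∑ a, (w a).toReal * (1 - (χ a).re) = 0 := by
    have := congrArg Complex.re h2
    simp only [Complex.re_sum, Complex.real_smul, Complex.re_ofReal_mul, Complex.one_re] at this
    simp only [mul_sub, mul_one, Finset.sum_sub_distrib, hwr, this, sub_self]
  have hle : ∀ a, (χ a).re ≤ 1 := fun a => (Complex.re_le_norm _).trans (hχ1 a).le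
  have h4 := (Finset.sum_eq_zero_iff_of_nonneg fun a _ =>
    mul_nonneg ENNReal.toReal_nonneg (sub_nonneg.2 (hle a))).1 h3 a (Finset.mem_univ a)
  have h5 : (χ a).re = 1 := by
    rcases mul_eq_zero.1 h4 with h | h
    · exact absurd h (ENNReal.toReal_ne_zero.2 ⟨ha, hwt a⟩)
    · linarith
  have h6 := Complex.sq_norm (χ a)
  rw [hχ1, Complex.normSq_apply, h5] at h6
  refine Complex.ext h5 ?_
  have : (χ a).im * (χ a).im = 0 := by linarith
  simpa using this

end Bernoulli

section SkewProduct

open scoped ENNReal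

theorem ae_prod_bool_iff {X : Type*} [MeasurableSpace X] {μ : Measure X} [SFinite μ]
    {l : Measure Bool} [SFinite l] {p : X × Bool → Prop} :
    (∀ᵐ x ∂μ.prod l, p x) ↔ ∀ b, l {b} ≠ 0 → ∀ᵐ z ∂μ, p (z, b) := by
  constructor
  · intro h b hb
    filter_upwards [Measure.ae_ae_of_ae_prod h] with z hz
    by_contra hc
    exact hb (measure_mono_null (by simpa using hc) hz)
  · intro h
    rw [ae_iff]
    have hsub : {x : X × Bool | ¬ p x} ⊆ ⋃ b : Bool, {z | ¬ p (z, b)} ×ˢ {b} := by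
      rintro ⟨z, b⟩ hz
      exact Set.mem_iUnion.2 ⟨b, hz, rfl⟩
    refine measure_mono_null hsub (measure_iUnion_null fun b => ?_)
    rw [Measure.prod_prod, mul_eq_zero]
    by_cases hb : l {b} = 0
    · exact Or.inr hb
    · exact Or.inl (h b hb)

variable {A : Type*} [Fintype A] [MeasurableSpace A] [MeasurableSingletonClass A]
  {w : A → ℝ≥0∞} {μ : Measure (ℕ → A)} [IsProbabilityMeasure μ]

theorem ae_weight_ne_zero (hμ : μ = ∑ a, w a • μ.map (consSeq a)) : ∀ᵐ z ∂μ, w (z 0) ≠ 0 := by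
  refine ae_of_consSeq hμ ?_ fun a ha => ae_of_all _ fun z => ha
  exact (measurable_pi_apply (X := fun _ : ℕ => A) 0) (Set.toFinite {a | w a ≠ 0}).measurableSet

theorem ae_eq_integral_of_invariant (hw : ∑ a, w a = 1) (hμ : μ = ∑ a, w a • μ.map (consSeq a))
    {V : (ℕ → A) → ℂ} (hV : Measurable V) {M : ℝ} (hb : ∀ z, ‖V z‖ ≤ M)
    (hinv : ∀ᵐ z ∂μ, V z = V (shiftSeq z)) : ∀ᵐ z ∂μ, V z = ∫ y, V y ∂μ := by
  have h_integrable : Integrable V μ :=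
    Integrable.of_bound hV.aestronglyMeasurable M (ae_of_all _ hb)
  have := ae_eq_zero_of_integral_eq_zero hw hμ (V := fun z => V z - ∫ y, V y ∂μ)
    (hV.sub_const _) (M := M + ‖∫ y, V y ∂μ‖)
    (fun z => (norm_sub_le _ _).trans (add_le_add_left (hb z) _)) (χ := fun _ => 1)
    (by filter_upwards [hinv] with z hz; simp [← hz])
    (by rw [integral_sub h_integrable (integrable_const _)]; simp)
  filter_upwards [this] with z hz
  exact sub_eq_zero.1 hz

/-- The extension of the shift by a sign cocycle depending on the first letter. -/
def skewShift (sg : A → Bool) (x : (ℕ → A) × Bool) : (ℕ → A) × Bool :=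
  (shiftSeq x.1, xor x.2 (sg (x.1 0)))

theorem measurable_skewShift (sg : A → Bool) : Measurable (skewShift sg) := by
  refine (measurable_shiftSeq.comp measurable_fst).prodMk ?_
  have h1 : Measurable fun x : Bool × Bool => xor x.1 x.2 := measurable_of_countable _
  have h2 : Measurable sg := measurable_of_countable _
  exact h1.comp (measurable_snd.prodMk
    (h2.comp ((measurable_pi_apply (X := fun _ : ℕ => A) 0).comp measurable_fst)))

variable {sg : A → Bool} {l : Measure Bool} [IsProbabilityMeasure l]

theorem measurePreserving_skewShift (hw : ∑ a, w a = 1) (hμ : μ = ∑ a, w a • μ.map (consSeq a))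
    (hinv : ∀ a, w a ≠ 0 → ∀ b, l {xor b (sg a)} = l {b}) :
    MeasurePreserving (skewShift sg) (μ.prod l) (μ.prod l) := by
  refine ⟨measurable_skewShift sg, Measure.ext_of_lintegral _ fun f hf => ?_⟩
  have hfb : ∀ b, Measurable fun z => f (z, b) := fun b => hf.comp measurable_prodMk_right
  rw [lintegral_map hf (measurable_skewShift sg),
    lintegral_prod (fun x => f (skewShift sg x)) (hf.comp (measurable_skewShift sg)).aemeasurable,
    lintegral_prod _ hf.aemeasurable]
  simp only [lintegral_fintype, Fintype.sum_bool]
  have hmeas : Measurable fun z => f (skewShift sg (z, true)) * l {true} +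
      f (skewShift sg (z, false)) * l {false} :=
    ((hf.comp ((measurable_skewShift sg).comp measurable_prodMk_right)).mul_const _).add
      ((hf.comp ((measurable_skewShift sg).comp measurable_prodMk_right)).mul_const _)
  rw [lintegral_bernoulli hμ hmeas]
  have key : ∀ a, w a * ∫⁻ z, (f (skewShift sg (consSeq a z, true)) * l {true} +
      f (skewShift sg (consSeq a z, false)) * l {false}) ∂μ =
      w a * ∫⁻ z, (f (z, true) * l {true} + f (z, false) * l {false}) ∂μ := by
    intro a
    by_cases ha : w a = 0
    · simp [ha]
    congr 2
    funext z
    have h1 := hinv a ha true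
    rcases hs : sg a with _ | _
    · simp [skewShift, hs]
    · simp only [hs, Bool.xor_true, Bool.not_true] at h1
      simp [skewShift, hs, h1, add_comm]
  rw [Finset.sum_congr rfl fun a _ => key a, ← Finset.sum_mul, hw, one_mul]

/-- The function `z ↦ ψ(z, +) + ε ψ(z, -)` attached to an eigenfunction of the sign extension
is an eigenfunction of the shift. -/
theorem ae_signSum_eq {θ : A → ℂ} {ψ : (ℕ → A) × Bool → ℂ}
    (h : ∀ᵐ x ∂μ.prod l, ψ x = θ (x.1 0) * ψ (skewShift sg x)) (hl : ∀ b, l {b} ≠ 0)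
    {ε : ℂ} (hε : ε * ε = 1) :
    ∀ᵐ z ∂μ, ψ (z, false) + ε * ψ (z, true) = (θ (z 0) * if sg (z 0) then ε else 1) *
      (ψ (shiftSeq z, false) + ε * ψ (shiftSeq z, true)) := by
  rw [ae_prod_bool_iff] at h
  filter_upwards [h false (hl false), h true (hl true)] with z h1 h2
  rw [h1, h2]
  rcases hs : sg (z 0) with _ | _
  · simp [skewShift, hs]; ring
  · simp [skewShift, hs]; linear_combination (- θ (z 0) * ψ (shiftSeq z, true)) * hε

theorem ae_eq_of_sign_trivial (hμ : μ = ∑ a, w a • μ.map (consSeq a))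
    (hinv : ∀ a, w a ≠ 0 → ∀ b, l {xor b (sg a)} = l {b}) (hf : l {false} ≠ 0)
    (ht : l {true} = 0) {θ : A → ℂ} {ψ : (ℕ → A) × Bool → ℂ}
    (h : ∀ᵐ x ∂μ.prod l, ψ x = θ (x.1 0) * ψ (skewShift sg x)) :
    ∀ᵐ z ∂μ, ψ (z, false) = θ (z 0) * ψ (shiftSeq z, false) := by
  rw [ae_prod_bool_iff] at h
  filter_upwards [h false hf, ae_weight_ne_zero hμ] with z h1 h2
  have h3 : sg (z 0) = false := by
    by_contra hc
    have := hinv _ h2 false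
    simp only [Bool.not_eq_false] at hc
    simp only [hc, Bool.xor_true, Bool.not_false] at this
    exact hf (this ▸ ht)
  simpa [skewShift, h3] using h1

theorem ae_eq_zero_of_eigenfunction_skewShift (hw : ∑ a, w a = 1)
    (hμ : μ = ∑ a, w a • μ.map (consSeq a))
    (hinv : ∀ a, w a ≠ 0 → ∀ b, l {xor b (sg a)} = l {b}) (hf : l {false} ≠ 0)
    {θ : A → ℂ} (hθ : ∀ a, ‖θ a‖ = 1) {ψ : (ℕ → A) × Bool → ℂ} (hψ : Measurable ψ) {M : ℝ}
    (hb : ∀ x, ‖ψ x‖ ≤ M) (h : ∀ᵐ x ∂μ.prod l, ψ x = θ (x.1 0) * ψ (skewShift sg x))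
    {a : A} (ha : w a ≠ 0) (ha2 : θ a ^ 2 ≠ 1) : ∀ᵐ x ∂μ.prod l, ψ x = 0 := by
  have hV : ∀ b, Measurable fun z => ψ (z, b) := fun b => hψ.comp measurable_prodMk_right
  rw [ae_prod_bool_iff]
  by_cases ht : l {true} = 0
  · have h1 := ae_eq_of_sign_trivial hμ hinv hf ht h
    have h2 : ∫ z, ψ (z, false) ∂μ = 0 := by
      by_contra hc
      have := eq_one_of_integral_ne_zero hw hμ (hV false) (fun z => hb _) hθ h1 hc ha
      exact ha2 (by rw [this, one_pow])
    have h3 := ae_eq_zero_of_integral_eq_zero hw hμ (hV false) (fun z => hb _) h1 h2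
    rintro (_ | _) hb
    · exact h3
    · exact absurd ht hb
  · have hl : ∀ b, l {b} ≠ 0 := by rintro (_ | _); exacts [hf, ht]
    have key : ∀ ε : ℂ, ε * ε = 1 → ∀ᵐ z ∂μ, ψ (z, false) + ε * ψ (z, true) = 0 := by
      intro ε hε
      have hn : ‖ε‖ = 1 := by
        have : ‖ε‖ * ‖ε‖ = 1 := by rw [← norm_mul, hε, norm_one]
        nlinarith [norm_nonneg ε]
      have h1 := ae_signSum_eq h hl hε
      have hm : Measurable fun z => ψ (z, false) + ε * ψ (z, true) :=
        (hV false).add ((hV true).const_mul ε)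
      have hbd : ∀ z, ‖ψ (z, false) + ε * ψ (z, true)‖ ≤ M + M := fun z =>
        (norm_add_le _ _).trans (add_le_add (hb _) (by rw [norm_mul, hn, one_mul]; exact hb _))
      refine ae_eq_zero_of_integral_eq_zero hw hμ hm hbd
        (χ := fun a => θ a * if sg a then ε else 1) h1 ?_
      by_contra hc
      have := eq_one_of_integral_ne_zero hw hμ hm hbd
        (χ := fun a => θ a * if sg a then ε else 1)
        (fun a => by rw [norm_mul, hθ]; split_ifs <;> simp [hn]) h1 hc ha
      apply ha2
      have h4 := congrArg (· ^ 2) this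
      simp only [mul_pow, one_pow] at h4
      split_ifs at h4
      · rwa [pow_two ε, hε, mul_one] at h4
      · simpa using h4
    have h3 : ∀ᵐ z ∂μ, ψ (z, false) = 0 ∧ ψ (z, true) = 0 := by
      filter_upwards [key 1 (by norm_num), key (-1) (by norm_num)] with z h1 h2
      exact ⟨by linear_combination (h1 + h2) / 2, by linear_combination (h1 - h2) / 2⟩
    rintro (_ | _) _
    · exact h3.mono fun z hz => hz.1
    · exact h3.mono fun z hz => hz.2

theorem ae_const_of_invariant_skewShift (hw : ∑ a, w a = 1)
    (hμ : μ = ∑ a, w a • μ.map (consSeq a))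
    (hinv : ∀ a, w a ≠ 0 → ∀ b, l {xor b (sg a)} = l {b}) (hf : l {false} ≠ 0)
    (herg : l {true} ≠ 0 → ∃ a, w a ≠ 0 ∧ sg a = true)
    {ψ : (ℕ → A) × Bool → ℂ} (hψ : Measurable ψ) {M : ℝ}
    (hb : ∀ x, ‖ψ x‖ ≤ M) (h : ∀ᵐ x ∂μ.prod l, ψ x = ψ (skewShift sg x)) :
    ∃ c, ∀ᵐ x ∂μ.prod l, ψ x = c := by
  have hV : ∀ b, Measurable fun z => ψ (z, b) := fun b => hψ.comp measurable_prodMk_right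
  have h : ∀ᵐ x ∂μ.prod l, ψ x = (fun _ : A => (1 : ℂ)) (x.1 0) * ψ (skewShift sg x) := by
    simpa using h
  simp only [ae_prod_bool_iff]
  by_cases ht : l {true} = 0
  · have h1 := ae_eq_of_sign_trivial (θ := fun _ => 1) (ψ := ψ) hμ hinv hf ht h
    refine ⟨∫ z, ψ (z, false) ∂μ, ?_⟩
    rintro (_ | _) hb'
    · exact ae_eq_integral_of_invariant hw hμ (hV false) (fun z => hb _) (by simpa using h1)
    · exact absurd ht hb'
  · have hl : ∀ b, l {b} ≠ 0 := by rintro (_ | _); exacts [hf, ht]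
    have hm : ∀ ε : ℂ, Measurable fun z => ψ (z, false) + ε * ψ (z, true) := fun ε =>
        (hV false).add ((hV true).const_mul ε)
    have hbd : ∀ ε : ℂ, ‖ε‖ = 1 → ∀ z, ‖ψ (z, false) + ε * ψ (z, true)‖ ≤ M + M := fun ε hn z =>
      (norm_add_le _ _).trans (add_le_add (hb _) (by rw [norm_mul, hn, one_mul]; exact hb _))
    have h1 := ae_eq_integral_of_invariant hw hμ (hm 1) (hbd 1 (by simp))
      (by simpa using ae_signSum_eq (θ := fun _ => 1) (ψ := ψ) h hl (ε := 1) (by norm_num))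
    have h2 : ∀ᵐ z ∂μ, ψ (z, false) + (-1) * ψ (z, true) = 0 := by
      have h3 := ae_signSum_eq (θ := fun _ => 1) (ψ := ψ) h hl (ε := -1) (by norm_num)
      refine ae_eq_zero_of_integral_eq_zero hw hμ (hm (-1)) (hbd (-1) (by simp))
        (χ := fun a => 1 * if sg a then -1 else 1) h3 ?_
      by_contra hc
      obtain ⟨a, ha, hs⟩ := herg ht
      have := eq_one_of_integral_ne_zero hw hμ (hm (-1)) (hbd (-1) (by simp))
        (χ := fun a => 1 * if sg a then -1 else 1)
        (fun a => by split_ifs <;> simp) h3 hc ha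
      norm_num [hs] at this
    generalize (∫ y, (ψ (y, false) + 1 * ψ (y, true)) ∂μ) = d at h1
    refine ⟨d / 2, ?_⟩
    rintro (_ | _) _
    · filter_upwards [h1, h2] with z h1 h2
      linear_combination (h1 + h2) / 2
    · filter_upwards [h1, h2] with z h1 h2
      linear_combination (h1 - h2) / 2

theorem ergodic_skewShift (hw : ∑ a, w a = 1)
    (hμ : μ = ∑ a, w a • μ.map (consSeq a))
    (hinv : ∀ a, w a ≠ 0 → ∀ b, l {xor b (sg a)} = l {b}) (hf : l {false} ≠ 0)
    (herg : l {true} ≠ 0 → ∃ a, w a ≠ 0 ∧ sg a = true) :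
    Ergodic (skewShift sg) (μ.prod l) := by
  refine ⟨measurePreserving_skewShift hw hμ hinv, ⟨fun s hs hinvs => ?_⟩⟩
  obtain ⟨c, hc⟩ := ae_const_of_invariant_skewShift hw hμ hinv hf herg (M := 1)
    (ψ := s.indicator 1) (measurable_one.indicator hs)
    (fun x => (norm_indicator_le_norm_self _ _).trans (by simp))
    (ae_of_all _ fun x => by
      have : x ∈ s ↔ skewShift sg x ∈ s := by rw [← Set.mem_preimage, hinvs]
      by_cases hx : x ∈ s
      · rw [Set.indicator_of_mem hx, Set.indicator_of_mem (this.1 hx)]; rfl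
      · rw [Set.indicator_of_notMem hx, Set.indicator_of_notMem (fun h => hx (this.2 h))])
  rw [eventuallyConst_set]
  by_cases h1 : c = 1
  · left
    filter_upwards [hc] with x hx
    by_contra hxs
    rw [Set.indicator_of_notMem hxs, h1] at hx
    exact zero_ne_one hx
  · right
    filter_upwards [hc] with x hx hxs
    rw [Set.indicator_of_mem hxs] at hx
    exact h1 hx.symm

end SkewProduct

section Suspension

open scoped ENNReal

/-- If, for almost every `s ∈ [0, ρ)`, the function `g` takes the value `g s` almost everywhere on
`[s, ∞)`, then `g` is almost everywhere constant on `[0, ∞)`. -/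
theorem exists_ae_eq_const_of_ae_translate {E : Type*} {g : ℝ → E} {ρ : ℝ} (hρ : 0 < ρ)
    (h : ∀ᵐ s : ℝ, 0 ≤ s → s < ρ → ∀ᵐ τ : ℝ, 0 ≤ τ → g (s + τ) = g s) :
    ∃ c, ∀ᵐ s : ℝ, 0 ≤ s → g s = c := by
  have shift : ∀ s : ℝ, (∀ᵐ τ : ℝ, 0 ≤ τ → g (s + τ) = g s) → ∀ᵐ t : ℝ, s ≤ t → g t = g s := by
    intro s hs
    filter_upwards [(quasiMeasurePreserving_add_left volume (-s)).ae hs] with t ht hst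
    simpa using ht (by linarith)
  obtain ⟨s₀, hs₀, h₀⟩ : ∃ s₀ ∈ Set.Ico 0 ρ, ∀ᵐ t : ℝ, s₀ ≤ t → g t = g s₀ := by
    have hpos : volume (Set.Ico 0 ρ) ≠ 0 := by simp [hρ]
    obtain ⟨s, hs, hs'⟩ := (frequently_ae_mem_iff.2 hpos).and_eventually h |>.exists
    exact ⟨s, hs, shift s (hs' hs.1 hs.2)⟩
  refine ⟨g s₀, ?_⟩
  filter_upwards [h, h₀] with s hs h0 hs0
  rcases lt_or_ge s ρ with hlt | hge
  · have hpos : volume (Set.Ioi (max s s₀)) ≠ 0 := by simp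
    obtain ⟨t, ht, h1, h2⟩ := ((frequently_ae_mem_iff.2 hpos).and_eventually
      ((shift s (hs hs0 hlt)).and h₀)).exists
    rw [← h1 ((le_max_left _ _).trans (le_of_lt ht)), h2 ((le_max_right _ _).trans (le_of_lt ht))]
  · exact h0 (hs₀.2.le.trans hge)

theorem indicator_one_congr {α β R : Type*} [Zero R] [One R] {s : Set α} {t : Set β} {x : α}
    {y : β} (h : x ∈ s ↔ y ∈ t) : s.indicator (1 : α → R) x = t.indicator (1 : β → R) y := by
  by_cases hx : x ∈ s
  · rw [Set.indicator_of_mem hx, Set.indicator_of_mem (h.1 hx), Pi.one_apply, Pi.one_apply]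
  · rw [Set.indicator_of_notMem hx, Set.indicator_of_notMem fun hy => hx (h.2 hy)]

theorem setLIntegral_Ico_add (f : ℝ → ℝ≥0∞) (u v τ : ℝ) :
    ∫⁻ s in Set.Ico u v, f (s + τ) = ∫⁻ s in Set.Ico (u + τ) (v + τ), f s := by
  rw [← lintegral_indicator measurableSet_Ico, ← lintegral_indicator measurableSet_Ico,
    ← lintegral_add_right_eq_self ((Set.Ico (u + τ) (v + τ)).indicator _) τ]
  simp [Set.indicator]

theorem setLIntegral_Ico_union_Ico (f : ℝ → ℝ≥0∞) {u v z : ℝ} (h1 : u ≤ v) (h2 : v ≤ z) :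
    ∫⁻ s in Set.Ico u z, f s = (∫⁻ s in Set.Ico u v, f s) + ∫⁻ s in Set.Ico v z, f s := by
  rw [← Set.Ico_union_Ico_eq_Ico h1 h2, lintegral_union measurableSet_Ico]
  exact Set.Ico_disjoint_Ico_same

variable {X Y : Type*} [MeasurableSpace X] [MeasurableSpace Y]

/-- The region under the graph of a roof function. -/
def underRoof (ρ : X → ℝ) : Set (X × ℝ) := {y | 0 ≤ y.2 ∧ y.2 < ρ y.1}

/-- The normalized measure on the region under a roof function. -/
def suspensionMeasure (m : Measure X) (ρ : X → ℝ) : Measure (X × ℝ) :=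
  (∫⁻ x, ENNReal.ofReal (ρ x) ∂m)⁻¹ • (m.prod volume).restrict (underRoof ρ)

/-- `F` is a semiconjugacy from the suspension semiflow over the ergodic map `T` with roof `ρ` to
the family `S`. -/
structure IsSuspensionFactor (m : Measure X) (T : X → X) (ρ : X → ℝ) (F : X × ℝ → Y)
    (S : ℝ → Y → Y) (a b : ℝ) : Prop where
  ergodic : Ergodic T m
  measurable_roof : Measurable ρ
  pos : 0 < a
  le_roof : ∀ x, a ≤ ρ x
  roof_le : ∀ x, ρ x ≤ b
  measurable_factor : Measurable F
  measurable_flow : ∀ τ, Measurable (S τ)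
  factor_add_roof : ∀ x s, 0 ≤ s → F (x, s + ρ x) = F (T x, s)
  flow_factor : ∀ τ x s, 0 ≤ τ → 0 ≤ s → S τ (F (x, s)) = F (x, s + τ)

theorem measurableSet_underRoof {ρ : X → ℝ} (hρ : Measurable ρ) : MeasurableSet (underRoof ρ) :=
  (measurableSet_le measurable_const measurable_snd).inter
    (measurableSet_lt measurable_snd (hρ.comp measurable_fst))

namespace IsSuspensionFactor

variable {m : Measure X} [IsProbabilityMeasure m] {T : X → X} {ρ : X → ℝ} {F : X × ℝ → Y}
  {S : ℝ → Y → Y} {a b : ℝ} (H : IsSuspensionFactor m T ρ F S a b)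

include H

theorem roof_pos (x : X) : 0 < ρ x := H.pos.trans_le (H.le_roof x)

theorem lintegral_roof_ne_zero : ∫⁻ x, ENNReal.ofReal (ρ x) ∂m ≠ 0 := by
  have : ENNReal.ofReal a ≤ ∫⁻ x, ENNReal.ofReal (ρ x) ∂m := by
    calc ENNReal.ofReal a = ∫⁻ _, ENNReal.ofReal a ∂m := by simp
      _ ≤ _ := lintegral_mono fun x => ENNReal.ofReal_le_ofReal (H.le_roof x)
  exact fun h => (ENNReal.ofReal_pos.2 H.pos).ne' (le_antisymm (h ▸ this) bot_le)

theorem lintegral_roof_ne_top : ∫⁻ x, ENNReal.ofReal (ρ x) ∂m ≠ ⊤ := by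
  have : ∫⁻ x, ENNReal.ofReal (ρ x) ∂m ≤ ENNReal.ofReal b := by
    calc ∫⁻ x, ENNReal.ofReal (ρ x) ∂m ≤ ∫⁻ _, ENNReal.ofReal b ∂m :=
        lintegral_mono fun x => ENNReal.ofReal_le_ofReal (H.roof_le x)
      _ = _ := by simp
  exact ne_top_of_le_ne_top ENNReal.ofReal_ne_top this

theorem lintegral_suspensionMeasure {g : X × ℝ → ℝ≥0∞} (hg : Measurable g) :
    ∫⁻ y, g y ∂suspensionMeasure m ρ = (∫⁻ x, ENNReal.ofReal (ρ x) ∂m)⁻¹ *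
      ∫⁻ x, (∫⁻ s in Set.Ico 0 (ρ x), g (x, s)) ∂m := by
  have hD := measurableSet_underRoof H.measurable_roof
  rw [suspensionMeasure, lintegral_smul_measure, ← lintegral_indicator hD,
    lintegral_prod _ (hg.indicator hD).aemeasurable, smul_eq_mul]
  congr 2
  funext x
  rw [← lintegral_indicator measurableSet_Ico]
  rfl

theorem isProbabilityMeasure_suspensionMeasure :
    IsProbabilityMeasure (suspensionMeasure m ρ) := by
  refine ⟨?_⟩
  rw [← lintegral_one, H.lintegral_suspensionMeasure measurable_const]
  simp only [lintegral_one, Measure.restrict_apply_univ, Real.volume_Ico, sub_zero]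
  exact ENNReal.inv_mul_cancel H.lintegral_roof_ne_zero H.lintegral_roof_ne_top

theorem isProbabilityMeasure_map : IsProbabilityMeasure ((suspensionMeasure m ρ).map F) := by
  have := H.isProbabilityMeasure_suspensionMeasure
  exact Measure.isProbabilityMeasure_map H.measurable_factor.aemeasurable

theorem ae_suspensionMeasure_iff {p : X × ℝ → Prop} :
    (∀ᵐ y ∂suspensionMeasure m ρ, p y) ↔ ∀ᵐ y ∂m.prod volume, 0 ≤ y.2 → y.2 < ρ y.1 → p y := by
  rw [suspensionMeasure, Measure.ae_ennreal_smul_measure_iff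
    (ENNReal.inv_ne_zero.2 H.lintegral_roof_ne_top),
    ae_restrict_iff' (measurableSet_underRoof H.measurable_roof)]
  simp [underRoof]

theorem map_flow {τ : ℝ} (hτ : 0 ≤ τ) :
    ((suspensionMeasure m ρ).map F).map (S τ) = (suspensionMeasure m ρ).map F := by
  ext E hE
  rw [Measure.map_map (H.measurable_flow τ) H.measurable_factor]
  have hSF := (H.measurable_flow τ).comp H.measurable_factor
  rw [Measure.map_apply hSF hE, Measure.map_apply H.measurable_factor hE,
    ← lintegral_indicator_one (hSF hE), ← lintegral_indicator_one (H.measurable_factor hE),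
    H.lintegral_suspensionMeasure (measurable_one.indicator (hSF hE)),
    H.lintegral_suspensionMeasure (measurable_one.indicator (H.measurable_factor hE))]
  congr 1
  set K : X → ℝ → ℝ≥0∞ := fun x s => (F ⁻¹' E).indicator 1 (x, s) with hK
  have hKm : Measurable (Function.uncurry K) :=
    measurable_one.indicator (H.measurable_factor hE)
  have hKx : ∀ x, Measurable (K x) := fun x => hKm.comp measurable_prodMk_left
  have hKτ : ∀ x, ∫⁻ s in Set.Ico 0 (ρ x), ((S τ ∘ F) ⁻¹' E).indicator 1 (x, s) =
      ∫⁻ s in Set.Ico τ (ρ x + τ), K x s := by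
    intro x
    have h1 := setLIntegral_Ico_add (K x) 0 (ρ x) τ
    rw [zero_add] at h1
    rw [← h1]
    refine setLIntegral_congr_fun measurableSet_Ico fun s hs => ?_
    have : (x, s) ∈ (S τ ∘ F) ⁻¹' E ↔ (x, s + τ) ∈ F ⁻¹' E := by
      simp only [Set.mem_preimage, Function.comp_apply, H.flow_factor τ x s hτ hs.1]
    exact indicator_one_congr this
  have hKT : ∀ x, ∫⁻ s in Set.Ico (ρ x) (ρ x + τ), K x s = ∫⁻ s in Set.Ico 0 τ, K (T x) s := by
    intro x
    have h1 := setLIntegral_Ico_add (K x) 0 τ (ρ x)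
    rw [zero_add, add_comm τ] at h1
    rw [← h1]
    refine setLIntegral_congr_fun measurableSet_Ico fun s hs => ?_
    have : (x, s + ρ x) ∈ F ⁻¹' E ↔ (T x, s) ∈ F ⁻¹' E := by
      simp only [Set.mem_preimage, H.factor_add_roof x s hs.1]
    exact indicator_one_congr this
  have hsum : ∀ x, (∫⁻ s in Set.Ico τ (ρ x + τ), K x s) + ∫⁻ s in Set.Ico 0 τ, K x s =
      (∫⁻ s in Set.Ico 0 (ρ x), K x s) + ∫⁻ s in Set.Ico 0 τ, K (T x) s := by
    intro x
    have hx := H.roof_pos x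
    rw [← hKT, add_comm, ← setLIntegral_Ico_union_Ico (K x) hτ (by linarith),
      ← setLIntegral_Ico_union_Ico (K x) hx.le (by linarith)]
  have hJ : Measurable fun x => ∫⁻ s in Set.Ico 0 τ, K x s := hKm.lintegral_prod_right'
  have hle : ∫⁻ x, (∫⁻ s in Set.Ico 0 τ, K x s) ∂m ≠ ⊤ := by
    have h1 : ∫⁻ x, (∫⁻ s in Set.Ico 0 τ, K x s) ∂m ≤ ∫⁻ x, ENNReal.ofReal τ ∂m := by
      refine lintegral_mono fun x => ?_
      calc ∫⁻ s in Set.Ico 0 τ, K x s ≤ ∫⁻ s in Set.Ico 0 τ, 1 :=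
            lintegral_mono fun s => Set.indicator_le_self' (by simp) _
        _ = ENNReal.ofReal τ := by simp
    exact ne_top_of_le_ne_top (by simp) h1
  have hT : ∫⁻ x, (∫⁻ s in Set.Ico 0 τ, K (T x) s) ∂m = ∫⁻ x, (∫⁻ s in Set.Ico 0 τ, K x s) ∂m :=
    H.ergodic.toMeasurePreserving.lintegral_comp hJ
  rw [lintegral_congr hKτ]
  refine (ENNReal.add_left_inj hle).1 ?_
  rw [← lintegral_add_right _ hJ, lintegral_congr hsum,
    lintegral_add_right _ (show Measurable fun x => ∫⁻ s in Set.Ico 0 τ, K (T x) s from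
      hJ.comp H.ergodic.measurable), hT]

end IsSuspensionFactor

end Suspension

section SuspensionErgodic

namespace IsSuspensionFactor

variable {X Y : Type*} [MeasurableSpace X] [MeasurableSpace Y]
  {m : Measure X} [IsProbabilityMeasure m] {T : X → X} {ρ : X → ℝ} {F : X × ℝ → Y}
  {S : ℝ → Y → Y} {a b : ℝ} (H : IsSuspensionFactor m T ρ F S a b)

include H

/-- A flow-invariant function on the suspension descends to the base. -/
theorem exists_base_function {g : X × ℝ → ℂ} (hg : Measurable g) (hb : ∀ y, ‖g y‖ ≤ 1)
    (hinv : ∀ τ, 0 ≤ τ → ∀ᵐ y ∂m.prod volume,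
      0 ≤ y.2 → y.2 < ρ y.1 → g (y.1, y.2 + τ) = g y)
    {θ : X → ℂ} (hθ : ∀ x s, 0 ≤ s → g (x, s + ρ x) = θ x * g (T x, s)) :
    ∃ ψ : X → ℂ, Measurable ψ ∧ (∀ x, ‖ψ x‖ ≤ 1) ∧
      (∀ᵐ x ∂m, ∀ᵐ s : ℝ, 0 ≤ s → g (x, s) = ψ x) ∧ ∀ᵐ x ∂m, ψ x = θ x * ψ (T x) := by
  have hconst : ∀ᵐ x ∂m, ∃ c, ∀ᵐ s : ℝ, 0 ≤ s → g (x, s) = c := by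
    have h1 : ∀ᵐ τ : ℝ, ∀ᵐ y ∂m.prod volume,
        0 ≤ τ → 0 ≤ y.2 → y.2 < ρ y.1 → g (y.1, y.2 + τ) = g y := by
      refine ae_of_all _ fun τ => ?_
      by_cases hτ : 0 ≤ τ
      · filter_upwards [hinv τ hτ] with y hy _ using hy
      · exact ae_of_all _ fun y h => absurd h hτ
    have hmeas : MeasurableSet {z : ℝ × X × ℝ | 0 ≤ z.1 → 0 ≤ z.2.2 → z.2.2 < ρ z.2.1 →
        g (z.2.1, z.2.2 + z.1) = g z.2} := by
      have m1 : Measurable fun z : ℝ × X × ℝ => (z.2.1, z.2.2 + z.1) :=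
        (measurable_fst.comp measurable_snd).prodMk
          ((measurable_snd.comp measurable_snd).add measurable_fst)
      have e : {z : ℝ × X × ℝ | 0 ≤ z.1 → 0 ≤ z.2.2 → z.2.2 < ρ z.2.1 →
        g (z.2.1, z.2.2 + z.1) = g z.2} = {z | 0 ≤ z.1}ᶜ ∪ ({z | 0 ≤ z.2.2}ᶜ ∪
          ({z | z.2.2 < ρ z.2.1}ᶜ ∪ {z | g (z.2.1, z.2.2 + z.1) = g z.2})) := by
        ext z
        simp only [Set.mem_ofPred_eq, Set.mem_union, Set.mem_compl_iff, imp_iff_not_or]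
      rw [e]
      refine (measurableSet_le measurable_const measurable_fst).compl.union
        ((measurableSet_le measurable_const (measurable_snd.comp measurable_snd)).compl.union
        ((measurableSet_lt (measurable_snd.comp measurable_snd)
          (H.measurable_roof.comp (measurable_fst.comp measurable_snd))).compl.union
        (measurableSet_eq_fun (hg.comp m1) (hg.comp measurable_snd))))
    rw [Measure.ae_ae_comm hmeas] at h1
    filter_upwards [Measure.ae_ae_of_ae_prod h1] with x hx
    refine exists_ae_eq_const_of_ae_translate (H.roof_pos x) ?_
    filter_upwards [hx] with s hs h0 hρ
    filter_upwards [hs] with τ hτ h using hτ h h0 hρ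
  have hψ : ∀ᵐ x ∂m, ∀ᵐ s : ℝ, 0 ≤ s → g (x, s) = ∫ s in Set.Icc (0 : ℝ) 1, g (x, s) := by
    filter_upwards [hconst] with x ⟨c, hc⟩
    have : ∫ s in Set.Icc (0 : ℝ) 1, g (x, s) = c := by
      rw [setIntegral_congr_ae (g := fun _ => c) measurableSet_Icc
        (hc.mono fun s hs h => hs h.1)]
      simp
    rwa [this]
  refine ⟨fun x => ∫ s in Set.Icc (0 : ℝ) 1, g (x, s), ?_, fun x => ?_, hψ, ?_⟩
  · have h1 : StronglyMeasurable (Function.uncurry fun x s => g (x, s)) := hg.stronglyMeasurable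
    exact (h1.integral_prod_right (ν := volume.restrict (Set.Icc (0 : ℝ) 1))).measurable
  · have := norm_setIntegral_le_of_norm_le_const (μ := volume) (s := Set.Icc (0 : ℝ) 1)
      (f := fun s => g (x, s)) (C := 1) (by simp) (fun s _ => hb _)
    simpa using this
  · filter_upwards [hψ, H.ergodic.quasiMeasurePreserving.ae hψ] with x h1 h2
    have h3 : ∀ᵐ s : ℝ, 0 ≤ s → g (x, s + ρ x) = ∫ s in Set.Icc (0 : ℝ) 1, g (x, s) := by
      filter_upwards [(quasiMeasurePreserving_add_right volume (ρ x)).ae h1] with s hs h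
      exact hs (add_nonneg h (H.roof_pos x).le)
    have hpos : volume (Set.Ici (0 : ℝ)) ≠ 0 := by simp
    obtain ⟨s, hs, h4, h5⟩ := ((frequently_ae_mem_iff.2 hpos).and_eventually (h2.and h3)).exists
    rw [← h5 hs, hθ x s hs, h4 hs]

theorem ae_underRoof_of_ae_map {p : Y → Prop}
    (h : ∀ᵐ y ∂(suspensionMeasure m ρ).map F, p y) :
    ∀ᵐ y ∂m.prod volume, 0 ≤ y.2 → y.2 < ρ y.1 → p (F y) :=
  H.ae_suspensionMeasure_iff.1 (ae_of_ae_map H.measurable_factor.aemeasurable h)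

theorem ae_map_of_ae_ae {p : Y → Prop} (hp : MeasurableSet {y | p y})
    (h : ∀ᵐ x ∂m, ∀ᵐ s : ℝ, 0 ≤ s → p (F (x, s))) :
    ∀ᵐ y ∂(suspensionMeasure m ρ).map F, p y := by
  rw [ae_map_iff H.measurable_factor.aemeasurable hp, H.ae_suspensionMeasure_iff]
  have h1 : ∀ᵐ y ∂m.prod volume, 0 ≤ y.2 → p (F y) := by
    rw [Measure.ae_prod_iff_ae_ae]
    · exact h
    · have : {y : X × ℝ | 0 ≤ y.2 → p (F y)} = {y | 0 ≤ y.2}ᶜ ∪ F ⁻¹' {y | p y} := by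
        ext y
        simp only [Set.mem_ofPred_eq, Set.mem_union, Set.mem_compl_iff, imp_iff_not_or,
          Set.mem_preimage]
      rw [this]
      exact (measurableSet_le measurable_const measurable_snd).compl.union
        (H.measurable_factor hp)
  filter_upwards [h1] with y hy h0 _ using hy h0

theorem measure_eq_zero_or_one {E : Set Y} (hE : MeasurableSet E)
    (hinv : ∀ τ, 0 ≤ τ → (suspensionMeasure m ρ).map F (symmDiff E (S τ ⁻¹' E)) = 0) :
    (suspensionMeasure m ρ).map F E = 0 ∨ (suspensionMeasure m ρ).map F E = 1 := by
  have := H.isProbabilityMeasure_map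
  obtain ⟨ψ, hψm, -, hψ, hψT⟩ := H.exists_base_function (g := (F ⁻¹' E).indicator 1)
    (measurable_one.indicator (H.measurable_factor hE))
    (fun y => (norm_indicator_le_norm_self _ _).trans (by simp)) (fun τ hτ => by
      have h1 : ∀ᵐ y ∂(suspensionMeasure m ρ).map F, y ∈ E ↔ S τ y ∈ E := by
        have h2 := measure_eq_zero_iff_ae_notMem.1 (hinv τ hτ)
        filter_upwards [h2] with y hy
        simp only [Set.mem_symmDiff, Set.mem_preimage] at hy
        tauto
      filter_upwards [H.ae_underRoof_of_ae_map h1] with y hy h0 hρ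
      have h3 := hy h0 hρ
      obtain ⟨x, s⟩ := y
      rw [H.flow_factor τ x s hτ h0] at h3
      exact indicator_one_congr h3.symm)
    (θ := fun _ => 1) (fun x s hs => by
      rw [one_mul]
      exact indicator_one_congr (by rw [Set.mem_preimage, Set.mem_preimage,
        H.factor_add_roof x s hs]))
  obtain ⟨c, hc⟩ := H.ergodic.ae_eq_const_of_ae_eq_comp₀ hψm.nullMeasurable
    (hψT.mono fun x hx => by simpa using hx.symm)
  by_cases h1 : c = 1
  · right
    rw [prob_compl_eq_zero_iff hE |>.symm]
    refine (H.ae_map_of_ae_ae (p := (· ∈ E)) hE ?_)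
    filter_upwards [hψ, hc] with x hx hcx
    filter_upwards [hx] with s hs h0
    by_contra hn
    have := hs h0
    rw [hcx, Set.indicator_of_notMem (show (x, s) ∉ F ⁻¹' E from hn), Function.const_apply,
      h1] at this
    exact zero_ne_one this
  · left
    refine measure_eq_zero_iff_ae_notMem.2 (H.ae_map_of_ae_ae (p := (· ∉ E)) hE.compl ?_)
    filter_upwards [hψ, hc] with x hx hcx
    filter_upwards [hx] with s hs h0 hn
    have := hs h0
    rw [hcx, Set.indicator_of_mem (show (x, s) ∈ F ⁻¹' E from hn), Function.const_apply] at this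
    exact h1 this.symm

theorem eigenfunction_ae_eq_zero {κ : ℝ}
    (hκ : ∀ ψ : X → ℂ, Measurable ψ → (∀ x, ‖ψ x‖ ≤ 1) →
      (∀ᵐ x ∂m, ψ x = Complex.exp (-(κ * ρ x : ℝ) * Complex.I) * ψ (T x)) → ∀ᵐ x ∂m, ψ x = 0)
    {φ : Y → ℂ} (hφ : Measurable φ)
    (h : ∀ᵐ y ∂(suspensionMeasure m ρ).map F, ∀ τ : ℝ, 0 ≤ τ →
      φ (S τ y) = Complex.exp ((κ * τ : ℝ) * Complex.I) * φ y) :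
    φ =ᵐ[(suspensionMeasure m ρ).map F] 0 := by
  set φ' : Y → ℂ := fun y => (‖φ y‖⁻¹ : ℝ) * φ y with hφ'
  have hφ'm : Measurable φ' := (Complex.measurable_ofReal.comp hφ.norm.inv).mul hφ
  have hφ'b : ∀ y, ‖φ' y‖ ≤ 1 := by
    intro y
    rw [hφ', norm_mul, Complex.norm_real, norm_inv, norm_norm]
    exact inv_mul_le_one
  have hexp : ∀ u : ℝ, ‖Complex.exp (u * Complex.I)‖ = 1 := Complex.norm_exp_ofReal_mul_I
  obtain ⟨ψ, hψm, hψb, hψ, hψT⟩ := H.exists_base_function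
    (g := fun y => Complex.exp (-(κ * y.2 : ℝ) * Complex.I) * φ' (F y))
    (((Complex.measurable_ofReal.comp (measurable_snd.const_mul κ)).neg.mul_const _).cexp.mul
      (hφ'm.comp H.measurable_factor))
    (fun y => by
      rw [norm_mul, ← Complex.ofReal_neg, hexp, one_mul]
      exact hφ'b _)
    (fun τ hτ => by
      filter_upwards [H.ae_underRoof_of_ae_map h] with y hy h0 hρ
      have h1 := hy h0 hρ τ hτ
      obtain ⟨x, s⟩ := y
      rw [H.flow_factor τ x s hτ h0] at h1
      simp only [hφ', h1, norm_mul, hexp, one_mul]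
      rw [← mul_assoc, ← mul_assoc, ← mul_assoc, mul_right_comm _ _ (Complex.exp _),
        ← Complex.exp_add]
      congr 3
      push_cast
      ring)
    (θ := fun x => Complex.exp (-(κ * ρ x : ℝ) * Complex.I)) (fun x s hs => by
      simp only [H.factor_add_roof x s hs, ← mul_assoc, ← Complex.exp_add]
      congr 2
      push_cast
      ring)
  have h0 := hκ ψ hψm hψb hψT
  refine H.ae_map_of_ae_ae (p := fun y => φ y = 0) (hφ (measurableSet_singleton 0)) ?_
  filter_upwards [hψ, h0] with x hx hx0
  filter_upwards [hx] with s hs h1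
  have h2 := hs h1
  rw [hx0, mul_eq_zero] at h2
  rcases h2 with h2 | h2
  · exact absurd h2 (Complex.exp_ne_zero _)
  · rcases mul_eq_zero.1 h2 with h3 | h3
    · simpa using h3
    · exact h3

end IsSuspensionFactor

end SuspensionErgodic

section SuspensionBirkhoff

/-- If the primitive of a bounded function, evaluated along a sequence growing linearly,
grows linearly, then the function has a time average. -/
theorem tendsto_average_of_tendsto_subsequence {h : ℝ → ℝ} (hh : Measurable h) {M : ℝ}
    (hM : ∀ s, |h s| ≤ M) {t : ℕ → ℝ} {ρ c : ℝ} (hρ : 0 < ρ)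
    (ht : Tendsto (fun n : ℕ => (n : ℝ)⁻¹ * t n) atTop (𝓝 ρ))
    (hc : Tendsto (fun n : ℕ => (n : ℝ)⁻¹ * ∫ s in (0 : ℝ)..t n, h s) atTop (𝓝 c)) :
    Tendsto (fun u : ℝ => u⁻¹ * ∫ s in (0 : ℝ)..u, h s) atTop (𝓝 (ρ⁻¹ * c)) := by
  have hii : ∀ u v : ℝ, IntervalIntegrable h volume u v := fun u v =>
    (intervalIntegrable_const (c := M)).mono_fun hh.aestronglyMeasurable
      (ae_of_all _ fun s => by
        exact (hM s).trans (le_abs_self M))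
  set n : ℝ → ℕ := fun u => ⌊ρ⁻¹ * u⌋₊ with hn
  have hn1 : Tendsto (fun u => (n u : ℝ) / u) atTop (𝓝 ρ⁻¹) :=
    tendsto_nat_floor_mul_div_atTop (inv_nonneg.2 hρ.le)
  have hn2 : Tendsto n atTop atTop :=
    tendsto_nat_floor_atTop.comp (tendsto_id.const_mul_atTop (inv_pos.2 hρ))
  have hne : ∀ᶠ u in atTop, (n u : ℝ) ≠ 0 :=
    (hn2.eventually_gt_atTop 0).mono fun u hu => Nat.cast_ne_zero.2 hu.ne'
  have h1 : Tendsto (fun u => u⁻¹ * ∫ s in (0 : ℝ)..t (n u), h s) atTop (𝓝 (ρ⁻¹ * c)) := by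
    refine (hn1.mul (hc.comp hn2)).congr' ?_
    filter_upwards [hne] with u hu
    simp only [Function.comp_apply]
    field_simp
  have h2 : Tendsto (fun u => u⁻¹ * t (n u)) atTop (𝓝 1) := by
    have := hn1.mul (ht.comp hn2)
    rw [inv_mul_cancel₀ hρ.ne'] at this
    refine this.congr' ?_
    filter_upwards [hne] with u hu
    simp only [Function.comp_apply]
    field_simp
  have h3 : Tendsto (fun u => u⁻¹ * ∫ s in t (n u)..u, h s) atTop (𝓝 0) := by
    have h4 : Tendsto (fun u : ℝ => M * |1 - u⁻¹ * t (n u)|) atTop (𝓝 0) := by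
      have := ((h2.const_sub 1).abs).const_mul M
      simpa using this
    refine squeeze_zero_norm' ?_ h4
    filter_upwards [eventually_gt_atTop 0] with u hu
    rw [norm_mul, norm_inv, Real.norm_of_nonneg hu.le]
    have h5 := intervalIntegral.norm_integral_le_of_norm_le_const (a := t (n u)) (b := u)
      (f := h) (C := M) fun s _ => hM s
    calc u⁻¹ * ‖∫ s in t (n u)..u, h s‖ ≤ u⁻¹ * (M * |u - t (n u)|) := by gcongr
      _ = M * |1 - u⁻¹ * t (n u)| := by
        rw [show u - t (n u) = u * (1 - u⁻¹ * t (n u)) by field_simp, abs_mul, abs_of_pos hu]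
        field_simp
  have := h1.add h3
  rw [add_zero] at this
  refine this.congr fun u => ?_
  rw [← mul_add, intervalIntegral.integral_add_adjacent_intervals (hii _ _) (hii _ _)]

namespace IsSuspensionFactor

variable {X Y : Type*} [MeasurableSpace X] [MeasurableSpace Y]
  {m : Measure X} [IsProbabilityMeasure m] {T : X → X} {ρ : X → ℝ} {F : X × ℝ → Y}
  {S : ℝ → Y → Y} {a b : ℝ} (H : IsSuspensionFactor m T ρ F S a b)

include H

theorem integral_indicator_underRoof {h : Y → ℝ} (x : X) :
    ∫ s, (underRoof ρ).indicator (fun y => h (F y)) (x, s) =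
      ∫ s in (0 : ℝ)..ρ x, h (F (x, s)) := by
  rw [intervalIntegral.integral_of_le (H.roof_pos x).le, ← integral_Ico_eq_integral_Ioc,
    ← integral_indicator measurableSet_Ico]
  rfl

theorem measurable_integral_roof {h : Y → ℝ} (hh : Measurable h) :
    Measurable fun x => ∫ s in (0 : ℝ)..ρ x, h (F (x, s)) := by
  have h1 : StronglyMeasurable (Function.uncurry fun x s =>
      (underRoof ρ).indicator (fun y => h (F y)) (x, s)) :=
    ((hh.comp H.measurable_factor).indicator
      (measurableSet_underRoof H.measurable_roof)).stronglyMeasurable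
  have h2 := (h1.integral_prod_right (ν := volume)).measurable
  simpa only [H.integral_indicator_underRoof] using h2

theorem integral_map_eq {h : Y → ℝ} (hh : Measurable h) {M : ℝ} (hM : ∀ y, |h y| ≤ M) :
    ∫ y, h y ∂(suspensionMeasure m ρ).map F =
      (∫ x, ρ x ∂m)⁻¹ * ∫ x, (∫ s in (0 : ℝ)..ρ x, h (F (x, s))) ∂m := by
  have hD := measurableSet_underRoof H.measurable_roof
  have hDf : (m.prod volume) (underRoof ρ) ≠ ⊤ := by
    have hsub : underRoof ρ ⊆ Set.univ ×ˢ Set.Ico 0 b :=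
      fun y hy => ⟨trivial, hy.1, hy.2.trans_le (H.roof_le _)⟩
    refine ne_top_of_le_ne_top ?_ (measure_mono hsub)
    rw [Measure.prod_prod]
    simp
  have h_integrable : Integrable ((underRoof ρ).indicator fun y => h (F y)) (m.prod volume) := by
    rw [integrable_indicator_iff hD]
    exact IntegrableOn.of_bound hDf.lt_top (hh.comp H.measurable_factor).aestronglyMeasurable M
      (ae_of_all _ fun y => hM _)
  have hR : (∫⁻ x, ENNReal.ofReal (ρ x) ∂m).toReal = ∫ x, ρ x ∂m :=
    (integral_eq_lintegral_of_nonneg_ae (ae_of_all _ fun x => (H.roof_pos x).le)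
      H.measurable_roof.aestronglyMeasurable).symm
  rw [integral_map H.measurable_factor.aemeasurable hh.aestronglyMeasurable, suspensionMeasure,
    integral_smul_measure, ← integral_indicator hD, integral_prod _ h_integrable,
    ENNReal.toReal_inv, hR,
    smul_eq_mul]
  simp only [H.integral_indicator_underRoof]

theorem birkhoffSum_integral_roof {h : Y → ℝ} (hh : Measurable h) {M : ℝ} (hM : ∀ y, |h y| ≤ M)
    (n : ℕ) (x : X) : birkhoffSum T (fun x => ∫ s in (0 : ℝ)..ρ x, h (F (x, s))) n x =
      ∫ s in (0 : ℝ)..birkhoffSum T ρ n x, h (F (x, s)) := by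
  induction n generalizing x with
  | zero => simp
  | succ n ih =>
    rw [birkhoffSum_succ', birkhoffSum_succ', ih]
    have hii : ∀ u v : ℝ, IntervalIntegrable (fun s => h (F (x, s))) volume u v := fun u v =>
      (intervalIntegrable_const (c := M)).mono_fun
        (hh.comp (H.measurable_factor.comp measurable_prodMk_left)).aestronglyMeasurable
        (ae_of_all _ fun s => by
          exact (hM _).trans (le_abs_self M))
    have hpos : 0 ≤ birkhoffSum T ρ n (T x) :=
      Finset.sum_nonneg fun _ _ => (H.roof_pos _).le
    rw [← intervalIntegral.integral_add_adjacent_intervals (hii 0 (ρ x))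
      (hii (ρ x) (ρ x + birkhoffSum T ρ n (T x)))]
    congr 1
    have h1 := intervalIntegral.integral_comp_add_right (a := 0) (b := birkhoffSum T ρ n (T x))
      (fun s => h (F (x, s))) (ρ x)
    rw [zero_add, add_comm (birkhoffSum T ρ n (T x))] at h1
    rw [← h1]
    refine intervalIntegral.integral_congr fun s hs => ?_
    rw [Set.uIcc_of_le hpos] at hs
    simp only [H.factor_add_roof x s hs.1]

theorem ae_tendsto_average {h : Y → ℝ} (hh : Measurable h) {M : ℝ} (hM : ∀ y, |h y| ≤ M) :
    ∀ᵐ x ∂m, Tendsto (fun u : ℝ => u⁻¹ * ∫ s in (0 : ℝ)..u, h (F (x, s))) atTop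
      (𝓝 (∫ y, h y ∂(suspensionMeasure m ρ).map F)) := by
  have hb : 0 ≤ b := by
    obtain ⟨x⟩ := nonempty_of_isProbabilityMeasure m
    exact (H.roof_pos x).le.trans (H.roof_le x)
  have hρb : ∀ x, |ρ x| ≤ b := fun x => by rw [abs_of_pos (H.roof_pos x)]; exact H.roof_le x
  have h_integrable : Integrable ρ m :=
    Integrable.of_bound H.measurable_roof.aestronglyMeasurable b (ae_of_all _ hρb)
  have hpos : 0 < ∫ x, ρ x ∂m := by
    have : ∫ _, a ∂m ≤ ∫ x, ρ x ∂m := integral_mono (integrable_const _) h_integrable H.le_roof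
    simp only [integral_const, probReal_univ, one_smul] at this
    exact H.pos.trans_le this
  have h1 := ae_tendsto_birkhoffAverage H.ergodic (H.measurable_integral_roof hh) (M := M * b)
    fun x => by
      have h5 := intervalIntegral.norm_integral_le_of_norm_le_const (a := 0) (b := ρ x)
        (f := fun s => h (F (x, s))) (C := M) fun s _ => hM _
      rw [sub_zero] at h5
      exact h5.trans (mul_le_mul_of_nonneg_left (hρb x) ((abs_nonneg _).trans (hM (F (x, 0)))))
  filter_upwards [h1, ae_tendsto_birkhoffAverage H.ergodic H.measurable_roof hρb] with x h1 h2
  rw [H.integral_map_eq hh hM]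
  refine tendsto_average_of_tendsto_subsequence
    (hh.comp (H.measurable_factor.comp measurable_prodMk_left)) (fun s => hM _)
    (t := fun n => birkhoffSum T ρ n x) hpos ?_ ?_
  · simpa [birkhoffAverage] using h2
  · simpa [birkhoffAverage, H.birkhoffSum_integral_roof hh hM] using h1

end IsSuspensionFactor

end SuspensionBirkhoff

section Symbolic

open scoped ENNReal

variable {A : Type*}

/-- The point coded by a sequence of letters, for the contractions `x ↦ ra a * x + ta a`. -/
def codePoint (ra ta : A → ℝ) (z : ℕ → A) : ℝ :=
  ∑' n : ℕ, (∏ j ∈ Finset.range n, ra (z j)) * ta (z n)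

variable [Fintype A] {ra ta : A → ℝ}

theorem exists_codePoint_bound (hr : ∀ a, |ra a| < 1) : ∃ u : ℕ → ℝ, Summable u ∧
    ∀ n (z : ℕ → A), ‖(∏ j ∈ Finset.range n, ra (z j)) * ta (z n)‖ ≤ u n := by
  obtain ⟨R, hR0, hR1, hR⟩ : ∃ R : ℝ, 0 ≤ R ∧ R < 1 ∧ ∀ a, |ra a| ≤ R := by
    rcases isEmpty_or_nonempty A with h | h
    · exact ⟨0, le_rfl, one_pos, fun a => h.elim a⟩
    · obtain ⟨a, ha⟩ := Finite.exists_max fun a => |ra a|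
      exact ⟨|ra a|, abs_nonneg _, hr a, ha⟩
  refine ⟨fun n => R ^ n * ∑ a, |ta a|, (summable_geometric_of_lt_one hR0 hR1).mul_right _,
    fun n z => ?_⟩
  rw [norm_mul, norm_prod, Real.norm_eq_abs]
  refine mul_le_mul ?_ ?_ (abs_nonneg _) (pow_nonneg hR0 _)
  · calc ∏ j ∈ Finset.range n, ‖ra (z j)‖ ≤ ∏ j ∈ Finset.range n, R :=
        Finset.prod_le_prod (fun _ _ => norm_nonneg _) fun j _ => hR _
      _ = R ^ n := by simp
  · exact Finset.single_le_sum (f := fun a => |ta a|) (fun _ _ => abs_nonneg _)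
      (Finset.mem_univ _)

theorem codePoint_consSeq (hr : ∀ a, |ra a| < 1) (a : A) (z : ℕ → A) :
    codePoint ra ta (consSeq a z) = ra a * codePoint ra ta z + ta a := by
  obtain ⟨u, hu, hb⟩ := exists_codePoint_bound (ta := ta) hr
  have hs : Summable fun n => (∏ j ∈ Finset.range n, ra (consSeq a z j)) * ta (consSeq a z n) :=
    Summable.of_norm_bounded hu fun n => hb n _
  rw [codePoint, hs.tsum_eq_zero_add, codePoint, ← tsum_mul_left, add_comm]
  simp only [Finset.prod_range_succ', consSeq_succ, consSeq_zero, Finset.range_zero,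
    Finset.prod_empty, one_mul]
  congr 2
  funext n
  ring

theorem codePoint_eq (hr : ∀ a, |ra a| < 1) (z : ℕ → A) :
    codePoint ra ta z = ra (z 0) * codePoint ra ta (shiftSeq z) + ta (z 0) := by
  rw [← codePoint_consSeq hr, consSeq_shiftSeq]

variable [TopologicalSpace A] [DiscreteTopology A]

theorem continuous_codePoint (hr : ∀ a, |ra a| < 1) : Continuous (codePoint ra ta) := by
  obtain ⟨u, hu, hb⟩ := exists_codePoint_bound (ta := ta) hr
  refine continuous_tsum (fun n => ?_) hu hb
  exact (continuous_finsetProd _ fun j _ =>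
    continuous_of_discreteTopology.comp (continuous_apply j)).mul
      (continuous_of_discreteTopology.comp (continuous_apply n))

theorem exists_cyl_subset_of_mem_nhds {z : ℕ → A} {s : Set (ℕ → A)} (hs : s ∈ 𝓝 z) :
    ∃ n, cyl n z ⊆ s := by
  obtain ⟨_, ⟨x, n, rfl⟩, hz, hsub⟩ :=
    (PiNat.isTopologicalBasis_cylinders fun _ : ℕ => A).mem_nhds_iff.1 hs
  refine ⟨n, fun y hy => hsub fun i hi => ?_⟩
  rw [hy i hi, hz i hi]

variable {I : Type*} {π : A → I}

/-- Compactness turns separation of the coded points into uniform separation. -/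
theorem exists_uniform_separation (hr : ∀ a, |ra a| < 1)
    (hsep : ∀ z z' : ℕ → A, (∀ n, π (z n) = π (z' n)) → z 0 ≠ z' 0 →
      codePoint ra ta z ≠ codePoint ra ta z') :
    ∃ δ > 0, ∀ z z' : ℕ → A, (∀ n, π (z n) = π (z' n)) → z 0 ≠ z' 0 →
      δ ≤ |codePoint ra ta z - codePoint ra ta z'| := by
  have hK : IsCompact {x : (ℕ → A) × (ℕ → A) | (∀ n, π (x.1 n) = π (x.2 n)) ∧ x.1 0 ≠ x.2 0} := by
    have hev : ∀ n, Continuous fun x : (ℕ → A) × (ℕ → A) => (x.1 n, x.2 n) := fun n =>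
      ((continuous_apply n).comp continuous_fst).prodMk ((continuous_apply n).comp continuous_snd)
    have e : {x : (ℕ → A) × (ℕ → A) | (∀ n, π (x.1 n) = π (x.2 n)) ∧ x.1 0 ≠ x.2 0} =
        (⋂ n, (fun x => (x.1 n, x.2 n)) ⁻¹' {y : A × A | π y.1 = π y.2}) ∩
          (fun x => (x.1 0, x.2 0)) ⁻¹' {y : A × A | y.1 ≠ y.2} := by
      ext x
      simp only [Set.mem_ofPred_eq, Set.mem_inter_iff, Set.mem_iInter, Set.mem_preimage]
    have hcl : IsClosed {x : (ℕ → A) × (ℕ → A) | (∀ n, π (x.1 n) = π (x.2 n)) ∧ x.1 0 ≠ x.2 0} := by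
      rw [e]
      exact (isClosed_iInter fun n => (isClosed_discrete _).preimage (hev n)).inter
        ((isClosed_discrete _).preimage (hev 0))
    exact hcl.isCompact
  have hg : Continuous fun x : (ℕ → A) × (ℕ → A) =>
      |codePoint ra ta x.1 - codePoint ra ta x.2| :=
    (((continuous_codePoint (ta := ta) hr).comp continuous_fst).sub
      ((continuous_codePoint (ta := ta) hr).comp continuous_snd)).abs
  obtain ⟨δ, hδ, h⟩ := hK.exists_forall_le' (a := 0) hg.continuousOn
    (fun x hx => abs_pos.2 (sub_ne_zero.2 (hsep _ _ hx.1 hx.2)))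
  exact ⟨δ, hδ, fun z z' h1 h2 => h (z, z') ⟨h1, h2⟩⟩

end Symbolic

section SymbolicModel

open scoped ENNReal

variable {A I : Type*} [Fintype A] [MeasurableSpace A] [MeasurableSingletonClass A]
  [TopologicalSpace A] [DiscreteTopology A]

/-- The symbolic description of a model: `κ ω` is the product measure with marginals `W (ω n)`,
and `W i` charges exactly the letters above `i`. -/
structure IsSymbolicModel (π : A → I) (ra ta : A → ℝ) (W : I → A → ℝ≥0∞)
    (κ : (ℕ → I) → Measure (ℕ → A)) : Prop where
  abs_lt_one : ∀ a, |ra a| < 1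
  ratio_ne_zero : ∀ a, ra a ≠ 0
  sum_weight : ∀ i, ∑ a, W i a = 1
  weight_ne_zero_iff : ∀ i a, W i a ≠ 0 ↔ π a = i
  isProbabilityMeasure : ∀ ω, IsProbabilityMeasure (κ ω)
  measure_cyl : ∀ ω n c, κ ω (cyl n c) = ∏ j ∈ Finset.range n, W (ω j) (c j)
  separated : ∀ z z' : ℕ → A, (∀ n, π (z n) = π (z' n)) → z 0 ≠ z' 0 →
    codePoint ra ta z ≠ codePoint ra ta z'

namespace IsSymbolicModel

variable {π : A → I} {ra ta : A → ℝ} {W : I → A → ℝ≥0∞} {κ : (ℕ → I) → Measure (ℕ → A)}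
  (H : IsSymbolicModel π ra ta W κ)

include H

theorem eq_sum (ω : ℕ → I) : κ ω = ∑ a, W (ω 0) a • (κ (shiftSeq ω)).map (consSeq a) := by
  have := H.isProbabilityMeasure ω
  have := H.isProbabilityMeasure (shiftSeq ω)
  refine eq_sum_consSeq (H.sum_weight _) fun n c => ?_
  rw [H.measure_cyl, H.measure_cyl, Finset.prod_range_succ', mul_comm]
  rfl

theorem ae_fiber (ω : ℕ → I) : ∀ᵐ z ∂κ ω, ∀ n, π (z n) = ω n := by
  rw [ae_all_iff]
  intro n
  induction n generalizing ω with
  | zero =>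
    rw [H.eq_sum ω, ← Measure.sum_fintype, Measure.ae_sum_iff]
    intro a
    by_cases ha : W (ω 0) a = 0
    · simp [ha]
    · rw [Measure.ae_ennreal_smul_measure_iff ha, ae_map_iff (measurable_consSeq a).aemeasurable]
      · exact ae_of_all _ fun z => (H.weight_ne_zero_iff _ _).1 ha
      · exact (measurable_pi_apply (X := fun _ : ℕ => A) 0)
          (Set.toFinite {a | π a = ω 0}).measurableSet
  | succ n ih =>
    rw [H.eq_sum ω, ← Measure.sum_fintype, Measure.ae_sum_iff]
    intro a
    refine Measure.ae_smul_measure ?_ _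
    rw [ae_map_iff (measurable_consSeq a).aemeasurable]
    · exact ih (shiftSeq ω)
    · exact (measurable_pi_apply (X := fun _ : ℕ => A) (n + 1))
          (Set.toFinite {a | π a = ω (n + 1)}).measurableSet

theorem measurable_codePoint : Measurable (codePoint ra ta) := by
  have : DiscreteMeasurableSpace A := MeasurableSingletonClass.toDiscreteMeasurableSpace
  exact (continuous_codePoint H.abs_lt_one).measurable

theorem isProbabilityMeasure_map (ω : ℕ → I) :
    IsProbabilityMeasure ((κ ω).map (codePoint ra ta)) := by
  have := H.isProbabilityMeasure ω
  exact Measure.isProbabilityMeasure_map H.measurable_codePoint.aemeasurable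

theorem measure_zoom_ne_zero (z : ℕ → A) (c : ℝ) :
    (κ (π ∘ z)).map (codePoint ra ta)
      ((fun y => c * (y - codePoint ra ta z)) ⁻¹' Set.Icc (-1) 1) ≠ 0 := by
  have hc : Continuous fun y => c * (y - codePoint ra ta z) := by fun_prop
  rw [Measure.map_apply H.measurable_codePoint (hc.measurable measurableSet_Icc)]
  have hnhds : codePoint ra ta ⁻¹' ((fun y => c * (y - codePoint ra ta z)) ⁻¹' Set.Icc (-1) 1)
      ∈ 𝓝 z := by
    refine (hc.comp
      (continuous_codePoint (ta := ta) H.abs_lt_one)).continuousAt.preimage_mem_nhds ?_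
    exact Icc_mem_nhds (by simp) (by simp)
  obtain ⟨n, hn⟩ := exists_cyl_subset_of_mem_nhds hnhds
  refine fun h => ?_
  have h1 := measure_mono_null hn h
  rw [H.measure_cyl, Finset.prod_eq_zero_iff] at h1
  obtain ⟨j, -, hj⟩ := h1
  exact (H.weight_ne_zero_iff (π (z j)) (z j)).2 rfl hj

theorem map_apply_of_subset_ball {δ : ℝ} (hδ : ∀ z z' : ℕ → A, (∀ n, π (z n) = π (z' n)) →
      z 0 ≠ z' 0 → δ ≤ |codePoint ra ta z - codePoint ra ta z'|) (z : ℕ → A) {s : Set ℝ}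
    (hs : MeasurableSet s) (hsub : ∀ y ∈ s, |codePoint ra ta z - y| < δ) :
    (κ (π ∘ z)).map (codePoint ra ta) s = W (π (z 0)) (z 0) *
      (κ (π ∘ shiftSeq z)).map (codePoint ra ta) ((fun y => ra (z 0) * y + ta (z 0)) ⁻¹' s) := by
  classical
  have hshift : shiftSeq (π ∘ z) = π ∘ shiftSeq z := rfl
  have haff : Measurable fun y : ℝ => ra (z 0) * y + ta (z 0) := by fun_prop
  rw [Measure.map_apply H.measurable_codePoint hs, Measure.map_apply H.measurable_codePoint
    (haff hs), H.eq_sum, Measure.finsetSum_apply, Finset.sum_eq_single (z 0), hshift]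
  · rw [Measure.smul_apply, Measure.map_apply (measurable_consSeq _) (H.measurable_codePoint hs),
      smul_eq_mul]
    congr 2
    ext y
    simp [codePoint_consSeq H.abs_lt_one]
  · intro a _ ha
    by_cases hw : W ((π ∘ z) 0) a = 0
    · rw [Measure.smul_apply, hw, zero_smul]
    rw [Measure.smul_apply, Measure.map_apply (measurable_consSeq _) (H.measurable_codePoint hs),
      smul_eq_mul, mul_eq_zero]
    right
    rw [measure_eq_zero_iff_ae_notMem]
    filter_upwards [H.ae_fiber (shiftSeq (π ∘ z))] with y hy hys
    refine (hsub _ hys).not_ge (hδ _ _ (fun n => ?_) ha.symm)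
    cases n with
    | zero => exact ((H.weight_ne_zero_iff _ _).1 hw).symm
    | succ n => exact (hy n).symm
  · simp

end IsSymbolicModel

end SymbolicModel

section Averages

theorem tendsto_average_of_shift {u : ℝ → ℝ} (hu : ∀ a b, IntervalIntegrable u volume a b)
    {C L : ℝ} (h : Tendsto (fun T : ℝ => T⁻¹ * ∫ s in (0 : ℝ)..T, u (C + s)) atTop (𝓝 L)) :
    Tendsto (fun T : ℝ => T⁻¹ * ∫ s in (0 : ℝ)..T, u s) atTop (𝓝 L) := by
  have hT : Tendsto (fun T : ℝ => T - C) atTop atTop := tendsto_atTop_add_const_right _ _ tendsto_id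
  have h1 := h.comp hT
  have hz : Tendsto (fun T : ℝ => T⁻¹ * ∫ s in (0 : ℝ)..C, u s) atTop (𝓝 0) := by
    simpa using tendsto_inv_atTop_zero.mul_const (∫ s in (0 : ℝ)..C, u s)
  have hone : Tendsto (fun T : ℝ => 1 - T⁻¹ * C) atTop (𝓝 1) := by
    simpa using (tendsto_inv_atTop_zero.mul_const C).const_sub 1
  have h2 := hz.add (hone.mul h1)
  rw [zero_add, one_mul] at h2
  refine h2.congr' ?_
  filter_upwards [eventually_gt_atTop 0, eventually_gt_atTop C] with T hT0 hTC
  have e : ∫ s in (0 : ℝ)..(T - C), u (C + s) = ∫ s in C..T, u s := by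
    rw [intervalIntegral.integral_comp_add_left (fun s => u s)]
    simp
  rw [← intervalIntegral.integral_add_adjacent_intervals (hu 0 C) (hu C T)]
  simp only [Function.comp_apply, e]
  have : T - C ≠ 0 := (sub_pos.2 hTC).ne'
  field_simp

theorem tendsto_average_of_approx {Y : Type*} [MeasurableSpace Y] {K : Set Y} {Q : Measure Y}
    [IsProbabilityMeasure Q] (hQ : ∀ᵐ y ∂Q, y ∈ K) {g : ℝ → Y} (hg : Measurable g)
    (hgK : ∀ s, g s ∈ K) {h : ℕ → Y → ℝ} (hh : ∀ n, Measurable (h n))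
    (hb : ∀ n, ∃ M, ∀ y, |h n y| ≤ M) {f : Y → ℝ} (hf : Measurable f)
    (happ : ∀ ε > 0, ∃ n, ∀ y ∈ K, |f y - h n y| ≤ ε)
    (hlim : ∀ n, Tendsto (fun T : ℝ => T⁻¹ * ∫ s in (0 : ℝ)..T, h n (g s)) atTop
      (𝓝 (∫ y, h n y ∂Q))) :
    Tendsto (fun T : ℝ => T⁻¹ * ∫ s in (0 : ℝ)..T, f (g s)) atTop (𝓝 (∫ y, f y ∂Q)) := by
  rw [Metric.tendsto_atTop]
  intro ε hε
  obtain ⟨n, hn⟩ := happ (ε / 4) (by linarith)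
  obtain ⟨M, hM⟩ := hb n
  have hfM : ∀ y ∈ K, |f y| ≤ M + ε / 4 := fun y hy => by
    have h1 := abs_add_le (h n y) (f y - h n y)
    rw [add_sub_cancel] at h1
    linarith [hn y hy, hM y]
  have hi1 : Integrable (h n) Q :=
    Integrable.of_bound (hh n).aestronglyMeasurable M (ae_of_all _ hM)
  have hi2 : Integrable f Q :=
    Integrable.of_bound hf.aestronglyMeasurable (M + ε / 4) (hQ.mono hfM)
  have hj1 : ∀ T, IntervalIntegrable (fun s => h n (g s)) volume 0 T := fun T =>
    (intervalIntegrable_const (c := M)).mono_fun ((hh n).comp hg).aestronglyMeasurable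
      (ae_of_all _ fun s => (hM _).trans (le_abs_self M))
  have hj2 : ∀ T, IntervalIntegrable (fun s => f (g s)) volume 0 T := fun T =>
    (intervalIntegrable_const (c := M + ε / 4)).mono_fun (hf.comp hg).aestronglyMeasurable
      (ae_of_all _ fun s => (hfM _ (hgK s)).trans (le_abs_self _))
  obtain ⟨N, hN⟩ := Metric.tendsto_atTop.1 (hlim n) (ε / 4) (by linarith)
  refine ⟨max N 1, fun T hT => ?_⟩
  have hT0 : 0 < T := one_pos.trans_le ((le_max_right _ _).trans hT)
  have h1 := hN T ((le_max_left _ _).trans hT)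
  have h2 : |(∫ y, f y ∂Q) - ∫ y, h n y ∂Q| ≤ ε / 4 := by
    rw [← integral_sub hi2 hi1]
    have := norm_integral_le_of_norm_le_const (μ := Q) (f := fun y => f y - h n y)
      (C := ε / 4) (hQ.mono fun y hy => hn y hy)
    simpa using this
  have h3 : |T⁻¹ * (∫ s in (0 : ℝ)..T, f (g s)) - T⁻¹ * ∫ s in (0 : ℝ)..T, h n (g s)| ≤ ε / 4 := by
    rw [← mul_sub, ← intervalIntegral.integral_sub (hj2 T) (hj1 T), abs_mul, abs_inv,
      abs_of_pos hT0]
    have := intervalIntegral.norm_integral_le_of_norm_le_const (a := 0) (b := T)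
      (f := fun s => f (g s) - h n (g s)) (C := ε / 4) (fun s _ => hn _ (hgK s))
    rw [sub_zero, abs_of_pos hT0, Real.norm_eq_abs] at this
    rw [inv_mul_le_iff₀ hT0, mul_comm T]
    exact this
  rw [Real.dist_eq] at h1 ⊢
  rw [abs_lt] at h1 ⊢
  rw [abs_le] at h2 h3
  constructor <;> linarith [h1.1, h1.2, h2.1, h2.2, h3.1, h3.2]

/-- On a metrizable compact set, continuous functions are approximated by a countable family. -/
theorem exists_countable_approx {Y : Type*} [TopologicalSpace Y] {K : Set Y} (hK : IsCompact K)
    [TopologicalSpace.MetrizableSpace K] : ∃ h : ℕ → Y → ℝ, (∀ n, Continuous (h n)) ∧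
      (∀ n, ∃ M, ∀ y, |h n y| ≤ M) ∧
      ∀ f : C(Y, ℝ), ∀ ε > 0, ∃ n, ∀ y ∈ K, |f y - h n y| ≤ ε := by
  have : CompactSpace K := isCompact_iff_compactSpace.1 hK
  let R : Set C(K, ℝ) := Set.range fun f : C(Y, ℝ) => f.restrict K
  have : Nonempty R := ⟨⟨_, 0, rfl⟩⟩
  have hch : ∀ n, ∃ f : C(Y, ℝ), f.restrict K = (TopologicalSpace.denseSeq R n : C(K, ℝ)) :=
    fun n => (TopologicalSpace.denseSeq R n).2
  choose f hf using hch
  let N : ℕ → ℝ := fun n => ‖(TopologicalSpace.denseSeq R n : C(K, ℝ))‖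
  have hN : ∀ n, 0 ≤ N n := fun n => norm_nonneg _
  have hfN : ∀ n, ∀ y ∈ K, |f n y| ≤ N n := fun n y hy => by
    have := ContinuousMap.norm_coe_le_norm (TopologicalSpace.denseSeq R n : C(K, ℝ)) ⟨y, hy⟩
    rw [← hf n] at this
    change |f n y| ≤ ‖(TopologicalSpace.denseSeq R n : C(K, ℝ))‖
    rw [← hf n]
    exact this
  refine ⟨fun n y => max (-N n) (min (N n) (f n y)), fun n => ?_, fun n => ⟨N n, fun y => ?_⟩, ?_⟩
  · exact continuous_const.max (continuous_const.min (f n).continuous)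
  · exact abs_le.2 ⟨le_max_left _ _, max_le (by linarith [hN n]) (min_le_left _ _)⟩
  · intro g ε hε
    obtain ⟨n, hn⟩ := (TopologicalSpace.denseRange_denseSeq R).exists_dist_lt
      ⟨g.restrict K, g, rfl⟩ hε
    refine ⟨n, fun y hy => ?_⟩
    have h1 := abs_le.1 (hfN n y hy)
    change |g y - max (-N n) (min (N n) (f n y))| ≤ ε
    rw [min_eq_right h1.2, max_eq_right h1.1]
    have h2 := (ContinuousMap.dist_apply_le_dist (f := g.restrict K)
      (g := (TopologicalSpace.denseSeq R n : C(K, ℝ))) ⟨y, hy⟩).trans hn.le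
    rw [← hf n] at h2
    exact h2

end Averages

section Bool

open scoped ENNReal

/-- The law of the sign: uniform if reflections occur, trivial otherwise. -/
theorem exists_sign_measure {A : Type*} (w : A → ℝ≥0∞) (sg : A → Bool) :
    ∃ l : Measure Bool, IsProbabilityMeasure l ∧
      (∀ a, w a ≠ 0 → ∀ b, l {xor b (sg a)} = l {b}) ∧ l {false} ≠ 0 ∧
      (l {true} ≠ 0 → ∃ a, w a ≠ 0 ∧ sg a = true) := by
  by_cases h : ∃ a, w a ≠ 0 ∧ sg a = true
  · have hl : ∀ b, (PMF.uniformOfFintype Bool).toMeasure {b} = 2⁻¹ := fun b => by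
      rw [PMF.toMeasure_apply_singleton _ _ (measurableSet_singleton b)]
      simp
    refine ⟨(PMF.uniformOfFintype Bool).toMeasure, inferInstance, fun a _ b => ?_, ?_, fun _ => h⟩
    · rw [hl, hl]
    · rw [hl]; simp
  · refine ⟨Measure.dirac false, inferInstance, fun a ha b => ?_, by simp, fun h' => ?_⟩
    · have : sg a = false := by
        by_contra hs
        exact h ⟨a, ha, by simpa using hs⟩
      simp [this]
    · simp at h'

end Bool

section SymbolicScenery

open scoped ENNReal

variable {A I : Type*}

/-- The scenery at the coded point of `z`, seen at scale `c`. -/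
def symbolicScenery [MeasurableSpace A] (π : A → I) (ra ta : A → ℝ)
    (κ : (ℕ → I) → Measure (ℕ → A)) (z : ℕ → A) (c : ℝ) : ProbabilityMeasure ℝ :=
  toProb (scenery c (codePoint ra ta z) ((κ (π ∘ z)).map (codePoint ra ta)))

/-- The scenery as a function on the suspension space: the flag records the orientation. -/
def sceneryFactor [MeasurableSpace A] (π : A → I) (ra ta : A → ℝ)
    (κ : (ℕ → I) → Measure (ℕ → A)) (C : ℝ) (y : ((ℕ → A) × Bool) × ℝ) : ProbabilityMeasure ℝ :=
  symbolicScenery π ra ta κ y.1.1 ((if y.1.2 then -1 else 1) * Real.exp (C + y.2))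

theorem symbolicScenery_mem [MeasurableSpace A] (π : A → I) (ra ta : A → ℝ)
    (κ : (ℕ → I) → Measure (ℕ → A)) (z : ℕ → A) (c : ℝ) :
    symbolicScenery π ra ta κ z c ∈ unitBallMeasures :=
  toProb_mem (scenery_compl _ _ _)

variable [Fintype A] [MeasurableSpace A] [MeasurableSingletonClass A]
  [TopologicalSpace A] [DiscreteTopology A]

namespace IsSymbolicModel

variable {π : A → I} {ra ta : A → ℝ} {W : I → A → ℝ≥0∞} {κ : (ℕ → I) → Measure (ℕ → A)}
  (H : IsSymbolicModel π ra ta W κ)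

include H

theorem coe_symbolicScenery (z : ℕ → A) (c : ℝ) : (symbolicScenery π ra ta κ z c : Measure ℝ) =
    scenery c (codePoint ra ta z) ((κ (π ∘ z)).map (codePoint ra ta)) := by
  have := H.isProbabilityMeasure_map (π ∘ z)
  exact coe_toProb (isProbabilityMeasure_scenery (H.measure_zoom_ne_zero z c))

theorem scaleM_symbolicScenery (z : ℕ → A) (c : ℝ) {τ : ℝ} (hτ : 0 ≤ τ) :
    scaleM τ (scenery c (codePoint ra ta z) ((κ (π ∘ z)).map (codePoint ra ta))) =
      scenery (Real.exp τ * c) (codePoint ra ta z) ((κ (π ∘ z)).map (codePoint ra ta)) := by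
  have := H.isProbabilityMeasure_map (π ∘ z)
  rw [scaleM_eq_scenery, scenery_scenery (Real.one_le_exp hτ) (H.measure_zoom_ne_zero z _)]

theorem scaleFlow_symbolicScenery (z : ℕ → A) (c : ℝ) {τ : ℝ} (hτ : 0 ≤ τ) :
    scaleFlow τ (symbolicScenery π ra ta κ z c) =
      symbolicScenery π ra ta κ z (Real.exp τ * c) := by
  rw [scaleFlow, H.coe_symbolicScenery, H.scaleM_symbolicScenery z c hτ]
  rfl

theorem symbolicScenery_shift {δ : ℝ} (hδ : ∀ z z' : ℕ → A, (∀ n, π (z n) = π (z' n)) →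
      z 0 ≠ z' 0 → δ ≤ |codePoint ra ta z - codePoint ra ta z'|) (z : ℕ → A) {c : ℝ}
    (hc : 1 < |c| * δ) : symbolicScenery π ra ta κ z c =
      symbolicScenery π ra ta κ (shiftSeq z) (c * ra (z 0)) := by
  have hW : W (π (z 0)) (z 0) ≠ ⊤ := by
    refine ne_top_of_le_ne_top ENNReal.one_ne_top (b := 1) ?_
    rw [← H.sum_weight (π (z 0))]
    exact Finset.single_le_sum (f := fun a => W (π (z 0)) a) (fun _ _ => zero_le)
      (Finset.mem_univ _)
  rw [symbolicScenery, symbolicScenery]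
  congr 1
  refine scenery_eq_of_local ((H.weight_ne_zero_iff _ _).2 rfl) hW (codePoint_eq H.abs_lt_one z)
    fun s hs hsm => H.map_apply_of_subset_ball hδ z hsm fun y hy => ?_
  have h1 : |c * (y - codePoint ra ta z)| ≤ 1 := abs_le.2 (hs hy)
  rw [abs_mul, abs_sub_comm] at h1
  exact lt_of_mul_lt_mul_left (h1.trans_lt hc) (abs_nonneg c)

variable [Fintype I] [MeasurableSpace I] [MeasurableSingletonClass I]

theorem measurable_kernel : Measurable κ := by
  have := H.isProbabilityMeasure
  refine Measurable.measure_of_isPiSystem_of_isProbabilityMeasure generateFrom_cyl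
    isPiSystem_cyl ?_
  rintro _ ⟨n, c, rfl⟩
  simp_rw [H.measure_cyl]
  exact Finset.measurable_prod _ fun j _ =>
    (measurable_of_countable fun i => W i (c j)).comp (measurable_pi_apply (X := fun _ : ℕ => I) j)

theorem measurable_projection : Measurable fun z : ℕ → A => π ∘ z :=
  measurable_pi_lambda _ fun n => (measurable_of_countable π).comp (measurable_pi_apply n)

theorem measurable_fiberMeasure :
    Measurable fun z : ℕ → A => (κ (π ∘ z)).map (codePoint ra ta) :=
  (Measure.measurable_map _ H.measurable_codePoint).comp
    (H.measurable_kernel.comp H.measurable_projection)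

theorem measurable_symbolicScenery {X : Type*} [MeasurableSpace X] {z : X → ℕ → A} {c : X → ℝ}
    (hz : Measurable z) (hc : Measurable c) :
    Measurable fun x => symbolicScenery π ra ta κ (z x) (c x) := by
  refine measurable_toProb ?_ fun y => scenery_compl _ _ _
  have : ∀ x, IsProbabilityMeasure ((κ (π ∘ z x)).map (codePoint ra ta)) :=
    fun x => H.isProbabilityMeasure_map _
  exact measurable_scenery hc (H.measurable_codePoint.comp hz) (H.measurable_fiberMeasure.comp hz)

theorem measurable_sceneryFactor (C : ℝ) : Measurable (sceneryFactor π ra ta κ C) := by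
  have hb : Measurable fun b : Bool => (if b then -1 else 1 : ℝ) := measurable_of_countable _
  exact H.measurable_symbolicScenery (measurable_fst.comp measurable_fst)
    ((hb.comp (measurable_snd.comp measurable_fst)).mul
      (Real.measurable_exp.comp (measurable_const.add measurable_snd)))

theorem sceneryFactor_flow (C : ℝ) {τ : ℝ} (x : (ℕ → A) × Bool) (s : ℝ) (hτ : 0 ≤ τ) :
    scaleFlow τ (sceneryFactor π ra ta κ C (x, s)) = sceneryFactor π ra ta κ C (x, s + τ) := by
  rw [sceneryFactor, H.scaleFlow_symbolicScenery _ _ hτ, sceneryFactor]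
  congr 1
  rw [← add_assoc, Real.exp_add (C + s)]
  ring

theorem sceneryFactor_roof {δ : ℝ} (hδ0 : 0 < δ) (hδ : ∀ z z' : ℕ → A,
      (∀ n, π (z n) = π (z' n)) → z 0 ≠ z' 0 → δ ≤ |codePoint ra ta z - codePoint ra ta z'|)
    {C : ℝ} (hC : 1 < Real.exp C * δ) (x : (ℕ → A) × Bool) {s : ℝ} (hs : 0 ≤ s) :
    sceneryFactor π ra ta κ C (x, s + -Real.log |ra (x.1 0)|) =
      sceneryFactor π ra ta κ C (skewShift (fun a => decide (ra a < 0)) x, s) := by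
  obtain ⟨z, b⟩ := x
  have h0 := H.ratio_ne_zero (z 0)
  have hpos := abs_pos.2 h0
  have hlog : 0 ≤ -Real.log |ra (z 0)| :=
    neg_nonneg.2 (Real.log_nonpos hpos.le (H.abs_lt_one _).le)
  have hsgn : |(if b then -1 else 1 : ℝ)| = 1 := by cases b <;> simp
  have hexp : Real.exp (C + (s + -Real.log |ra (z 0)|)) = Real.exp (C + s) * |ra (z 0)|⁻¹ := by
    rw [← add_assoc, Real.exp_add (C + s), Real.exp_neg, Real.exp_log hpos]
  rw [sceneryFactor, H.symbolicScenery_shift hδ, sceneryFactor]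
  · change symbolicScenery π ra ta κ (shiftSeq z) _ = symbolicScenery π ra ta κ (shiftSeq z) _
    congr 1
    change (if b then -1 else 1 : ℝ) * Real.exp (C + (s + -Real.log |ra (z 0)|)) * ra (z 0) =
      (if xor b (decide (ra (z 0) < 0)) then -1 else 1 : ℝ) * Real.exp (C + s)
    rw [hexp]
    rcases lt_or_gt_of_ne h0 with h | h
    · rw [abs_of_neg h]
      cases b <;> simp [h] <;> field_simp
    · rw [abs_of_pos h]
      cases b <;> simp [h.not_gt] <;> field_simp
  · change 1 < |(if b then -1 else 1 : ℝ) * Real.exp (C + (s + -Real.log |ra (z 0)|))| * δ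
    rw [abs_mul, hsgn, one_mul, Real.abs_exp]
    refine hC.trans_le (mul_le_mul_of_nonneg_right (Real.exp_le_exp.2 ?_) hδ0.le)
    linarith

theorem measure_bind_cyl {P : Measure (ℕ → I)} {p : I → ℝ≥0∞}
    (hP : ∀ n c, P (cyl n c) = ∏ j ∈ Finset.range n, p (c j)) (n : ℕ) (c : ℕ → A) :
    P.bind κ (cyl n c) = ∏ j ∈ Finset.range n, p (π (c j)) * W (π (c j)) (c j) := by
  classical
  rw [Measure.bind_apply (measurableSet_cyl n c) H.measurable_kernel.aemeasurable]
  have : ∀ ω, κ ω (cyl n c) = (cyl n (π ∘ c)).indicator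
      (fun _ => ∏ j ∈ Finset.range n, W (π (c j)) (c j)) ω := fun ω => by
    rw [H.measure_cyl]
    by_cases hω : ω ∈ cyl n (π ∘ c)
    · rw [Set.indicator_of_mem hω]
      exact Finset.prod_congr rfl fun j hj => by rw [hω j (Finset.mem_range.1 hj)]; rfl
    · rw [Set.indicator_of_notMem hω]
      obtain ⟨j, hj, hne⟩ : ∃ j < n, ω j ≠ π (c j) := by
        by_contra! hcon
        exact hω hcon
      refine Finset.prod_eq_zero (Finset.mem_range.2 hj) ?_
      by_contra hW
      exact hne ((H.weight_ne_zero_iff _ _).1 hW).symm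
  simp_rw [this]
  rw [lintegral_indicator_const (measurableSet_cyl _ _), hP, mul_comm, ← Finset.prod_mul_distrib]
  rfl

theorem sum_joint_weight {p : I → ℝ≥0∞} (hp : ∑ i, p i = 1) :
    ∑ a, p (π a) * W (π a) a = 1 := by
  classical
  have : ∀ a, p (π a) * W (π a) a = ∑ i, p i * W i a := fun a => by
    rw [Finset.sum_eq_single (π a)]
    · intro i _ hi
      rw [mul_eq_zero]
      right
      by_contra hW
      exact hi ((H.weight_ne_zero_iff _ _).1 hW).symm
    · simp
  simp_rw [this]
  rw [Finset.sum_comm]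
  simp_rw [← Finset.mul_sum, H.sum_weight, mul_one, hp]

theorem isProbabilityMeasure_bind {P : Measure (ℕ → I)} [IsProbabilityMeasure P] :
    IsProbabilityMeasure (P.bind κ) := by
  have := H.isProbabilityMeasure
  refine ⟨?_⟩
  rw [Measure.bind_apply MeasurableSet.univ H.measurable_kernel.aemeasurable]
  simp

theorem bind_eq_sum {P : Measure (ℕ → I)} [IsProbabilityMeasure P] {p : I → ℝ≥0∞}
    (hp : ∑ i, p i = 1) (hP : ∀ n c, P (cyl n c) = ∏ j ∈ Finset.range n, p (c j)) :
    P.bind κ = ∑ a, (p (π a) * W (π a) a) • (P.bind κ).map (consSeq a) := by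
  have := H.isProbabilityMeasure_bind (P := P)
  refine eq_sum_consSeq (H.sum_joint_weight hp) fun n c => ?_
  rw [H.measure_bind_cyl hP, H.measure_bind_cyl hP, Finset.prod_range_succ', mul_comm]
  rfl

theorem ae_bind_noAtom {P : Measure (ℕ → I)}
    (h : ∀ᵐ ω ∂P, ∀ x : ℝ, (κ ω).map (codePoint ra ta) {x} = 0) :
    ∀ᵐ z ∂P.bind κ, (κ (π ∘ z)).map (codePoint ra ta) {codePoint ra ta z} = 0 := by
  have hpre : ∀ x : ℝ, (fun y => 1 * (y - x)) ⁻¹' ({0} ∩ Set.Icc (-1 : ℝ) 1) = {x} := fun x => by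
    ext y
    simp only [one_mul, Set.mem_preimage, Set.mem_inter_iff, Set.mem_singleton_iff, sub_eq_zero,
      and_iff_left_iff_imp]
    rintro rfl
    simp
  have hiff : ∀ z, (κ (π ∘ z)).map (codePoint ra ta) {codePoint ra ta z} = 0 ↔
      (symbolicScenery π ra ta κ z 1 : Measure ℝ) {0} = 0 := fun z => by
    have := H.isProbabilityMeasure_map (π ∘ z)
    rw [H.coe_symbolicScenery, scenery_apply _ _ _ (measurableSet_singleton 0), hpre, mul_eq_zero]
    simp [measure_ne_top]
  simp_rw [hiff]
  have hN : MeasurableSet {z | (symbolicScenery π ra ta κ z 1 : Measure ℝ) {0} = 0} := by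
    have h0 : Measurable fun z => symbolicScenery π ra ta κ z 1 :=
      H.measurable_symbolicScenery measurable_id measurable_const
    have h1 : Measurable fun z => (symbolicScenery π ra ta κ z 1 : Measure ℝ) {0} :=
      (Measure.measurable_coe (measurableSet_singleton 0)).comp (measurable_toMeasure.comp h0)
    exact h1 (measurableSet_singleton 0)
  rw [ae_iff]
  change P.bind κ {z | (symbolicScenery π ra ta κ z 1 : Measure ℝ) {0} = 0}ᶜ = 0
  have hm : Measurable fun ω =>
      κ ω {z | (symbolicScenery π ra ta κ z 1 : Measure ℝ) {0} = 0}ᶜ :=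
    (Measure.measurable_coe hN.compl).comp H.measurable_kernel
  rw [Measure.bind_apply hN.compl H.measurable_kernel.aemeasurable, lintegral_eq_zero_iff hm]
  filter_upwards [h] with ω hω
  change (∀ᵐ z ∂κ ω, (symbolicScenery π ra ta κ z 1 : Measure ℝ) {0} = 0)
  filter_upwards [H.ae_fiber ω] with z hz
  rw [← hiff, show π ∘ z = ω from funext hz]
  exact hω _

end IsSymbolicModel

end SymbolicScenery

section SymbolicDistribution

open scoped ENNReal

variable {A I : Type*} [Fintype A] [MeasurableSpace A] [MeasurableSingletonClass A]
  [TopologicalSpace A] [DiscreteTopology A] [Fintype I] [MeasurableSpace I]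
  [MeasurableSingletonClass I]

namespace IsSymbolicModel

variable {π : A → I} {ra ta : A → ℝ} {W : I → A → ℝ≥0∞} {κ : (ℕ → I) → Measure (ℕ → A)}
  (H : IsSymbolicModel π ra ta W κ)

include H

theorem exists_isSuspensionFactor [Nonempty A] {P : Measure (ℕ → I)} [IsProbabilityMeasure P]
    {p : I → ℝ≥0∞} (hp : ∑ i, p i = 1)
    (hP : ∀ n c, P (cyl n c) = ∏ j ∈ Finset.range n, p (c j)) {l : Measure Bool}
    [IsProbabilityMeasure l]
    (hinv : ∀ a, p (π a) * W (π a) a ≠ 0 → ∀ b, l {xor b (decide (ra a < 0))} = l {b})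
    (hf : l {false} ≠ 0)
    (herg : l {true} ≠ 0 → ∃ a, p (π a) * W (π a) a ≠ 0 ∧ decide (ra a < 0) = true) :
    ∃ C a b, IsSuspensionFactor ((P.bind κ).prod l) (skewShift fun a => decide (ra a < 0))
      (fun x => -Real.log |ra (x.1 0)|) (sceneryFactor π ra ta κ C) scaleFlow a b := by
  have := H.isProbabilityMeasure_bind (P := P)
  obtain ⟨δ, hδ0, hδ⟩ := exists_uniform_separation H.abs_lt_one H.separated
  obtain ⟨a₀, ha₀⟩ := Finite.exists_min fun a => -Real.log |ra a|
  obtain ⟨a₁, ha₁⟩ := Finite.exists_max fun a => -Real.log |ra a|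
  have hC : 1 < Real.exp (Real.log (2 / δ)) * δ := by
    rw [Real.exp_log (by positivity), div_mul_cancel₀ _ hδ0.ne']
    norm_num
  have hroof : Measurable fun a => -Real.log |ra a| := measurable_of_countable _
  exact ⟨Real.log (2 / δ), -Real.log |ra a₀|, -Real.log |ra a₁|,
    { ergodic := ergodic_skewShift (w := fun a => p (π a) * W (π a) a)
        (H.sum_joint_weight hp) (H.bind_eq_sum hp hP) hinv hf herg
      measurable_roof :=
        hroof.comp ((measurable_pi_apply (X := fun _ : ℕ => A) 0).comp measurable_fst)
      pos := neg_pos.2 (Real.log_neg (abs_pos.2 (H.ratio_ne_zero a₀)) (H.abs_lt_one a₀))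
      le_roof := fun x => ha₀ _
      roof_le := fun x => ha₁ _
      measurable_factor := H.measurable_sceneryFactor _
      measurable_flow := measurable_scaleFlow
      factor_add_roof := fun x s hs => H.sceneryFactor_roof hδ0 hδ hC x hs
      flow_factor := fun τ x s hτ _ => H.sceneryFactor_flow _ x s hτ }⟩

theorem measure_singleton_sceneryFactor {C : ℝ} {x : (ℕ → A) × Bool} {s : ℝ}
    (h : (κ (π ∘ x.1)).map (codePoint ra ta) {codePoint ra ta x.1} = 0) :
    (sceneryFactor π ra ta κ C (x, s) : Measure ℝ) {0} = 0 := by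
  rw [sceneryFactor, H.coe_symbolicScenery, scenery_apply _ _ _ (measurableSet_singleton 0),
    mul_eq_zero]
  right
  refine measure_mono_null (fun y hy => ?_) h
  have hne : ((if x.2 then -1 else 1 : ℝ) * Real.exp (C + s)) ≠ 0 :=
    mul_ne_zero (by split_ifs <;> norm_num) (Real.exp_pos _).ne'
  exact sub_eq_zero.1 ((mul_eq_zero.1 hy.1).resolve_left hne)

/-- Convergence of the scenery averages from the level `C` of the suspension. -/
theorem tendsto_average_scenery {Q : Measure (ProbabilityMeasure ℝ)} {C : ℝ} {z : ℕ → A}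
    {f : C(ProbabilityMeasure ℝ, ℝ)} {M : ℝ} (hM : ∀ ν ∈ unitBallMeasures, |f ν| ≤ M)
    (h : Tendsto (fun T : ℝ => T⁻¹ * ∫ s in (0 : ℝ)..T,
      f (sceneryFactor π ra ta κ C ((z, false), s))) atTop (𝓝 (∫ ν, f ν ∂Q))) :
    Tendsto (fun T : ℝ => T⁻¹ * ∫ s in (0 : ℝ)..T, f (toProb (scaleM s
        (recenter ((κ (π ∘ z)).map (codePoint ra ta)) (codePoint ra ta z)))))
      atTop (𝓝 (∫ ν, f ν ∂Q)) := by
  have hmeas : Measurable fun s : ℝ => symbolicScenery π ra ta κ z (Real.exp s) :=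
    H.measurable_symbolicScenery measurable_const Real.measurable_exp
  have hu : ∀ a b, IntervalIntegrable (fun s => f (symbolicScenery π ra ta κ z (Real.exp s)))
      volume a b := fun a b =>
    (intervalIntegrable_const (c := M)).mono_fun
      (f.continuous.measurable.comp hmeas).aestronglyMeasurable
      (ae_of_all _ fun s => (hM _ (symbolicScenery_mem _ _ _ _ _ _)).trans (le_abs_self M))
  have h' := tendsto_average_of_shift hu (C := C) (L := ∫ ν, f ν ∂Q)
    (by simpa [sceneryFactor] using h)
  refine h'.congr' ?_
  filter_upwards [eventually_ge_atTop 0] with T hT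
  congr 1
  refine intervalIntegral.integral_congr fun s hs => ?_
  rw [Set.uIcc_of_le hT] at hs
  rw [recenter_eq_scenery, H.scaleM_symbolicScenery z 1 hs.1, mul_one]
  rfl

theorem exists_distribution {P : Measure (ℕ → I)} [IsProbabilityMeasure P]
    {p : I → ℝ≥0∞} (hp : ∑ i, p i = 1)
    (hP : ∀ n c, P (cyl n c) = ∏ j ∈ Finset.range n, p (c j))
    (hatom : ∀ᵐ ω ∂P, ∀ x : ℝ, (κ ω).map (codePoint ra ta) {x} = 0) :
    ∃ Q : Measure (ProbabilityMeasure ℝ), IsProbabilityMeasure Q ∧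
      (∀ τ : ℝ, 0 ≤ τ → Q.map (scaleFlow τ) = Q) ∧
      (∀ E : Set (ProbabilityMeasure ℝ), MeasurableSet E →
        (∀ τ : ℝ, 0 ≤ τ → Q (symmDiff E (scaleFlow τ ⁻¹' E)) = 0) → Q E = 0 ∨ Q E = 1) ∧
      (∀ᵐ ν : ProbabilityMeasure ℝ ∂Q, (ν : Measure ℝ) {0} = 0) ∧
      (∀ᵐ ω ∂P, ∀ᵐ z ∂κ ω, ∀ f : C(ProbabilityMeasure ℝ, ℝ),
        Tendsto (fun T : ℝ => T⁻¹ * ∫ τ in (0 : ℝ)..T, f (toProb (scaleM τ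
          (recenter ((κ ω).map (codePoint ra ta)) (codePoint ra ta z)))))
          atTop (𝓝 (∫ ν, f ν ∂Q))) ∧
      ∀ (α : ℝ) (a : A), p (π a) ≠ 0 →
        Complex.exp (-(α * -Real.log |ra a| : ℝ) * Complex.I) ^ 2 ≠ 1 →
        ∀ φ : ProbabilityMeasure ℝ → ℂ, Measurable φ →
          (∀ᵐ ν ∂Q, ∀ τ : ℝ, 0 ≤ τ →
            φ (scaleFlow τ ν) = Complex.exp ((α * τ : ℝ) * Complex.I) * φ ν) → φ =ᵐ[Q] 0 := by
  have hμ := H.isProbabilityMeasure_bind (P := P)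
  have hσ : SFinite (P.bind κ) :=
    have : SigmaFinite (P.bind κ) := inferInstance
    @instSFiniteOfSigmaFinite _ _ _ this
  have : Nonempty A := (nonempty_of_isProbabilityMeasure (P.bind κ)).map fun z => z 0
  obtain ⟨l, hl, hinv, hf, herg⟩ := exists_sign_measure (fun a => p (π a) * W (π a) a)
    fun a => decide (ra a < 0)
  obtain ⟨C, c₁, c₂, hF⟩ := H.exists_isSuspensionFactor hp hP hinv hf herg
  have hQ := hF.isProbabilityMeasure_map
  set Q := (suspensionMeasure ((P.bind κ).prod l) fun x => -Real.log |ra (x.1 0)|).map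
    (sceneryFactor π ra ta κ C) with hQdef
  have hclosed : MeasurableSet unitBallMeasures := isCompact_unitBallMeasures.isClosed.measurableSet
  have hQK : ∀ᵐ ν ∂Q, ν ∈ unitBallMeasures :=
    hF.ae_map_of_ae_ae hclosed
      (ae_of_all _ fun x => ae_of_all _ fun s _ => symbolicScenery_mem _ _ _ _ _ _)
  refine ⟨Q, hQ, fun τ hτ => hF.map_flow hτ, fun E hE h => hF.measure_eq_zero_or_one hE h,
    ?_, ?_, ?_⟩
  · refine hF.ae_map_of_ae_ae ?_ ?_
    · exact ((Measure.measurable_coe (measurableSet_singleton 0)).comp measurable_toMeasure)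
        (measurableSet_singleton 0)
    · refine ae_prod_bool_iff.2 fun b _ => ?_
      filter_upwards [H.ae_bind_noAtom hatom] with z hz
      exact ae_of_all _ fun s _ => H.measure_singleton_sceneryFactor hz
  · have : CompactSpace unitBallMeasures := isCompact_iff_compactSpace.1 isCompact_unitBallMeasures
    obtain ⟨h, hc, hb, happ⟩ := exists_countable_approx isCompact_unitBallMeasures
    have hae : ∀ᵐ z ∂P.bind κ, ∀ n, Tendsto (fun T : ℝ => T⁻¹ * ∫ s in (0 : ℝ)..T,
        h n (sceneryFactor π ra ta κ C ((z, false), s))) atTop (𝓝 (∫ ν, h n ν ∂Q)) := by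
      rw [ae_all_iff]
      intro n
      obtain ⟨M, hM⟩ := hb n
      exact ae_prod_bool_iff.1 (hF.ae_tendsto_average (hc n).measurable hM) false hf
    filter_upwards [Measure.ae_ae_of_ae_bind H.measurable_kernel.aemeasurable hae] with ω hω
    filter_upwards [hω, H.ae_fiber ω] with z hz hfib f
    have hzω : π ∘ z = ω := funext hfib
    obtain ⟨M, hM⟩ := isCompact_unitBallMeasures.exists_bound_of_continuousOn
      f.continuous.continuousOn
    rw [← hzω]
    refine H.tendsto_average_scenery (C := C) hM ?_
    refine tendsto_average_of_approx
      (g := fun s => sceneryFactor π ra ta κ C ((z, false), s)) hQK ?_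
      (fun s => symbolicScenery_mem _ _ _ _ _ _)
      (fun n => (hc n).measurable) hb f.continuous.measurable (happ f) hz
    exact (H.measurable_sceneryFactor C).comp measurable_prodMk_left
  · intro α a ha hα φ hφ h
    refine hF.eigenfunction_ae_eq_zero (fun ψ hψ hψ1 hψT => ?_) hφ h
    refine ae_eq_zero_of_eigenfunction_skewShift (w := fun a => p (π a) * W (π a) a)
      (θ := fun a => Complex.exp (-(α * -Real.log |ra a| : ℝ) * Complex.I))
      (H.sum_joint_weight hp) (H.bind_eq_sum hp hP) hinv hf (fun a => ?_) hψ hψ1 hψT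
      (mul_ne_zero ha ((H.weight_ne_zero_iff _ _).2 rfl)) hα
    rw [← Complex.ofReal_neg]
    exact Complex.norm_exp_ofReal_mul_I _

end IsSymbolicModel

end SymbolicDistribution

section Model

open scoped ENNReal

instance measurableSingletonClass_sigma {I : Type*} {k : I → ℕ} :
    MeasurableSingletonClass (Σ i, Fin (k i)) :=
  ⟨fun x => by
    refine MeasurableSpace.measurableSet_iInf.2 fun i => ?_
    exact (Set.toFinite (Sigma.mk i ⁻¹' {x})).measurableSet⟩

variable {I : Type*} {k : I → ℕ}

/-- Record the map index along with the digit. -/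
def toLetters (ω : ℕ → I) (u : (n : ℕ) → Fin (k (ω n))) : ℕ → Σ i, Fin (k i) :=
  fun n => ⟨ω n, u n⟩

theorem toLetters_injective (ω : ℕ → I) : Function.Injective (toLetters (k := k) ω) := by
  intro u v h
  funext n
  have := congrFun h n
  simpa [toLetters] using this

theorem exists_toLetters {ω : ℕ → I} {z : ℕ → Σ i, Fin (k i)} (h : ∀ n, (z n).1 = ω n) :
    ∃ u, toLetters ω u = z := by
  obtain rfl : (fun n => (z n).1) = ω := funext h
  exact ⟨fun n => (z n).2, rfl⟩

theorem measurable_toLetters (ω : ℕ → I) : Measurable (toLetters (k := k) ω) :=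
  measurable_pi_lambda _ fun n =>
    (measurable_of_countable fun x : Fin (k (ω n)) => (⟨ω n, x⟩ : Σ i, Fin (k i))).comp
      (measurable_pi_apply n)

theorem coding_eq_codePoint (r : I → ℝ) (t : (i : I) → Fin (k i) → ℝ) (ω : ℕ → I) :
    coding k r t ω = codePoint (fun a : Σ i, Fin (k i) => r a.1) (fun a => t a.1 a.2) ∘
      toLetters ω := rfl

theorem continuous_toLetters (ω : ℕ → I) : Continuous (toLetters (k := k) ω) :=
  continuous_pi fun n =>
    (continuous_of_discreteTopology (f := fun x : Fin (k (ω n)) =>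
      (⟨ω n, x⟩ : Σ i, Fin (k i)))).comp (continuous_apply n)

open Classical in
/-- The probability vectors of a model, as weights on all letters. -/
def letterWeight (p : (i : I) → Fin (k i) → ℝ) (i : I) (a : Σ i, Fin (k i)) : ℝ≥0∞ :=
  if a.1 = i then ENNReal.ofReal (p a.1 a.2) else 0

theorem map_toLetters_cyl {p : (i : I) → Fin (k i) → ℝ} (hk : ∀ i, 0 < k i) {ω : ℕ → I}
    {μ : Measure ((n : ℕ) → Fin (k (ω n)))}
    (hμ : ∀ (n : ℕ) (c : (j : ℕ) → Fin (k (ω j))),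
      μ {u | ∀ j < n, u j = c j} = ∏ j ∈ Finset.range n, ENNReal.ofReal (p (ω j) (c j)))
    (n : ℕ) (c : ℕ → Σ i, Fin (k i)) : μ.map (toLetters ω) (cyl n c) =
      ∏ j ∈ Finset.range n, letterWeight p (ω j) (c j) := by
  rw [Measure.map_apply (measurable_toLetters ω) (measurableSet_cyl n c)]
  by_cases h : ∀ j < n, (c j).1 = ω j
  · have hd : ∀ j, ∃ x : Fin (k (ω j)), j < n → (⟨ω j, x⟩ : Σ i, Fin (k i)) = c j := fun j => by
      by_cases hj : j < n
      · rw [← h j hj]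
        exact ⟨(c j).2, fun _ => rfl⟩
      · exact ⟨⟨0, hk _⟩, fun h' => absurd h' hj⟩
    choose d hd using hd
    have : toLetters ω ⁻¹' cyl n c = {u | ∀ j < n, u j = d j} := by
      ext u
      refine forall₂_congr fun j hj => ?_
      rw [← hd j hj]
      simp [toLetters]
    rw [this, hμ]
    refine Finset.prod_congr rfl fun j hj => ?_
    rw [← hd j (Finset.mem_range.1 hj), letterWeight, if_pos rfl]
  · push Not at h
    obtain ⟨j, hj, hne⟩ := h
    rw [Finset.prod_eq_zero (Finset.mem_range.2 hj) (by rw [letterWeight, if_neg hne])]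
    have : toLetters ω ⁻¹' cyl n c = ∅ := by
      refine Set.eq_empty_of_forall_notMem fun u hu => hne ?_
      rw [← hu j hj]
      rfl
    rw [this, measure_empty]

theorem isSymbolicModel_of_separation [Fintype I] {r : I → ℝ} (hr : ∀ i, |r i| < 1)
    (hr0 : ∀ i, r i ≠ 0) {t : (i : I) → Fin (k i) → ℝ} (hk : ∀ i, 0 < k i)
    {p : (i : I) → Fin (k i) → ℝ} (hp : ∀ i j, 0 < p i j) (hpsum : ∀ i, ∑ j, p i j = 1)
    {η : (ω : ℕ → I) → Measure ((n : ℕ) → Fin (k (ω n)))}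
    (hη : ∀ ω, IsProbabilityMeasure (η ω))
    (hcyl : ∀ (ω : ℕ → I) (n : ℕ) (c : (j : ℕ) → Fin (k (ω j))),
      η ω {u | ∀ j < n, u j = c j} = ∏ j ∈ Finset.range n, ENNReal.ofReal (p (ω j) (c j)))
    (hsep : ∀ ω : ℕ → I, ∀ u v : Fin (k (ω 0)), u ≠ v →
      Disjoint ((fun x => r (ω 0) * x + t (ω 0) u) '' Yset k r t (shiftSeq ω))
               ((fun x => r (ω 0) * x + t (ω 0) v) '' Yset k r t (shiftSeq ω))) :
    IsSymbolicModel Sigma.fst (fun a : Σ i, Fin (k i) => r a.1) (fun a => t a.1 a.2)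
      (letterWeight p) fun ω => (η ω).map (toLetters ω) where
  abs_lt_one a := hr _
  ratio_ne_zero a := hr0 _
  sum_weight i := by
    rw [Fintype.sum_sigma, Finset.sum_eq_single i]
    · simp only [letterWeight, if_true]
      rw [← ENNReal.ofReal_sum_of_nonneg fun j _ => (hp i j).le, hpsum, ENNReal.ofReal_one]
    · intro j _ hj
      simp [letterWeight, hj]
    · simp
  weight_ne_zero_iff i a := by
    by_cases h : a.1 = i
    · simp [letterWeight, h, hp]
    · simp [letterWeight, h]
  isProbabilityMeasure ω := Measure.isProbabilityMeasure_map (measurable_toLetters ω).aemeasurable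
  measure_cyl ω := map_toLetters_cyl hk (hcyl ω)
  separated z z' hfib h0 heq := by
    obtain ⟨ω, u, rfl⟩ : ∃ ω u, toLetters ω u = z := ⟨fun n => (z n).1, fun n => (z n).2, rfl⟩
    obtain ⟨v, rfl⟩ := exists_toLetters (ω := ω) (z := z') fun n => (hfib n).symm
    have hr' : ∀ a : Σ i, Fin (k i), |r a.1| < 1 := fun a => hr a.1
    rw [codePoint_eq (ra := fun a : Σ i, Fin (k i) => r a.1) hr' (toLetters ω u),
      codePoint_eq (ra := fun a : Σ i, Fin (k i) => r a.1) hr' (toLetters ω v)] at heq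
    refine Set.disjoint_left.1 (hsep _ (u 0) (v 0) fun huv => h0 ?_)
      ⟨_, ⟨fun n => u (n + 1), rfl⟩, rfl⟩ ⟨_, ⟨fun n => v (n + 1), rfl⟩, heq.symm⟩
    exact congrArg (Sigma.mk _) huv

end Model

namespace IsSymbolicModel

open scoped ENNReal

variable {A I : Type*} [Fintype A] [MeasurableSpace A] [MeasurableSingletonClass A]
  {π : A → I} {ra ta : A → ℝ} {W : I → A → ℝ≥0∞} {κ : (ℕ → I) → Measure (ℕ → A)}
  (H : IsSymbolicModel π ra ta W κ)

include H

theorem eq_of_codePoint_eq {z z' : ℕ → A} (hfib : ∀ n, π (z n) = π (z' n))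
    (h : codePoint ra ta z = codePoint ra ta z') : z = z' := by
  funext n
  induction n generalizing z z' with
  | zero => exact by_contra fun h0 => H.separated z z' hfib h0 h
  | succ n ih =>
    have h0 : z 0 = z' 0 := by_contra fun h0 => H.separated z z' hfib h0 h
    refine ih (z := shiftSeq z) (z' := shiftSeq z') (fun n => hfib (n + 1)) ?_
    rw [codePoint_eq H.abs_lt_one, codePoint_eq H.abs_lt_one z', h0] at h
    exact mul_left_cancel₀ (H.ratio_ne_zero _) (add_right_cancel h)

end IsSymbolicModel

/-- for a non-trivial Bernoulli model with strong separation such that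
`log|r_i|/log β` is irrational for some `i ∈ I` with `ℙ([i]) > 0`, there is a non-trivial
`S`-invariant, `S`-ergodic distribution `Q` generated by `ℙ`-a.e. `η^{(ω)}` whose pure
point spectrum contains no nonzero integer multiple of `1/log β`. -/
theorem stmt14
    (β : ℝ) (hβ : 1 < β)
    (I : Type) [Fintype I] [Nonempty I] [MeasurableSpace I] [MeasurableSingletonClass I]
    (k : I → ℕ) (hk : ∀ i, 0 < k i)
    (r : I → ℝ) (hr : ∀ i, |r i| < 1) (hr0 : ∀ i, r i ≠ 0)
    (t : (i : I) → Fin (k i) → ℝ)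
    (p : (i : I) → Fin (k i) → ℝ) (hp : ∀ i j, 0 < p i j) (hpsum : ∀ i, ∑ j, p i j = 1)
    (q : I → ℝ) (hq : ∀ i, 0 ≤ q i) (hqsum : ∑ i, q i = 1)
    (P : Measure (ℕ → I)) (hP : IsProbabilityMeasure P)
    (hPcyl : ∀ (n : ℕ) (c : ℕ → I),
      P {ω | ∀ j < n, ω j = c j} = ∏ j ∈ Finset.range n, ENNReal.ofReal (q (c j)))
    (η' : (ω : ℕ → I) → Measure ((n : ℕ) → Fin (k (ω n))))
    (hη'prob : ∀ ω, IsProbabilityMeasure (η' ω))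
    (hη'cyl : ∀ (ω : ℕ → I) (n : ℕ) (c : (j : ℕ) → Fin (k (ω j))),
      η' ω {u | ∀ j < n, u j = c j} = ∏ j ∈ Finset.range n, ENNReal.ofReal (p (ω j) (c j)))
    (hSSC : ∀ ω : ℕ → I, ∀ u v : Fin (k (ω 0)), u ≠ v →
      Disjoint ((fun x => r (ω 0) * x + t (ω 0) u) '' Yset k r t (shiftSeq ω))
               ((fun x => r (ω 0) * x + t (ω 0) v) '' Yset k r t (shiftSeq ω)))
    (hnontriv : ∀ᵐ ω ∂P, ∀ x : ℝ, etaMeas k r t η' ω {x} = 0)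
    (i : I) (hiq : 0 < q i) (hirr : Irrational (Real.log |r i| / Real.log β)) :
    ∃ Q : Measure (ProbabilityMeasure ℝ), IsProbabilityMeasure Q ∧
      -- S-invariance
      (∀ τ : ℝ, 0 ≤ τ → Measure.map (scaleFlow τ) Q = Q) ∧
      -- S-ergodicity
      (∀ A : Set (ProbabilityMeasure ℝ), MeasurableSet A →
        (∀ τ : ℝ, 0 ≤ τ → Q (symmDiff A ((scaleFlow τ) ⁻¹' A)) = 0) →
        Q A = 0 ∨ Q A = 1) ∧
      -- non-triviality
      Q ≠ Measure.dirac (toProb (Measure.dirac 0)) ∧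
      -- ℙ-a.e. η^{(ω)} generates Q
      (∀ᵐ ω ∂P, ∀ᵐ x ∂(etaMeas k r t η' ω), ∀ f : C(ProbabilityMeasure ℝ, ℝ),
        Tendsto (fun T : ℝ =>
            T⁻¹ * ∫ τ in (0:ℝ)..T, f (toProb (scaleM τ (recenter (etaMeas k r t η' ω) x))))
          atTop (𝓝 (∫ ν, f ν ∂Q))) ∧
      -- the pure point spectrum contains no nonzero integer multiple of 1/log β
      (∀ m : ℤ, m ≠ 0 →
        ¬ ∃ φ : ProbabilityMeasure ℝ → ℂ, Measurable φ ∧ ¬ (φ =ᵐ[Q] 0) ∧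
          ∀ᵐ ν ∂Q, ∀ τ : ℝ, 0 ≤ τ →
            φ (scaleFlow τ ν) =
              Complex.exp (2 * Real.pi * Complex.I * ((m : ℂ) / (Real.log β : ℂ)) * (τ : ℂ))
                * φ ν) := by
  have H := isSymbolicModel_of_separation hr hr0 hk hp hpsum hη'prob hη'cyl hSSC
  have hmap : ∀ ω, etaMeas k r t η' ω = ((η' ω).map (toLetters ω)).map
      (codePoint (fun a : Σ i, Fin (k i) => r a.1) fun a => t a.1 a.2) := fun ω => by
    rw [Measure.map_map H.measurable_codePoint (measurable_toLetters ω), ← coding_eq_codePoint]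
    rfl
  obtain ⟨Q, hQ, hQinv, hQerg, hQ0, hQgen, hQspec⟩ := H.exists_distribution (P := P)
    (p := fun i => ENNReal.ofReal (q i))
    (by rw [← ENNReal.ofReal_sum_of_nonneg fun i _ => hq i, hqsum, ENNReal.ofReal_one])
    (fun n c => hPcyl n c) (hnontriv.mono fun ω h x => by rw [← hmap]; exact h x)
  refine ⟨Q, hQ, hQinv, hQerg, ?_, ?_, ?_⟩
  · rintro rfl
    have hmeas : MeasurableSet {ν : ProbabilityMeasure ℝ | (ν : Measure ℝ) {0} = 0} :=
      ((Measure.measurable_coe (measurableSet_singleton 0)).comp measurable_toMeasure)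
        (measurableSet_singleton 0)
    rw [ae_dirac_iff hmeas, coe_toProb inferInstance] at hQ0
    simp at hQ0
  · filter_upwards [hQgen] with ω hω
    have hinj : Function.Injective (coding k r t ω) := fun u v huv =>
      toLetters_injective ω <| H.eq_of_codePoint_eq (fun _ => rfl) huv
    have hcont : Continuous (coding k r t ω) :=
      (continuous_codePoint (ta := fun a : Σ i, Fin (k i) => t a.1 a.2) H.abs_lt_one).comp
        (continuous_toLetters ω)
    rw [etaMeas, (hcont.measurableEmbedding hinj).ae_map_iff, ← etaMeas, hmap]
    exact ae_of_ae_map (measurable_toLetters ω).aemeasurable hω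
  · rintro m hm ⟨φ, hφ, hφ0, heig⟩
    have hlog : Real.log β ≠ 0 := (Real.log_pos hβ).ne'
    refine hφ0 (hQspec (2 * Real.pi * (m / Real.log β)) ⟨i, 0, hk i⟩ (by simpa using hiq) ?_ φ hφ
      (heig.mono fun ν h τ hτ => (h τ hτ).trans ?_))
    · intro hexp
      rw [← Complex.exp_nat_mul, Complex.exp_eq_one_iff] at hexp
      obtain ⟨n, hn⟩ := hexp
      have hI : ((2 * m * (Real.log |r i| / Real.log β) : ℝ) : ℂ) * (2 * Real.pi * Complex.I) =
          ((n : ℝ) : ℂ) * (2 * Real.pi * Complex.I) := by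
        push_cast at hn ⊢
        rw [← hn]
        ring
      have hn' : 2 * m * (Real.log |r i| / Real.log β) = n := by
        exact_mod_cast mul_right_cancel₀ Complex.two_pi_I_ne_zero hI
      refine hirr ⟨n / (2 * m), ?_⟩
      have hm' : (m : ℝ) ≠ 0 := by exact_mod_cast hm
      push_cast
      rw [← hn']
      field_simp
    · congr 2
      push_cast
      ring
end
end

section
/- Let μ be the Cantor–Lebesgue measure on the middle-thirds Cantor set, i.e. the unique Borel probability measure on ℝ satisfying μ = (1/2)·(f_1)_*μ + (1/2)·(f_2)_*μ where f_1(x) = x/3 and f_2(x) = x/3 + 2/3. Let b ≥ 2 be an integer with log b / log 3 irrational. Then μ-almost every x is normal in base b: for every continuous g : [0,1] → ℝ, (1/N)·Σ_{k=0}^{N-1} g(b^k·x mod 1) → ∫_0^1 g dλ as N → ∞, where λ is Lebesgue measure. -/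
open MeasureTheory Filter Topology

/-- The average of `f` over the first `N` terms of `y` converges to the integral of `f`, for
every trigonometric polynomial `f`, as soon as the nontrivial exponential sums are `o(N)`. -/
theorem tendsto_average_of_mem_span_fourier {y : ℕ → UnitAddCircle}
    (hy : ∀ m : ℤ, m ≠ 0 →
      Tendsto (fun N : ℕ => (N : ℂ)⁻¹ * ∑ k ∈ Finset.range N, fourier m (y k)) atTop (𝓝 0))
    {f : C(UnitAddCircle, ℂ)}
    (hf : f ∈ Submodule.span ℂ (Set.range (fourier : ℤ → C(UnitAddCircle, ℂ)))) :
    Tendsto (fun N : ℕ => (N : ℂ)⁻¹ * ∑ k ∈ Finset.range N, f (y k)) atTop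
      (𝓝 (∫ x in (0 : ℝ)..1, f (x : UnitAddCircle))) := by
  have hint (g : C(UnitAddCircle, ℂ)) :
      IntervalIntegrable (fun x : ℝ => g (x : UnitAddCircle)) volume 0 1 :=
    (g.continuous.comp (AddCircle.continuous_mk' 1)).intervalIntegrable _ _
  induction hf using Submodule.span_induction with
  | mem f hf =>
    obtain ⟨m, rfl⟩ := hf
    have hcoeff : ∫ x in (0 : ℝ)..1, fourier m (x : UnitAddCircle)
        = (Pi.single m 1 : ℤ → ℂ) 0 := by
      rw [← fourierCoeff_fourier (T := 1) m, fourierCoeff_eq_intervalIntegral _ _ 0]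
      simp
    rw [hcoeff]
    rcases eq_or_ne m 0 with rfl | hm
    · refine tendsto_const_nhds.congr' ?_
      filter_upwards [eventually_ne_atTop 0] with N hN
      simp [hN]
    · simpa [hm.symm] using hy m hm
  | zero => simp
  | add f g _ _ ihf ihg =>
    simp only [ContinuousMap.add_apply, Finset.sum_add_distrib, mul_add]
    rw [intervalIntegral.integral_add (hint f) (hint g)]
    exact ihf.add ihg
  | smul a f _ ih =>
    simp only [ContinuousMap.smul_apply, smul_eq_mul, ← Finset.mul_sum]
    rw [intervalIntegral.integral_const_mul]
    simpa only [mul_left_comm] using ih.const_mul a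

/-- **Weyl's criterion** for continuous functions on the unit circle. -/
theorem tendsto_average_unitAddCircle {y : ℕ → UnitAddCircle}
    (hy : ∀ m : ℤ, m ≠ 0 →
      Tendsto (fun N : ℕ => (N : ℂ)⁻¹ * ∑ k ∈ Finset.range N, fourier m (y k)) atTop (𝓝 0))
    (f : C(UnitAddCircle, ℂ)) :
    Tendsto (fun N : ℕ => (N : ℂ)⁻¹ * ∑ k ∈ Finset.range N, f (y k)) atTop
      (𝓝 (∫ x in (0 : ℝ)..1, f (x : UnitAddCircle))) := by
  have hint (g : C(UnitAddCircle, ℂ)) :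
      IntervalIntegrable (fun x : ℝ => g (x : UnitAddCircle)) volume 0 1 :=
    (g.continuous.comp (AddCircle.continuous_mk' 1)).intervalIntegrable _ _
  rw [Metric.tendsto_atTop]
  intro ε hε
  have hmem : f ∈ (Submodule.span ℂ
      (Set.range (fourier : ℤ → C(UnitAddCircle, ℂ)))).topologicalClosure := by
    rw [span_fourier_closure_eq_top]; trivial
  obtain ⟨p, hp, hfp⟩ := Metric.mem_closure_iff.1 hmem (ε / 4) (by positivity)
  have hpt (z : UnitAddCircle) : ‖f z - p z‖ ≤ ε / 4 := by
    rw [← dist_eq_norm]; exact (ContinuousMap.dist_apply_le_dist z).trans hfp.le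
  obtain ⟨N₀, hN₀⟩ :=
    Metric.tendsto_atTop.1 (tendsto_average_of_mem_span_fourier hy hp) (ε / 4) (by positivity)
  refine ⟨N₀, fun N hN => ?_⟩
  have h1 : ‖(N : ℂ)⁻¹ * ∑ k ∈ Finset.range N, f (y k)
      - (N : ℂ)⁻¹ * ∑ k ∈ Finset.range N, p (y k)‖ ≤ ε / 4 := by
    rw [← mul_sub, ← Finset.sum_sub_distrib, norm_mul, norm_inv, Complex.norm_natCast]
    rcases Nat.eq_zero_or_pos N with rfl | hNpos
    · simp; positivity
    · have := norm_sum_le_of_le (Finset.range N) fun k _ => hpt (y k)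
      rw [Finset.sum_const, Finset.card_range, nsmul_eq_mul] at this
      rw [inv_mul_le_iff₀ (by positivity)]
      exact this
  have h2 : ‖(∫ x in (0 : ℝ)..1, p (x : UnitAddCircle))
      - ∫ x in (0 : ℝ)..1, f (x : UnitAddCircle)‖ ≤ ε / 4 := by
    rw [← intervalIntegral.integral_sub (hint p) (hint f)]
    refine (intervalIntegral.norm_integral_le_of_norm_le_const (C := ε / 4) fun x _ => ?_).trans
      (by simp)
    rw [norm_sub_rev]; exact hpt _
  have h3 := hN₀ N hN
  rw [dist_eq_norm] at h3 ⊢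
  calc _ = ‖((N : ℂ)⁻¹ * ∑ k ∈ Finset.range N, f (y k)
      - (N : ℂ)⁻¹ * ∑ k ∈ Finset.range N, p (y k))
      + ((N : ℂ)⁻¹ * ∑ k ∈ Finset.range N, p (y k) - ∫ x in (0 : ℝ)..1, p (x : UnitAddCircle))
      + ((∫ x in (0 : ℝ)..1, p (x : UnitAddCircle))
        - ∫ x in (0 : ℝ)..1, f (x : UnitAddCircle))‖ := by congr 1; ring
    _ ≤ _ := norm_add₃_le
    _ < ε := by linarith

/-- Weyl's criterion for continuous functions on `[0, 1]` with equal values at the endpoints. -/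
theorem tendsto_average_fract_of_periodic {y : ℕ → ℝ}
    (hy : ∀ m : ℤ, m ≠ 0 → Tendsto (fun N : ℕ => (N : ℂ)⁻¹ *
      ∑ k ∈ Finset.range N, fourier m (y k : UnitAddCircle)) atTop (𝓝 0))
    {g : ℝ → ℝ} (hg : Continuous g) (hg01 : g 0 = g 1) :
    Tendsto (fun N : ℕ => (N : ℝ)⁻¹ * ∑ k ∈ Finset.range N, g (Int.fract (y k))) atTop
      (𝓝 (∫ x in (0 : ℝ)..1, g x)) := by
  let f : C(UnitAddCircle, ℂ) := ⟨AddCircle.liftIco 1 0 fun x => (g x : ℂ),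
    AddCircle.liftIco_zero_continuous (by simp [hg01]) (by fun_prop)⟩
  have hf {x : ℝ} (hx : x ∈ Set.Ico (0 : ℝ) 1) : f (x : UnitAddCircle) = (g x : ℂ) :=
    AddCircle.liftIco_zero_coe_apply (f := fun x => (g x : ℂ)) hx
  have hfy (k : ℕ) : f (y k : UnitAddCircle) = (g (Int.fract (y k)) : ℂ) := by
    rw [← AddCircle.coe_fract]
    exact hf ⟨Int.fract_nonneg _, Int.fract_lt_one _⟩
  have hfint : ∫ x in (0 : ℝ)..1, f (x : UnitAddCircle) = ((∫ x in (0 : ℝ)..1, g x : ℝ) : ℂ) := by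
    rw [← intervalIntegral.integral_ofReal]
    exact intervalIntegral.integral_congr_Ioo_of_le zero_le_one
      fun x hx => hf (Set.Ioo_subset_Ico_self hx)
  have := tendsto_average_unitAddCircle hy f
  rw [hfint] at this
  simp only [hfy] at this
  rw [← tendsto_ofReal_iff]
  push_cast
  exact_mod_cast this

/-- Weyl's criterion for all continuous functions on `[0, 1]`. -/
theorem tendsto_average_fract {y : ℕ → ℝ}
    (hy : ∀ m : ℤ, m ≠ 0 → Tendsto (fun N : ℕ => (N : ℂ)⁻¹ *
      ∑ k ∈ Finset.range N, fourier m (y k : UnitAddCircle)) atTop (𝓝 0))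
    {g : ℝ → ℝ} (hg : Continuous g) :
    Tendsto (fun N : ℕ => (N : ℝ)⁻¹ * ∑ k ∈ Finset.range N, g (Int.fract (y k))) atTop
      (𝓝 (∫ x in (0 : ℝ)..1, g x)) := by
  obtain ⟨M, hM⟩ := (isCompact_Icc (a := (0 : ℝ)) (b := 1)).exists_bound_of_continuousOn
    hg.continuousOn
  have hM0 : 0 ≤ M := (norm_nonneg _).trans (hM 0 (by simp))
  rw [Metric.tendsto_nhds]
  intro ε hε
  obtain ⟨n, hn⟩ := exists_nat_gt (4 * (M + 1) / ε)
  have hn' : (M + 1) / (2 * n + 1) < ε / 4 := by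
    rw [div_lt_iff₀ hε] at hn
    rw [div_lt_iff₀ (by positivity)]
    nlinarith
  let ψ : ℝ → ℝ := fun x => (1 - 2 * x) ^ (2 * n)
  have hψ0 (x : ℝ) : 0 ≤ ψ x := (even_two_mul n).pow_nonneg _
  have hψc : Continuous ψ := by fun_prop
  have hψint : ∫ x in (0 : ℝ)..1, ψ x = 1 / (2 * n + 1) := by
    have := intervalIntegral.integral_comp_sub_mul (a := 0) (b := 1)
      (fun x : ℝ => x ^ (2 * n)) (two_ne_zero) 1
    simp only [ψ]
    rw [this, integral_pow]
    have : (-1 : ℝ) ^ (2 * n + 1) = -1 := Odd.neg_one_pow ⟨n, rfl⟩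
    norm_num [this]
    ring
  have h1 := tendsto_average_fract_of_periodic hy (g := fun x => g x * (1 - ψ x))
    (by fun_prop) (by norm_num [ψ])
  have h2 := tendsto_average_fract_of_periodic hy (g := ψ) hψc (by norm_num [ψ])
  rw [hψint] at h2
  have h2' : ∀ᶠ N : ℕ in atTop, (M + 1) *
      ((N : ℝ)⁻¹ * ∑ k ∈ Finset.range N, ψ (Int.fract (y k))) < ε / 4 :=
    (h2.const_mul (M + 1)).eventually_lt_const (by simpa [div_eq_mul_inv] using hn')
  have h1' := (Metric.tendsto_nhds.1 h1) (ε / 4) (by positivity)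
  filter_upwards [h1', h2'] with N hN1 hN2
  have hsplit : (N : ℝ)⁻¹ * ∑ k ∈ Finset.range N, g (Int.fract (y k))
      = (N : ℝ)⁻¹ * ∑ k ∈ Finset.range N, g (Int.fract (y k)) * (1 - ψ (Int.fract (y k)))
      + (N : ℝ)⁻¹ * ∑ k ∈ Finset.range N, g (Int.fract (y k)) * ψ (Int.fract (y k)) := by
    rw [← mul_add, ← Finset.sum_add_distrib]
    congr 2; ext k; ring
  have hisplit : ∫ x in (0 : ℝ)..1, g x
      = (∫ x in (0 : ℝ)..1, g x * (1 - ψ x)) + ∫ x in (0 : ℝ)..1, g x * ψ x := by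
    rw [← intervalIntegral.integral_add (Continuous.intervalIntegrable (by fun_prop) _ _)
      (Continuous.intervalIntegrable (by fun_prop) _ _)]
    congr 1; ext x; ring
  have hbound {x : ℝ} (hx : x ∈ Set.Icc (0 : ℝ) 1) : ‖g x * ψ x‖ ≤ (M + 1) * ψ x := by
    rw [norm_mul, Real.norm_of_nonneg (hψ0 x)]
    exact mul_le_mul_of_nonneg_right ((hM x hx).trans (by linarith)) (hψ0 x)
  have hsum : ‖(N : ℝ)⁻¹ * ∑ k ∈ Finset.range N, g (Int.fract (y k)) * ψ (Int.fract (y k))‖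
      < ε / 4 := by
    refine lt_of_le_of_lt ?_ hN2
    rw [norm_mul, norm_inv, Real.norm_natCast, mul_left_comm, Finset.mul_sum (a := M + 1)]
    gcongr
    exact norm_sum_le_of_le _ fun k _ => hbound ⟨Int.fract_nonneg _, (Int.fract_lt_one _).le⟩
  have hint : ‖∫ x in (0 : ℝ)..1, g x * ψ x‖ < ε / 4 := by
    have := intervalIntegral.norm_integral_le_of_norm_le (μ := volume) (zero_le_one' ℝ)
      (f := fun x => g x * ψ x) (g := fun x => (M + 1) * ψ x)
      (ae_of_all _ fun x hx => hbound (Set.Ioc_subset_Icc_self hx))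
      (Continuous.intervalIntegrable (by fun_prop) _ _)
    rw [intervalIntegral.integral_const_mul, hψint, mul_one_div] at this
    exact this.trans_lt hn'
  rw [Real.dist_eq] at hN1 ⊢
  rw [Real.norm_eq_abs] at hsum hint
  rw [hsplit, hisplit]
  rw [abs_lt] at *
  constructor <;> linarith

/-- The modulus of the characteristic function of the Cantor–Lebesgue measure is multiplied by
`|cos (t / 3)|` when passing from `t / 3` to `t`. -/
theorem norm_charFun_eq_abs_cos_mul {μ : Measure ℝ} [IsProbabilityMeasure μ]
    (hself : μ = ENNReal.ofReal (1/2) • Measure.map (fun x => x / 3) μ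
        + ENNReal.ofReal (1/2) • Measure.map (fun x => x / 3 + 2 / 3) μ) (t : ℝ) :
    ‖charFun μ t‖ = |Real.cos (t / 3)| * ‖charFun μ (t / 3)‖ := by
  have hi (ν : Measure ℝ) [IsFiniteMeasure ν] : Integrable (fun x : ℝ =>
      Complex.exp (t * x * Complex.I)) ν := by
    refine (integrable_const (1 : ℝ)).mono' (by fun_prop) (ae_of_all _ fun x => ?_)
    rw [← Complex.ofReal_mul, Complex.norm_exp_ofReal_mul_I]
  have hsplit : charFun μ t = (1 / 2 : ℝ) * charFun μ (t / 3)
      + (1 / 2 : ℝ) * (Complex.exp (2 * (t / 3 : ℝ) * Complex.I) * charFun μ (t / 3)) := by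
    have h1 : ∫ x : ℝ, Complex.exp (t * (x / 3 : ℝ) * Complex.I) ∂μ = charFun μ (t / 3) := by
      rw [charFun_apply_real]
      congr 1; ext x; congr 1; push_cast; ring
    have h2 : ∫ x : ℝ, Complex.exp (t * (x / 3 + 2 / 3 : ℝ) * Complex.I) ∂μ
        = Complex.exp (2 * (t / 3 : ℝ) * Complex.I) * charFun μ (t / 3) := by
      rw [charFun_apply_real, ← integral_const_mul]
      congr 1; ext x; rw [← Complex.exp_add]; congr 1; push_cast; ring
    conv_lhs => rw [charFun_apply_real, hself]
    rw [integral_add_measure ((hi _).smul_measure ENNReal.ofReal_ne_top)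
      ((hi _).smul_measure ENNReal.ofReal_ne_top), integral_smul_measure, integral_smul_measure,
      integral_map (by fun_prop) (by fun_prop), integral_map (by fun_prop) (by fun_prop),
      ENNReal.toReal_ofReal (by norm_num), h1, h2, Complex.real_smul, Complex.real_smul]
  have hexp : (1 / 2 : ℝ) + (1 / 2 : ℝ) * Complex.exp (2 * (t / 3 : ℝ) * Complex.I)
      = Complex.exp ((t / 3 : ℝ) * Complex.I) * (Real.cos (t / 3) : ℂ) := by
    rw [Complex.ofReal_cos, Complex.cos]
    have h1 : Complex.exp (2 * (t / 3 : ℝ) * Complex.I)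
      = Complex.exp ((t / 3 : ℝ) * Complex.I) * Complex.exp ((t / 3 : ℝ) * Complex.I) := by
      rw [← Complex.exp_add]; congr 1; ring
    have h2 : Complex.exp ((t / 3 : ℝ) * Complex.I) * Complex.exp (-(t / 3 : ℝ) * Complex.I)
      = 1 := by
      rw [← Complex.exp_add]; simp
    rw [h1]
    push_cast at h2 ⊢
    linear_combination -(1 / 2) * h2
  rw [hsplit, ← mul_assoc, ← add_mul, hexp, norm_mul, norm_mul, Complex.norm_exp_ofReal_mul_I,
    one_mul, Complex.norm_real, Real.norm_eq_abs]

/-- The modulus of the characteristic function of the Cantor–Lebesgue measure takes the same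
values at `2πn` and `2π(3n)`. -/
theorem norm_charFun_three_pow_mul {μ : Measure ℝ} [IsProbabilityMeasure μ]
    (hself : μ = ENNReal.ofReal (1/2) • Measure.map (fun x => x / 3) μ
        + ENNReal.ofReal (1/2) • Measure.map (fun x => x / 3 + 2 / 3) μ) (v : ℕ) (n : ℤ) :
    ‖charFun μ (2 * Real.pi * ((3 ^ v * n : ℤ) : ℝ))‖ = ‖charFun μ (2 * Real.pi * n)‖ := by
  induction v with
  | zero => simp
  | succ v ih =>
    rw [← ih, norm_charFun_eq_abs_cos_mul hself]
    have : 2 * Real.pi * ((3 ^ (v + 1) * n : ℤ) : ℝ) / 3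
        = ((3 ^ v * n : ℤ) : ℝ) * (2 * Real.pi) := by push_cast; ring
    rw [this, Real.cos_int_mul_two_pi, abs_one, one_mul, mul_comm]

/-- The partial product `∏_{1 ≤ j ≤ m} |cos (2πn / 3ʲ)|` of the modulus of the characteristic
function of the Cantor–Lebesgue measure at `2πn`. -/
noncomputable def cosProd (m : ℕ) (n : ℤ) : ℝ :=
  ∏ j ∈ Finset.range m, |Real.cos (2 * Real.pi * n / 3 ^ (j + 1))|

theorem cosProd_nonneg (m : ℕ) (n : ℤ) : 0 ≤ cosProd m n :=
  Finset.prod_nonneg fun _ _ => abs_nonneg _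

theorem norm_charFun_le_cosProd {μ : Measure ℝ} [IsProbabilityMeasure μ]
    (hself : μ = ENNReal.ofReal (1/2) • Measure.map (fun x => x / 3) μ
        + ENNReal.ofReal (1/2) • Measure.map (fun x => x / 3 + 2 / 3) μ) (m : ℕ) (n : ℤ) :
    ‖charFun μ (2 * Real.pi * n)‖ ≤ cosProd m n := by
  have key : ‖charFun μ (2 * Real.pi * n)‖
      = cosProd m n * ‖charFun μ (2 * Real.pi * n / 3 ^ m)‖ := by
    induction m with
    | zero => simp [cosProd]
    | succ m ih =>
      rw [ih, norm_charFun_eq_abs_cos_mul hself, cosProd, cosProd, Finset.prod_range_succ,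
        div_div, ← pow_succ]
      ring
  rw [key]
  exact mul_le_of_le_one_right (cosProd_nonneg m n) (norm_charFun_le_one _)

theorem cosProd_add_mul (m : ℕ) (n s : ℤ) : cosProd m (n + 3 ^ m * s) = cosProd m n := by
  refine Finset.prod_congr rfl fun j hj => ?_
  obtain ⟨d, rfl⟩ := Nat.exists_eq_add_of_lt (Finset.mem_range.1 hj)
  have : 2 * Real.pi * ((n + 3 ^ (j + d + 1) * s : ℤ) : ℝ) / 3 ^ (j + 1)
      = 2 * Real.pi * n / 3 ^ (j + 1) + (3 ^ d * s : ℤ) * (2 * Real.pi) := by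
    push_cast; field_simp; ring
  rw [this, Real.cos_add_int_mul_two_pi]

theorem cosProd_emod (m : ℕ) (n : ℤ) : cosProd m (n % 3 ^ m) = cosProd m n := by
  rw [← cosProd_add_mul m (n % 3 ^ m) (n / 3 ^ m), Int.emod_add_mul_ediv]

theorem abs_cos_add_thirds_le (θ : ℝ) :
    |Real.cos θ| + |Real.cos (θ + 2 * Real.pi / 3)| + |Real.cos (θ + 2 * (2 * Real.pi / 3))|
      ≤ 9 / 4 := by
  have hc : Real.cos (2 * Real.pi / 3) = -(1 / 2) := by
    rw [show 2 * Real.pi / 3 = Real.pi - Real.pi / 3 by ring, Real.cos_pi_sub,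
      Real.cos_pi_div_three]
  have hs : Real.sin (2 * Real.pi / 3) ^ 2 = 3 / 4 := by
    rw [Real.sin_sq, hc]; norm_num
  have hsq : Real.cos θ ^ 2 + Real.cos (θ + 2 * Real.pi / 3) ^ 2
      + Real.cos (θ + 2 * (2 * Real.pi / 3)) ^ 2 = 3 / 2 := by
    rw [Real.cos_add, Real.cos_add, Real.cos_two_mul, Real.sin_two_mul, hc]
    have := Real.sin_sq_add_cos_sq θ
    linear_combination (2 * Real.sin θ ^ 2) * hs + (3 / 2) * this
  rw [← sq_abs, ← sq_abs (Real.cos (θ + 2 * Real.pi / 3)),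
    ← sq_abs (Real.cos (θ + 2 * (2 * Real.pi / 3)))] at hsq
  nlinarith [sq_nonneg (|Real.cos θ| - 3 / 4), sq_nonneg (|Real.cos (θ + 2 * Real.pi / 3)| - 3 / 4),
    sq_nonneg (|Real.cos (θ + 2 * (2 * Real.pi / 3))| - 3 / 4)]

/-- The sum of `cosProd m` over a full residue system modulo `3 ^ m`. -/
theorem sum_cosProd_le (m : ℕ) :
    ∑ n ∈ Finset.range (3 ^ m), cosProd m n ≤ (9 / 4) ^ m := by
  induction m with
  | zero => simp [cosProd]
  | succ m ih =>
    have hstep (n : ℤ) (i : ℤ) : cosProd (m + 1) (3 ^ m * i + n)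
        = cosProd m n * |Real.cos (2 * Real.pi * n / 3 ^ (m + 1) + i * (2 * Real.pi / 3))| := by
      have : 2 * Real.pi * ((3 ^ m * i + n : ℤ) : ℝ) / 3 ^ (m + 1)
          = 2 * Real.pi * n / 3 ^ (m + 1) + i * (2 * Real.pi / 3) := by
        push_cast; field_simp; ring
      rw [← this, ← cosProd_add_mul m n i, add_comm n, cosProd, cosProd, Finset.prod_range_succ]
    have h3 : 3 ^ (m + 1) = 3 ^ m + 3 ^ m + 3 ^ m := by ring
    rw [h3, Finset.sum_range_add, Finset.sum_range_add, ← Finset.sum_add_distrib,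
      ← Finset.sum_add_distrib, pow_succ]
    refine le_trans ?_ (mul_le_mul_of_nonneg_right ih (by norm_num : (0 : ℝ) ≤ 9 / 4))
    rw [Finset.sum_mul]
    refine Finset.sum_le_sum fun n _ => ?_
    have e0 := hstep n 0
    have e1 := hstep n 1
    have e2 := hstep n 2
    have := abs_cos_add_thirds_le (2 * Real.pi * (n : ℤ) / 3 ^ (m + 1))
    simp only [mul_zero, zero_add, mul_one, Int.cast_zero, zero_mul, add_zero, Int.cast_one,
      one_mul, Int.cast_ofNat] at e0 e1 e2
    have c1 : ((3 ^ m + n : ℕ) : ℤ) = 3 ^ m + n := by push_cast; ring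
    have c2 : ((3 ^ m + 3 ^ m + n : ℕ) : ℤ) = 3 ^ m * 2 + n := by push_cast; ring
    rw [c1, c2, e0, e1, e2, ← mul_add, ← mul_add]
    exact mul_le_mul_of_nonneg_left this (cosProd_nonneg m n)

/-- If `c ≥ 2` is prime to `3`, then the powers of `c` are spread out modulo powers of `3`. -/
theorem exists_forall_three_pow_dvd_pow_sub_one {c : ℕ} (hc : 2 ≤ c) (h3 : ¬ 3 ∣ c) :
    ∃ e : ℕ, ∀ r d : ℕ, (3 : ℤ) ^ (e + r) ∣ (c : ℤ) ^ d - 1 → 3 ^ r ∣ d := by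
  have hne : (c : ℤ) ^ 2 - 1 ≠ 0 := by
    have : (2 : ℤ) ≤ c := by exact_mod_cast hc
    nlinarith
  have hfin : FiniteMultiplicity (3 : ℤ) ((c : ℤ) ^ 2 - 1) :=
    Int.finiteMultiplicity_iff.2 ⟨by norm_num, hne⟩
  refine ⟨multiplicity (3 : ℤ) ((c : ℤ) ^ 2 - 1), fun r d h => ?_⟩
  have hc3 : ¬ (3 : ℤ) ∣ c := by exact_mod_cast h3
  have hdvd : (3 : ℤ) ∣ (c : ℤ) ^ 2 - 1 := by
    have : (c : ℤ) % 3 = 1 ∨ (c : ℤ) % 3 = 2 := by omega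
    rw [Int.dvd_iff_emod_eq_zero, pow_two, Int.sub_emod, Int.mul_emod]
    rcases this with h | h <;> rw [h] <;> norm_num
  have hlte := Int.emultiplicity_pow_sub_pow (p := 3) Nat.prime_three (by decide)
    (x := (c : ℤ) ^ 2) (y := 1) (by exact_mod_cast hdvd)
    (by exact_mod_cast fun h => hc3 (Int.prime_three.dvd_of_dvd_pow h)) d
  have h2 : (3 : ℤ) ^ (multiplicity (3 : ℤ) ((c : ℤ) ^ 2 - 1) + r) ∣ ((c : ℤ) ^ 2) ^ d - 1 ^ d := by
    rw [one_pow, ← pow_mul, mul_comm, pow_mul]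
    exact h.trans (sub_one_dvd_pow_sub_one _ 2)
  have h4 := le_emultiplicity_of_pow_dvd h2
  rw [show (3 : ℤ) = ((3 : ℕ) : ℤ) from rfl, hlte] at h4
  rw [show ((3 : ℕ) : ℤ) = 3 from rfl, hfin.emultiplicity_eq_multiplicity] at h4
  push_cast at h4
  exact pow_dvd_of_le_emultiplicity ((ENat.add_le_add_iff_left (ENat.natCast_ne_top _)).1 h4)
/-- The sum of `cosProd` over `3 ^ r` consecutive terms of a geometric progression, whose residues
modulo `3 ^ (e + r)` are distinct. -/
theorem sum_cosProd_orbit_le {c e : ℕ}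
    (he : ∀ r d : ℕ, (3 : ℤ) ^ (e + r) ∣ (c : ℤ) ^ d - 1 → 3 ^ r ∣ d) (h3 : ¬ 3 ∣ c)
    (r : ℕ) {u : ℤ} (hu : ¬ 3 ∣ u) :
    ∑ l ∈ Finset.range (3 ^ r), cosProd (e + r) (u * c ^ l) ≤ (9 / 4) ^ (e + r) := by
  set m := e + r
  have hc3 : ¬ (3 : ℤ) ∣ c := by exact_mod_cast h3
  have hpos : (0 : ℤ) < 3 ^ m := by positivity
  let f : ℕ → ℕ := fun l => (u * c ^ l % 3 ^ m : ℤ).toNat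
  have hf (l : ℕ) : (f l : ℤ) = u * c ^ l % 3 ^ m :=
    Int.toNat_of_nonneg (Int.emod_nonneg _ hpos.ne')
  have hlt {i j : ℕ} (hj : j < 3 ^ r) (hij : i < j) : f i ≠ f j := by
    intro h
    obtain ⟨d, rfl⟩ := Nat.exists_eq_add_of_lt hij
    have hmod : u * c ^ i % 3 ^ m = u * c ^ (i + d + 1) % 3 ^ m := by rw [← hf, ← hf, h]
    have hdvd := Int.ModEq.dvd (show u * c ^ i ≡ u * c ^ (i + d + 1) [ZMOD 3 ^ m] from hmod)
    have hfac : u * (c : ℤ) ^ (i + d + 1) - u * c ^ i = (u * c ^ i) * (c ^ (d + 1) - 1) := by ring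
    rw [hfac] at hdvd
    have hcop : IsCoprime ((3 : ℤ) ^ m) (u * c ^ i) := by
      refine IsCoprime.pow_left ((Int.prime_three.coprime_iff_not_dvd).2 fun h => ?_)
      rcases Int.prime_three.dvd_or_dvd h with h | h
      · exact hu h
      · exact hc3 (Int.prime_three.dvd_of_dvd_pow h)
    have := Nat.le_of_dvd (Nat.succ_pos d) (he r (d + 1) (hcop.dvd_of_dvd_mul_left hdvd))
    omega
  have hinj : Set.InjOn f (Finset.range (3 ^ r) : Set ℕ) := by
    intro i hi j hj h
    simp only [Finset.coe_range, Set.mem_Iio] at hi hj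
    rcases lt_trichotomy i j with hij | hij | hij
    · exact absurd h (hlt hj hij)
    · exact hij
    · exact absurd h.symm (hlt hi hij)
  calc ∑ l ∈ Finset.range (3 ^ r), cosProd m (u * c ^ l)
      = ∑ l ∈ Finset.range (3 ^ r), cosProd m (f l) := by
        refine Finset.sum_congr rfl fun l _ => ?_
        rw [hf, cosProd_emod]
    _ = ∑ n ∈ (Finset.range (3 ^ r)).image f, cosProd m n :=
        (Finset.sum_image (f := fun n : ℕ => cosProd m n) hinj).symm
    _ ≤ ∑ n ∈ Finset.range (3 ^ m), cosProd m n := by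
        refine Finset.sum_le_sum_of_subset_of_nonneg ?_ fun n _ _ => cosProd_nonneg m n
        intro n hn
        obtain ⟨l, -, rfl⟩ := Finset.mem_image.1 hn
        have : (f l : ℤ) < 3 ^ m := by rw [hf]; exact Int.emod_lt_of_pos _ hpos
        exact Finset.mem_range.2 (by exact_mod_cast this)
    _ ≤ _ := sum_cosProd_le m

theorem sum_cosProd_orbit_mul_le {c e : ℕ}
    (he : ∀ r d : ℕ, (3 : ℤ) ^ (e + r) ∣ (c : ℤ) ^ d - 1 → 3 ^ r ∣ d) (h3 : ¬ 3 ∣ c)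
    (r q : ℕ) {u : ℤ} (hu : ¬ 3 ∣ u) :
    ∑ l ∈ Finset.range (q * 3 ^ r), cosProd (e + r) (u * c ^ l) ≤ q * (9 / 4) ^ (e + r) := by
  induction q with
  | zero => simp
  | succ q ih =>
    have hc3 : ¬ (3 : ℤ) ∣ c := by exact_mod_cast h3
    have hu' : ¬ (3 : ℤ) ∣ u * c ^ (q * 3 ^ r) := fun h => by
      rcases Int.prime_three.dvd_or_dvd h with h | h
      · exact hu h
      · exact hc3 (Int.prime_three.dvd_of_dvd_pow h)
    have := sum_cosProd_orbit_le he h3 r hu'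
    simp only [mul_assoc, ← pow_add] at this
    rw [add_mul, one_mul, Finset.sum_range_add]
    push_cast
    linarith

/-- The characteristic function of the Cantor–Lebesgue measure is small on average along
geometric progressions whose ratio is not a power of `3`. -/
theorem exists_sum_norm_charFun_le {μ : Measure ℝ} [IsProbabilityMeasure μ]
    (hself : μ = ENNReal.ofReal (1/2) • Measure.map (fun x => x / 3) μ
        + ENNReal.ofReal (1/2) • Measure.map (fun x => x / 3 + 2 / 3) μ)
    {a c : ℕ} (hc : 2 ≤ c) (h3 : ¬ 3 ∣ c) :
    ∃ K : ℝ, 0 ≤ K ∧ ∀ n : ℤ, n ≠ 0 → ∀ r N : ℕ, 3 ^ r ≤ N →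
      ∑ l ∈ Finset.range N,
        ‖charFun μ (2 * Real.pi * ((n * ((3 ^ a * c : ℕ) : ℤ) ^ l : ℤ) : ℝ))‖
          ≤ K * N * (3 / 4) ^ r := by
  obtain ⟨e, he⟩ := exists_forall_three_pow_dvd_pow_sub_one hc h3
  refine ⟨2 * (9 / 4) ^ e, by positivity, fun n hn r N hN => ?_⟩
  obtain ⟨v, u, rfl, hu⟩ : ∃ (v : ℕ) (u : ℤ), n = 3 ^ v * u ∧ ¬ 3 ∣ u :=
    ⟨_, FiniteMultiplicity.exists_eq_pow_mul_and_not_dvd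
      (Int.finiteMultiplicity_iff.2 ⟨by norm_num, hn⟩)⟩
  have hN' : N ≤ (N / 3 ^ r + 1) * 3 ^ r := (Nat.lt_mul_of_div_lt (Nat.lt_succ_self _)
    (by positivity)).le
  calc _ ≤ ∑ l ∈ Finset.range N, cosProd (e + r) (u * c ^ l) := by
        refine Finset.sum_le_sum fun l _ => ?_
        have : 3 ^ v * u * ((3 ^ a * c : ℕ) : ℤ) ^ l = 3 ^ (v + a * l) * (u * c ^ l) := by
          push_cast; ring
        rw [this, norm_charFun_three_pow_mul hself]
        exact norm_charFun_le_cosProd hself _ _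
    _ ≤ ∑ l ∈ Finset.range ((N / 3 ^ r + 1) * 3 ^ r), cosProd (e + r) (u * c ^ l) :=
        Finset.sum_le_sum_of_subset_of_nonneg (Finset.range_mono hN')
          fun _ _ _ => cosProd_nonneg _ _
    _ ≤ ((N / 3 ^ r + 1 : ℕ) : ℝ) * (9 / 4) ^ (e + r) := sum_cosProd_orbit_mul_le he h3 r _ hu
    _ ≤ (2 * (N / 3 ^ r)) * (9 / 4) ^ (e + r) := by
        gcongr
        have h1 : ((N / 3 ^ r : ℕ) : ℝ) ≤ (N : ℝ) / 3 ^ r := by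
          exact_mod_cast Nat.cast_div_le (α := ℝ) (m := N) (n := 3 ^ r)
        have h2 : (1 : ℝ) ≤ (N : ℝ) / 3 ^ r := by
          rw [one_le_div (by positivity)]; exact_mod_cast hN
        push_cast
        linarith
    _ = _ := by
        rw [show (3 / 4 : ℝ) ^ r = (9 / 4) ^ r / 3 ^ r by rw [← div_pow]; norm_num, pow_add]
        ring

theorem sum_sum_le_of_symm {F : ℕ → ℕ → ℝ} (hF : ∀ k l, 0 ≤ F k l) (hsymm : ∀ k l, F k l = F l k)
    (N : ℕ) :
    ∑ k ∈ Finset.range N, ∑ l ∈ Finset.range N, F k l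
      ≤ 2 * ∑ d ∈ Finset.range N, ∑ l ∈ Finset.range N, F (l + d) l := by
  let G : ℕ → ℕ → ℕ → ℝ := fun d k l => if k = l + d then F (l + d) l else 0
  have hG (d k l : ℕ) : 0 ≤ G d k l := by
    simp only [G]; split_ifs; exacts [hF _ _, le_rfl]
  have hGsum : ∑ k ∈ Finset.range N, ∑ l ∈ Finset.range N, ∑ d ∈ Finset.range N, G d k l
      ≤ ∑ d ∈ Finset.range N, ∑ l ∈ Finset.range N, F (l + d) l := by
    rw [Finset.sum_comm, Finset.sum_congr rfl fun l _ => Finset.sum_comm, Finset.sum_comm]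
    refine Finset.sum_le_sum fun d _ => Finset.sum_le_sum fun l _ => ?_
    simp only [G, Finset.sum_ite_eq']
    split_ifs; exacts [le_rfl, hF _ _]
  have hle (k l : ℕ) (hk : k ∈ Finset.range N) (hlk : l ≤ k) :
      F k l ≤ ∑ d ∈ Finset.range N, G d k l := by
    obtain ⟨d, rfl⟩ := Nat.exists_eq_add_of_le hlk
    have hd : d ∈ Finset.range N := Finset.mem_range.2 (by have := Finset.mem_range.1 hk; omega)
    refine le_trans ?_
      (Finset.single_le_sum (f := fun i => G i (l + d) l) (fun i _ => hG i (l + d) l) hd)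
    simp [G]
  have hswap : ∑ k ∈ Finset.range N, ∑ l ∈ Finset.range N, ∑ d ∈ Finset.range N, G d l k
      = ∑ k ∈ Finset.range N, ∑ l ∈ Finset.range N, ∑ d ∈ Finset.range N, G d k l :=
    Finset.sum_comm
  calc ∑ k ∈ Finset.range N, ∑ l ∈ Finset.range N, F k l
      ≤ ∑ k ∈ Finset.range N, ∑ l ∈ Finset.range N,
        (∑ d ∈ Finset.range N, G d k l + ∑ d ∈ Finset.range N, G d l k) := by
        refine Finset.sum_le_sum fun k hk => Finset.sum_le_sum fun l hl => ?_
        rcases le_total l k with h | h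
        · exact (hle k l hk h).trans
            (le_add_of_nonneg_right (Finset.sum_nonneg fun d _ => hG d l k))
        · rw [hsymm k l]
          exact (hle l k hl h).trans
            (le_add_of_nonneg_left (Finset.sum_nonneg fun d _ => hG d k l))
    _ ≤ _ := by
        simp only [Finset.sum_add_distrib]
        rw [hswap]
        linarith

/-- The second moment of a trigonometric sum is controlled by the characteristic function. -/
theorem integral_norm_sum_exp_sq_le (μ : Measure ℝ) [IsProbabilityMeasure μ] (t : ℕ → ℝ) (N : ℕ) :
    ∫ x, ‖∑ k ∈ Finset.range N, Complex.exp (t k * x * Complex.I)‖ ^ 2 ∂μ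
      ≤ ∑ k ∈ Finset.range N, ∑ l ∈ Finset.range N, ‖charFun μ (t k - t l)‖ := by
  have hi (s : ℝ) : Integrable (fun x : ℝ => Complex.exp (s * x * Complex.I)) μ := by
    refine (integrable_const (1 : ℝ)).mono' (by fun_prop) (ae_of_all _ fun x => ?_)
    rw [← Complex.ofReal_mul, Complex.norm_exp_ofReal_mul_I]
  have hexpand (x : ℝ) :
      ((‖∑ k ∈ Finset.range N, Complex.exp (t k * x * Complex.I)‖ ^ 2 : ℝ) : ℂ)
        = ∑ k ∈ Finset.range N, ∑ l ∈ Finset.range N,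
          Complex.exp ((t k - t l : ℝ) * x * Complex.I) := by
    rw [Complex.ofReal_pow, ← Complex.mul_conj', map_sum, Finset.sum_mul_sum]
    refine Finset.sum_congr rfl fun k _ => Finset.sum_congr rfl fun l _ => ?_
    rw [← Complex.exp_conj, ← Complex.exp_add]
    congr 1
    simp only [map_mul, Complex.conj_ofReal, Complex.conj_I]
    push_cast; ring
  have hint : ((∫ x, ‖∑ k ∈ Finset.range N, Complex.exp (t k * x * Complex.I)‖ ^ 2 ∂μ : ℝ) : ℂ)
      = ∑ k ∈ Finset.range N, ∑ l ∈ Finset.range N, charFun μ (t k - t l) := by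
    rw [← integral_complex_ofReal]
    simp only [hexpand, charFun_apply_real]
    rw [integral_finsetSum _ fun k _ => integrable_finsetSum _ fun l _ => hi _]
    exact Finset.sum_congr rfl fun k _ => integral_finsetSum _ fun l _ => hi _
  have hnorm := congrArg norm hint
  rw [Complex.norm_real, Real.norm_of_nonneg (integral_nonneg fun _ => by positivity)] at hnorm
  rw [hnorm]
  exact norm_sum_le_of_le _ fun k _ => norm_sum_le _ _

/-- Nonnegative functions with summable integrals tend to zero almost everywhere. -/
theorem ae_tendsto_zero_of_summable_integral {α : Type*} [MeasurableSpace α] {μ : Measure α}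
    {f : ℕ → α → ℝ} (hf : ∀ n, Integrable (f n) μ) (hf0 : ∀ n x, 0 ≤ f n x)
    (hsum : Summable fun n => ∫ x, f n x ∂μ) :
    ∀ᵐ x ∂μ, Tendsto (fun n => f n x) atTop (𝓝 0) := by
  have hmeas (n : ℕ) : AEMeasurable (fun x => ENNReal.ofReal (f n x)) μ :=
    (hf n).aemeasurable.ennreal_ofReal
  have hfin : ∫⁻ x, ∑' n, ENNReal.ofReal (f n x) ∂μ ≠ ⊤ := by
    rw [lintegral_tsum hmeas]
    simp only [← ofReal_integral_eq_lintegral_ofReal (hf _) (ae_of_all _ (hf0 _))]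
    exact hsum.tsum_ofReal_ne_top
  filter_upwards [ae_lt_top' (AEMeasurable.tsum hmeas) hfin] with x hx
  have := (ENNReal.tendsto_toReal ENNReal.zero_ne_top).comp
    (ENNReal.tendsto_atTop_zero_of_tsum_ne_top hx.ne)
  simpa [Function.comp_def, ENNReal.toReal_ofReal (hf0 _ x)] using this

/-- A bounded real sequence whose averages along the eighth powers tend to zero has averages
tending to zero. -/
theorem tendsto_average_of_tendsto_pow_eight {z : ℕ → ℝ} (hz : ∀ k, -1 ≤ z k)
    (h : Tendsto (fun n : ℕ => ((n ^ 8 : ℕ) : ℝ)⁻¹ * ∑ k ∈ Finset.range (n ^ 8), z k)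
      atTop (𝓝 0)) :
    Tendsto (fun N : ℕ => (N : ℝ)⁻¹ * ∑ k ∈ Finset.range N, z k) atTop (𝓝 0) := by
  let u : ℕ → ℝ := fun N => ∑ k ∈ Finset.range N, (1 + z k)
  have hu {N : ℕ} (hN : N ≠ 0) : u N / N = 1 + (N : ℝ)⁻¹ * ∑ k ∈ Finset.range N, z k := by
    have : (N : ℝ) ≠ 0 := by exact_mod_cast hN
    simp only [u, Finset.sum_add_distrib, Finset.sum_const, Finset.card_range, nsmul_eq_mul]
    field_simp
  have hmono : Monotone u := monotone_nat_of_le_succ fun N => by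
    simp only [u, Finset.sum_range_succ]
    linarith [hz N]
  have hlim : Tendsto (fun n => u n / n) atTop (𝓝 1) := by
    refine tendsto_div_of_monotone_of_exists_subseq_tendsto_div u 1 hmono fun a ha =>
      ⟨fun n => n ^ 8, ?_, tendsto_pow_atTop (by norm_num), ?_⟩
    · have h1 : Tendsto (fun n : ℕ => (1 + 1 / (n : ℝ)) ^ 8) atTop (𝓝 1) := by
        simpa using (tendsto_one_div_atTop_nhds_zero_nat.const_add (1 : ℝ)).pow 8
      filter_upwards [h1.eventually_lt_const ha, eventually_gt_atTop 0] with n hn hn0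
      have hn0' : (0 : ℝ) < n := by exact_mod_cast hn0
      have : (((n + 1) ^ 8 : ℕ) : ℝ) = (1 + 1 / (n : ℝ)) ^ 8 * ((n ^ 8 : ℕ) : ℝ) := by
        push_cast
        rw [← mul_pow, add_mul, one_div, inv_mul_cancel₀ hn0'.ne', one_mul]
      rw [this]
      gcongr
    · have := h.const_add 1
      rw [add_zero] at this
      refine this.congr' ?_
      filter_upwards [eventually_ne_atTop 0] with n hn
      exact (hu (pow_ne_zero 8 hn)).symm
  have := hlim.sub_const 1
  rw [sub_self] at this
  refine this.congr' ?_
  filter_upwards [eventually_ne_atTop 0] with n hn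
  rw [hu hn]; ring

/-- An integer `b ≥ 2` such that `log b / log 3` is irrational is `3 ^ a * c` with `c ≥ 2` prime
to `3`. -/
theorem exists_eq_three_pow_mul_of_irrational {b : ℕ} (hb : 2 ≤ b)
    (hirr : Irrational (Real.log b / Real.log 3)) :
    ∃ a c : ℕ, 2 ≤ c ∧ ¬ 3 ∣ c ∧ b = 3 ^ a * c := by
  obtain ⟨a, c, hc, rfl⟩ := Nat.exists_eq_pow_mul_and_not_dvd (show b ≠ 0 by omega) 3 (by norm_num)
  refine ⟨a, c, ?_, hc, rfl⟩
  by_contra! h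
  have hc1 : c = 1 := by
    have : c ≠ 0 := by rintro rfl; simp at hc
    omega
  subst hc1
  refine hirr ⟨a, ?_⟩
  have : Real.log 3 ≠ 0 := (Real.log_pos (by norm_num)).ne'
  push_cast
  rw [mul_one, Real.log_pow, mul_div_cancel_right₀ _ this]

/-- The averaged exponential sums along `(b ^ k * x)` have power-saving second moment. -/
theorem exists_integral_norm_average_sq_le {μ : Measure ℝ} [IsProbabilityMeasure μ]
    (hself : μ = ENNReal.ofReal (1/2) • Measure.map (fun x => x / 3) μ
        + ENNReal.ofReal (1/2) • Measure.map (fun x => x / 3 + 2 / 3) μ)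
    {a c : ℕ} (hc : 2 ≤ c) (h3 : ¬ 3 ∣ c) {h : ℤ} (hh : h ≠ 0) :
    ∃ K : ℝ, 0 ≤ K ∧ ∀ r N : ℕ, 3 ^ r ≤ N →
      ∫ x : ℝ, ‖(N : ℂ)⁻¹ * ∑ k ∈ Finset.range N, Complex.exp
        ((2 * Real.pi * ((h * ((3 ^ a * c : ℕ) : ℤ) ^ k : ℤ) : ℝ) : ℝ) * x * Complex.I)‖ ^ 2 ∂μ
        ≤ 2 / N + K * (3 / 4) ^ r := by
  obtain ⟨K, hK, hbound⟩ := exists_sum_norm_charFun_le hself (a := a) hc h3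
  refine ⟨2 * K, by positivity, fun r N hN => ?_⟩
  have hNpos : 0 < N := (by positivity : 0 < 3 ^ r).trans_le hN
  have hNpos' : (0 : ℝ) < N := by exact_mod_cast hNpos
  set b : ℕ := 3 ^ a * c with hb_def
  have hb : 2 ≤ b := hc.trans (Nat.le_mul_of_pos_left c (by positivity))
  let t : ℕ → ℝ := fun k => 2 * Real.pi * ((h * (b : ℤ) ^ k : ℤ) : ℝ)
  have hsymm (k l : ℕ) : ‖charFun μ (t k - t l)‖ = ‖charFun μ (t l - t k)‖ := by
    rw [← neg_sub, charFun_neg, RCLike.norm_conj]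
  have hdiff (d : ℕ) (hd : d ≠ 0) :
      ∑ l ∈ Finset.range N, ‖charFun μ (t (l + d) - t l)‖ ≤ K * N * (3 / 4) ^ r := by
    have hne : h * ((b : ℤ) ^ d - 1) ≠ 0 := by
      refine mul_ne_zero hh (sub_ne_zero.2 ?_)
      exact_mod_cast (Nat.one_lt_pow hd (by omega)).ne'
    refine le_of_eq_of_le (Finset.sum_congr rfl fun l _ => ?_) (hbound _ hne r N hN)
    simp only [t]
    congr 2
    push_cast
    ring
  have hzero : ∑ l ∈ Finset.range N, ‖charFun μ (t (l + 0) - t l)‖ ≤ N := by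
    simp
  have hdouble : ∑ d ∈ Finset.range N, ∑ l ∈ Finset.range N, ‖charFun μ (t (l + d) - t l)‖
      ≤ N + N * (K * N * (3 / 4) ^ r) := by
    have : ∀ d ∈ Finset.range N, ∑ l ∈ Finset.range N, ‖charFun μ (t (l + d) - t l)‖
        ≤ (if d = 0 then (N : ℝ) else 0) + K * N * (3 / 4) ^ r := by
      intro d _
      split_ifs with hd
      · subst hd
        exact hzero.trans (le_add_of_nonneg_right (by positivity))
      · rw [zero_add]; exact hdiff d hd
    refine (Finset.sum_le_sum this).trans (le_of_eq ?_)
    simp [Finset.sum_add_distrib, hNpos]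
  have hmain := (integral_norm_sum_exp_sq_le μ t N).trans
    ((sum_sum_le_of_symm (fun k l => norm_nonneg _) hsymm N).trans
      (mul_le_mul_of_nonneg_left hdouble zero_le_two))
  simp only [norm_mul, mul_pow, norm_inv, Complex.norm_natCast]
  rw [integral_const_mul]
  refine (mul_le_mul_of_nonneg_left hmain (by positivity)).trans (le_of_eq ?_)
  field_simp

/-- The exponential sums along `(b ^ k * x)` are `o(N)` for almost every `x` with respect to the
Cantor–Lebesgue measure. -/
theorem ae_tendsto_average_exp {μ : Measure ℝ} [IsProbabilityMeasure μ]
    (hself : μ = ENNReal.ofReal (1/2) • Measure.map (fun x => x / 3) μ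
        + ENNReal.ofReal (1/2) • Measure.map (fun x => x / 3 + 2 / 3) μ)
    {a c : ℕ} (hc : 2 ≤ c) (h3 : ¬ 3 ∣ c) {h : ℤ} (hh : h ≠ 0) :
    ∀ᵐ x : ℝ ∂μ, Tendsto (fun N : ℕ => (N : ℂ)⁻¹ * ∑ k ∈ Finset.range N, Complex.exp
        ((2 * Real.pi * ((h * ((3 ^ a * c : ℕ) : ℤ) ^ k : ℤ) : ℝ) : ℝ) * x * Complex.I))
      atTop (𝓝 0) := by
  obtain ⟨K, hK, hbound⟩ := exists_integral_norm_average_sq_le hself (a := a) hc h3 hh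
  let t : ℕ → ℝ := fun k => 2 * Real.pi * ((h * ((3 ^ a * c : ℕ) : ℤ) ^ k : ℤ) : ℝ)
  let A : ℕ → ℝ → ℂ := fun N x =>
    (N : ℂ)⁻¹ * ∑ k ∈ Finset.range N, Complex.exp (t k * x * Complex.I)
  have hnormexp (k : ℕ) (x : ℝ) : ‖Complex.exp (t k * x * Complex.I)‖ = 1 := by
    rw [← Complex.ofReal_mul, Complex.norm_exp_ofReal_mul_I]
  have hA1 (N : ℕ) (x : ℝ) : ‖A N x‖ ≤ 1 := by
    simp only [A, norm_mul, norm_inv, Complex.norm_natCast]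
    have := norm_sum_le_of_le (Finset.range N) fun k _ => (hnormexp k x).le
    rw [Finset.sum_const, Finset.card_range, nsmul_one] at this
    exact inv_mul_le_one_of_le₀ this (by positivity)
  have hint (N : ℕ) : Integrable (fun x => ‖A N x‖ ^ 2) μ := by
    refine (integrable_const (1 : ℝ)).mono' (by fun_prop) (ae_of_all _ fun x => ?_)
    rw [Real.norm_of_nonneg (by positivity)]
    exact pow_le_one₀ (norm_nonneg _) (hA1 N x)
  have hdecay (n : ℕ) : ∫ x, ‖A (n ^ 8) x‖ ^ 2 ∂μ ≤ (2 + K * (4 / 3)) * (1 / (n : ℝ) ^ 2) := by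
    rcases Nat.eq_zero_or_pos n with rfl | hn
    · simp [A]
    have hn' : (1 : ℝ) ≤ n := by exact_mod_cast hn
    have hlow := Nat.pow_log_le_self 3 (pow_pos hn 8).ne'
    have hup := Nat.lt_pow_succ_log_self (b := 3) (by norm_num) (n ^ 8)
    set r := Nat.log 3 (n ^ 8)
    have hr : (n : ℝ) ^ 2 ≤ (4 / 3) ^ (r + 1) := by
      refine le_of_pow_le_pow_left₀ (n := 4) (by norm_num) (by positivity) ?_
      calc ((n : ℝ) ^ 2) ^ 4 = ((n ^ 8 : ℕ) : ℝ) := by push_cast; ring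
        _ ≤ 3 ^ (r + 1) := by exact_mod_cast hup.le
        _ ≤ ((4 / 3) ^ 4) ^ (r + 1) := by gcongr; norm_num
        _ = _ := by rw [← pow_mul, ← pow_mul, mul_comm]
    have hr' : (3 / 4 : ℝ) ^ r ≤ 4 / 3 * (1 / (n : ℝ) ^ 2) := by
      calc (3 / 4 : ℝ) ^ r = 4 / 3 * (1 / (4 / 3) ^ (r + 1)) := by
            rw [← one_div_pow, pow_succ, show (1 / (4 / 3) : ℝ) = 3 / 4 by norm_num]; ring
        _ ≤ _ := by gcongr
    have h8 : 2 / ((n ^ 8 : ℕ) : ℝ) ≤ 2 * (1 / (n : ℝ) ^ 2) := by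
      rw [mul_one_div]
      push_cast
      gcongr
      norm_num
    calc _ ≤ 2 / ((n ^ 8 : ℕ) : ℝ) + K * (3 / 4) ^ r := hbound r (n ^ 8) hlow
      _ ≤ 2 * (1 / (n : ℝ) ^ 2) + K * (4 / 3 * (1 / (n : ℝ) ^ 2)) := by gcongr
      _ = _ := by ring
  have hsum : Summable fun n : ℕ => ∫ x, ‖A (n ^ 8) x‖ ^ 2 ∂μ :=
    Summable.of_nonneg_of_le (fun n => integral_nonneg fun x => by positivity) hdecay
      ((Real.summable_one_div_nat_pow.2 one_lt_two).mul_left _)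
  filter_upwards [ae_tendsto_zero_of_summable_integral (fun n => hint (n ^ 8))
    (fun n x => by positivity) hsum] with x hx
  have hsub : Tendsto (fun n : ℕ => A (n ^ 8) x) atTop (𝓝 0) := by
    rw [tendsto_zero_iff_norm_tendsto_zero]
    simpa using hx.sqrt
  have hre (N : ℕ) : (A N x).re
      = (N : ℝ)⁻¹ * ∑ k ∈ Finset.range N, (Complex.exp (t k * x * Complex.I)).re := by
    simp only [A]
    rw [← Complex.ofReal_natCast, ← Complex.ofReal_inv, Complex.re_ofReal_mul, Complex.re_sum]
  have him (N : ℕ) : (A N x).im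
      = (N : ℝ)⁻¹ * ∑ k ∈ Finset.range N, (Complex.exp (t k * x * Complex.I)).im := by
    simp only [A]
    rw [← Complex.ofReal_natCast, ← Complex.ofReal_inv, Complex.im_ofReal_mul, Complex.im_sum]
  have h1 := tendsto_average_of_tendsto_pow_eight
    (z := fun k => (Complex.exp (t k * x * Complex.I)).re)
    (fun k => (abs_le.1 ((Complex.abs_re_le_norm _).trans (hnormexp k x).le)).1) (by
      simp only [← hre]
      exact (Complex.continuous_re.tendsto 0).comp hsub)
  have h2 := tendsto_average_of_tendsto_pow_eight
    (z := fun k => (Complex.exp (t k * x * Complex.I)).im)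
    (fun k => (abs_le.1 ((Complex.abs_im_le_norm _).trans (hnormexp k x).le)).1) (by
      simp only [← him]
      exact (Complex.continuous_im.tendsto 0).comp hsub)
  simp only [← hre] at h1
  simp only [← him] at h2
  change Tendsto (fun N => A N x) atTop (𝓝 0)
  simpa only [Complex.re_add_im, Complex.ofReal_zero, zero_mul, add_zero] using
    h1.ofReal.add (h2.ofReal.mul_const Complex.I)

/-- Let `μ` be the Cantor–Lebesgue measure on the middle-thirds Cantor set,
i.e. the unique Borel probability measure with `μ = ½(f₁)₌μ + ½(f₂)₌μ`, `f₁(x)=x/3`,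
`f₂(x)=x/3+2/3`. If `b ≥ 2` is an integer with `log b / log 3` irrational, then `μ`-a.e.
`x` is normal in base `b`. -/
theorem stmt16
    (μ : Measure ℝ) (hprob : IsProbabilityMeasure μ)
    (hself : μ = ENNReal.ofReal (1/2) • Measure.map (fun x => x / 3) μ
        + ENNReal.ofReal (1/2) • Measure.map (fun x => x / 3 + 2 / 3) μ)
    (b : ℕ) (hb : 2 ≤ b)
    (hirr : Irrational (Real.log b / Real.log 3)) :
    ∀ᵐ x ∂μ, ∀ g : ℝ → ℝ, Continuous g →
      Tendsto (fun N : ℕ => (N : ℝ)⁻¹ * ∑ k ∈ Finset.range N, g (Int.fract ((b : ℝ) ^ k * x)))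
        atTop (𝓝 (∫ y in (0:ℝ)..1, g y)) := by
  obtain ⟨a, c, hc, h3, rfl⟩ := exists_eq_three_pow_mul_of_irrational hb hirr
  have hall : ∀ᵐ x : ℝ ∂μ, ∀ h : ℤ, h ≠ 0 →
      Tendsto (fun N : ℕ => (N : ℂ)⁻¹ * ∑ k ∈ Finset.range N, Complex.exp
        ((2 * Real.pi * ((h * ((3 ^ a * c : ℕ) : ℤ) ^ k : ℤ) : ℝ) : ℝ) * x * Complex.I))
      atTop (𝓝 0) := by
    rw [ae_all_iff]
    intro h
    by_cases hh : h = 0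
    · simp [hh]
    · filter_upwards [ae_tendsto_average_exp hself (a := a) hc h3 hh] with x hx _ using hx
  filter_upwards [hall] with x hx g hg
  refine tendsto_average_fract (fun m hm => (hx m hm).congr fun N => ?_) hg
  congr 1
  refine Finset.sum_congr rfl fun k _ => ?_
  rw [fourier_coe_apply]
  congr 1
  push_cast
  ring
end
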